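/- arXiv:1408.2932 — 3 statements merged into one kernel-verified Lean document; each statement's English description precedes it below -/
import Mathlib

section
/- Let E ⊂ ℝ^d be a compact set and let C be a connected component of E. Then there exists a sequence (φ_n)_{n∈ℕ} of C^∞ functions with compact support on ℝ^d such that: (1) 0 ≤ φ_n ≤ 1 on ℝ^d and φ_n(x) ∈ {0,1} for every x ∈ E and every n; (2) φ_n(x) = 1 for every x ∈ C and every n; (3) φ_n(x) → 0 as n → ∞ for every x ∈ E \ C; (4) the support of ∇φ_n is disjoint from E for every n. -/
open MeasureTheory Set Filter Topology
open scoped Topology ENNReal NNReal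

noncomputable section

/-- Smooth cutoff attached to a clopen subset of a compact set. -/
theorem exists_cutoff_of_isClopen {d : ℕ} {E : Set (EuclideanSpace ℝ (Fin d))}
    (hE : IsCompact E) (D : Set E) (hD : IsClopen D) :
    ∃ φ : (EuclideanSpace ℝ (Fin d)) → ℝ,
      ContDiff ℝ (⊤ : ℕ∞) φ ∧ HasCompactSupport φ ∧ (∀ x, φ x ∈ Set.Icc (0:ℝ) 1) ∧
      (∀ x : E, x ∈ D → φ x = 1) ∧ (∀ x : E, x ∉ D → φ x = 0) ∧
      tsupport (fun x => fderiv ℝ φ x) ∩ E = ∅ := by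
  have : CompactSpace E := isCompact_iff_compactSpace.mp hE
  have hA : IsCompact (Subtype.val '' D) := hD.1.isCompact.image continuous_subtype_val
  have hB : IsCompact (Subtype.val '' Dᶜ) :=
    hD.compl.1.isCompact.image continuous_subtype_val
  obtain ⟨R, hR⟩ := hA.isBounded.subset_ball 0
  have hs : IsClosed (Subtype.val '' Dᶜ ∪ (Metric.ball (0 : EuclideanSpace ℝ (Fin d)) R)ᶜ) :=
    hB.isClosed.union Metric.isOpen_ball.isClosed_compl
  have hdisj : Disjoint (Subtype.val '' Dᶜ ∪ (Metric.ball (0 : EuclideanSpace ℝ (Fin d)) R)ᶜ)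
      (Subtype.val '' D) := by
    rw [Set.disjoint_left]
    rintro x (⟨y, hy, rfl⟩ | hx) ⟨z, hz, hzx⟩
    · exact hy (Subtype.ext hzx ▸ hz)
    · exact hx (hR ⟨z, hz, hzx⟩)
  obtain ⟨f, h0, h1, hf⟩ := exists_contMDiffMap_zero_one_nhds_of_isClosed (n := (⊤ : ℕ∞))
    (modelWithCornersSelf ℝ (EuclideanSpace ℝ (Fin d))) hs hA.isClosed hdisj
  rw [eventually_nhdsSet_iff_forall] at h0 h1
  have hone : ∀ x : E, x ∈ D → ∀ᶠ y in 𝓝 (x : EuclideanSpace ℝ (Fin d)), f y = 1 :=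
    fun x hx => h1 x ⟨x, hx, rfl⟩
  have hzero : ∀ x : E, x ∉ D → ∀ᶠ y in 𝓝 (x : EuclideanSpace ℝ (Fin d)), f y = 0 :=
    fun x hx => h0 x (Or.inl ⟨x, hx, rfl⟩)
  refine ⟨f, f.contMDiff.contDiff, ?_, hf, fun x hx => (hone x hx).self_of_nhds,
    fun x hx => (hzero x hx).self_of_nhds, ?_⟩
  · refine HasCompactSupport.intro (isCompact_closedBall (0 : EuclideanSpace ℝ (Fin d)) R) ?_
    intro x hx
    exact (h0 x (Or.inr fun h => hx (Metric.ball_subset_closedBall h))).self_of_nhds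
  · rw [← Set.disjoint_iff_inter_eq_empty, Set.disjoint_right]
    intro x hx
    rw [notMem_tsupport_iff_eventuallyEq]
    have key : ∃ c : ℝ, ∀ᶠ y in 𝓝 x, f y = c := by
      by_cases h : (⟨x, hx⟩ : E) ∈ D
      · exact ⟨1, hone _ h⟩
      · exact ⟨0, hzero _ h⟩
    obtain ⟨c, hc⟩ := key
    filter_upwards [hc.eventually_nhds] with y hy
    have : f =ᶠ[𝓝 y] fun _ => c := hy
    rw [this.fderiv_eq]
    simp

/-- In a compact metrizable space a component is the intersection of a decreasing sequence of
clopen sets. -/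
theorem exists_clopen_seq {X : Type*} [TopologicalSpace X] [T2Space X] [CompactSpace X]
    [SecondCountableTopology X] (x : X) :
    ∃ D : ℕ → Set X, (∀ n, IsClopen (D n)) ∧ (∀ n, connectedComponent x ⊆ D n) ∧
      ∀ y, y ∉ connectedComponent x → ∀ᶠ n in atTop, y ∉ D n := by
  obtain ⟨T, hT, hTU⟩ := TopologicalSpace.isOpen_iUnion_countable
    (fun s : { s : Set X // IsClopen s ∧ x ∈ s } => (s : Set X)ᶜ) (fun s => s.2.1.compl.2)
  have hne : ({⟨univ, isClopen_univ, mem_univ x⟩} ∪ T :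
    Set { s : Set X // IsClopen s ∧ x ∈ s }).Nonempty := ⟨_, Or.inl rfl⟩
  obtain ⟨g, hg⟩ := ((Set.countable_singleton _).union hT).exists_eq_range hne
  refine ⟨fun n => ⋂ k ∈ Finset.range (n+1), (g k : Set X), fun n => ?_, fun n => ?_, ?_⟩
  · exact isClopen_biInter_finset fun k _ => (g k).2.1
  · exact Set.subset_iInter₂ fun k _ => (g k).2.1.connectedComponent_subset (g k).2.2
  · intro y hy
    rw [connectedComponent_eq_iInter_isClopen] at hy
    have hy2 : y ∈ ⋃ s : { s : Set X // IsClopen s ∧ x ∈ s }, (s : Set X)ᶜ := by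
      rw [← Set.compl_iInter]; exact hy
    rw [← hTU] at hy2
    obtain ⟨s, hs, hys⟩ := Set.mem_iUnion₂.mp hy2
    have hs2 : s ∈ Set.range g := hg ▸ Or.inr hs
    obtain ⟨k, rfl⟩ := hs2
    filter_upwards [eventually_ge_atTop k] with n hn h
    exact hys (Set.mem_iInter₂.mp h k (Finset.mem_range.mpr (by omega)))

/-- **Separation of a connected component of a compact set by smooth test functions.**
If `E ⊆ ℝ^d` is compact and `C` is a connected component of `E`, then there is a sequence
`φ n ∈ C_c^∞(ℝ^d)` with `0 ≤ φ n ≤ 1`, `φ n ∈ {0,1}` on `E`, `φ n = 1` on `C`,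
`φ n x → 0` for every `x ∈ E \ C`, and `supp ∇(φ n) ∩ E = ∅`. -/
theorem separation_of_component_by_test_functions
    (d : ℕ) (E : Set (EuclideanSpace ℝ (Fin d))) (hE : IsCompact E)
    (C : Set (EuclideanSpace ℝ (Fin d)))
    (hC : ∃ x ∈ E, C = connectedComponentIn E x) :
    ∃ φ : ℕ → (EuclideanSpace ℝ (Fin d)) → ℝ,
      (∀ n, ContDiff ℝ (⊤ : ℕ∞) (φ n)) ∧
      (∀ n, HasCompactSupport (φ n)) ∧
      (∀ n x, φ n x ∈ Set.Icc (0:ℝ) 1) ∧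
      (∀ n, ∀ x ∈ E, φ n x = 0 ∨ φ n x = 1) ∧
      (∀ n, ∀ x ∈ C, φ n x = 1) ∧
      (∀ x ∈ E \ C, Tendsto (fun n => φ n x) atTop (𝓝 0)) ∧
      (∀ n, tsupport (fun x => fderiv ℝ (φ n) x) ∩ E = ∅) := by
  obtain ⟨x, hx, rfl⟩ := hC
  have : CompactSpace E := isCompact_iff_compactSpace.mp hE
  obtain ⟨D, hD, hsub, hev⟩ := exists_clopen_seq (⟨x, hx⟩ : E)
  choose φ h1 h2 h3 h4 h5 h6 using fun n => exists_cutoff_of_isClopen hE (D n) (hD n)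
  rw [connectedComponentIn_eq_image hx]
  refine ⟨φ, h1, h2, h3, ?_, ?_, ?_, h6⟩
  · intro n y hy
    by_cases h : (⟨y, hy⟩ : E) ∈ D n
    · exact Or.inr (h4 n _ h)
    · exact Or.inl (h5 n _ h)
  · rintro n _ ⟨y, hy, rfl⟩
    exact h4 n y (hsub n hy)
  · rintro y ⟨hy, hyC⟩
    refine tendsto_const_nhds.congr' ?_
    filter_upwards [hev ⟨y, hy⟩ fun h => hyC ⟨_, h, rfl⟩] with n hn
    exact (h5 n _ hn).symm
end
end

section
/- Let Ω ⊂ ℝ² be open and let C ⊂ Ω be a simple Ω-closed Lipschitz curve with Lipschitz parametrization γ (defined on ℝ/(ℓℤ) if C is closed, or on [0,ℓ] with γ(0), γ(ℓ) ∈ ∂Ω otherwise) satisfying γ'(t) ≠ 0 for a.e. t. Let B : Ω → ℝ² be a bounded Borel vector field such that |B(x)| = 1 and B(x) is tangent to C for H¹-a.e. x ∈ C (i.e. B(γ(t)) is parallel to γ'(t) for a.e. t). If ∫_C B(x)·∇φ(x) dH¹(x) = 0 for every φ ∈ C_c^∞(Ω), then there exists a constant σ ∈ {+1, −1} such that γ'(t)/|γ'(t)|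 = σ·B(γ(t)) for a.e. t; consequently C admits a Lipschitz parametrization which agrees with B, meaning γ'(t)·B(γ(t)) > 0 for a.e. t. -/
open MeasureTheory Set Filter
open scoped Topology ENNReal NNReal RealInnerProductSpace

noncomputable section

/-- A simple `Ω`-closed Lipschitz curve `C ⊆ Ω` together with a Lipschitz parametrization:
either a closed curve (periodic parametrization, injective on one period) or a curve whose
endpoints lie on `∂Ω`.  The curve has finite `H¹`-measure. -/
structure SimpleOmegaClosedCurve (Ω C : Set (EuclideanSpace ℝ (Fin 2))) where
  len : ℝ
  len_pos : 0 < len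
  γ : ℝ → EuclideanSpace ℝ (Fin 2)
  K : ℝ≥0
  lip : LipschitzWith K γ
  dom : Set ℝ
  cases : (Function.Periodic γ len ∧ dom = Set.Ico 0 len ∧ Set.InjOn γ dom ∧ C = γ '' dom)
    ∨ (dom = Set.Ioo 0 len ∧ Set.InjOn γ dom ∧ C = γ '' dom ∧
        γ 0 ∈ frontier Ω ∧ γ len ∈ frontier Ω ∧ γ '' Set.Icc 0 len ⊆ closure Ω)
  sub : C ⊆ Ω
  finlen : μH[1] C ≠ ⊤

/-- A parametrization `Q` with a.e. derivative `g` *agrees with* the vector field `B` if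
`γ'(t) · B(γ(t)) > 0` for a.e. `t` in the domain of the parametrization. -/
def AgreesWith {Ω C : Set (EuclideanSpace ℝ (Fin 2))} (Q : SimpleOmegaClosedCurve Ω C)
    (g : ℝ → EuclideanSpace ℝ (Fin 2)) (B : EuclideanSpace ℝ (Fin 2) → EuclideanSpace ℝ (Fin 2)) :
    Prop :=
  ∀ᵐ t ∂(volume.restrict Q.dom), HasDerivAt Q.γ (g t) t ∧ 0 < ⟪g t, B (Q.γ t)⟫

/-- Smooth cutoff between a compact set and an open neighbourhood. -/
theorem exists_cutoff {K U : Set (EuclideanSpace ℝ (Fin 2))} (hK : IsCompact K) (hU : IsOpen U)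
    (hKU : K ⊆ U) : ∃ φ : EuclideanSpace ℝ (Fin 2) → ℝ, ContDiff ℝ (⊤ : ℕ∞) φ ∧
      HasCompactSupport φ ∧ tsupport φ ⊆ U ∧ ∀ x ∈ K, φ x = 1 := by
  obtain ⟨V, hVo, hKV, hVU, hVc⟩ := exists_open_between_and_isCompact_closure hK hU hKU
  obtain ⟨f, h0, h1, -⟩ := exists_contMDiffMap_zero_one_of_isClosed
    (modelWithCornersSelf ℝ (EuclideanSpace ℝ (Fin 2))) (n := ⊤) hVo.isClosed_compl hK.isClosed
    (Set.disjoint_left.2 fun x hx hx' => hx (hKV hx'))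
  have hs : tsupport f ⊆ closure V := by
    apply closure_mono
    intro x hx
    by_contra h
    exact hx (h0 h)
  refine ⟨f, f.contMDiff.contDiff, HasCompactSupport.of_support_subset_isCompact hVc
    (subset_closure.trans hs), hs.trans hVU, fun x hx => h1 hx⟩

theorem deriv_step_zero {y : ℝ} (h : y ≤ 0 ∨ 1 ≤ y) : deriv Real.smoothTransition y = 0 := by
  rcases h with h | h
  · apply IsLocalMin.deriv_eq_zero
    exact Filter.Eventually.of_forall fun z => by
      rw [Real.smoothTransition.zero_of_nonpos h]; exact Real.smoothTransition.nonneg z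
  · apply IsLocalMax.deriv_eq_zero
    exact Filter.Eventually.of_forall fun z => by
      rw [Real.smoothTransition.one_of_one_le h]; exact Real.smoothTransition.le_one z

theorem step_cont : Continuous (deriv Real.smoothTransition) :=
  (Real.smoothTransition.contDiff (n := 1)).continuous_deriv le_rfl

theorem step_diff : Differentiable ℝ Real.smoothTransition :=
  (Real.smoothTransition.contDiff (n := 1)).differentiable (by simp)

theorem step_cs : HasCompactSupport (deriv Real.smoothTransition) := by
  apply HasCompactSupport.of_support_subset_isCompact (isCompact_Icc (a := (0:ℝ)) (b := 1))
  intro y hy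
  by_contra h
  apply hy
  apply deriv_step_zero
  simp only [Set.mem_Icc, not_and_or, not_le] at h
  exact h.imp le_of_lt le_of_lt

theorem ramp_limit {q p : ℝ → ℝ} {t0 δ : ℝ} (hδ : 0 < δ) (hp : Continuous p)
    (hpc : ∀ t, |t - t0| ≤ δ → |p t - (t - t0)| ≤ |t - t0| / 2) (hpd : HasDerivAt p 1 t0)
    (hp0 : p t0 = 0) (hq : Integrable q)
    (hL : Tendsto (fun h : ℝ => ⨍ y in Metric.closedBall t0 (2 * h), |q y - q t0|) (𝓝[>] 0) (𝓝 0)) :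
    Tendsto (fun h => ∫ t in Ioo (t0 - δ) (t0 + δ),
      q t * (deriv Real.smoothTransition (p t / h) / h)) (𝓝[>] 0) (𝓝 (q t0)) := by
  obtain ⟨M, hM⟩ := step_cs.exists_bound_of_continuous step_cont
  have hM0 : 0 ≤ M := (norm_nonneg _).trans (hM 0)
  rw [Metric.tendsto_nhds]
  intro ε hε
  obtain ⟨η, hη, hu⟩ := Metric.uniformContinuous_iff.1
    (step_cs.uniformContinuous_of_continuous step_cont) (ε / (8 * (|q t0| + 1))) (by positivity)
  have h1 : ∀ᶠ t in 𝓝 t0, |p t - (t - t0)| ≤ η / 4 * |t - t0| := by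
    have := (hasDerivAt_iff_isLittleO.1 hpd).def (c := η / 4) (by positivity)
    filter_upwards [this] with t ht
    simpa [hp0] using ht
  obtain ⟨r, hr, h1⟩ := Metric.eventually_nhds_iff.1 h1
  have h2 : ∀ᶠ h in 𝓝[>] (0:ℝ), ⨍ y in Metric.closedBall t0 (2 * h), |q y - q t0| < ε / (8 * (M + 1)) :=
    hL.eventually (gt_mem_nhds (by positivity))
  have h3 : ∀ᶠ h in 𝓝[>] (0:ℝ), h ∈ Ioo 0 (min (δ / 4) (r / 4)) :=
    Ioo_mem_nhdsGT (by positivity)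
  filter_upwards [h2, h3] with h h2 h3
  obtain ⟨h0, h3⟩ := h3
  have hδ' : h < δ / 4 := h3.trans_le (min_le_left _ _)
  have hr' : h < r / 4 := h3.trans_le (min_le_right _ _)
  set Bl := Metric.closedBall t0 (2 * h) with hBl
  have hBI : Bl = Icc (t0 - 2 * h) (t0 + 2 * h) := Real.closedBall_eq_Icc
  have e1 : ∫ t in Ioo (t0 - δ) (t0 + δ), q t * (deriv Real.smoothTransition (p t / h) / h)
      = ∫ t in Bl, q t * (deriv Real.smoothTransition (p t / h) / h) := by
    apply setIntegral_eq_of_subset_of_forall_sdiff_eq_zero measurableSet_Ioo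
    · rw [hBI]; intro t ht; constructor <;> linarith [ht.1, ht.2]
    · intro t ht
      have h5 := hpc t (by rw [abs_le]; constructor <;> linarith [ht.1.1, ht.1.2])
      have h6 : 2 * h < |t - t0| := by
        have := ht.2
        simpa [hBl, Real.dist_eq] using this
      rw [deriv_step_zero]
      · simp
      · rcases le_total 0 (t - t0) with h7 | h7
        · right
          rw [abs_of_nonneg h7] at h5 h6
          rw [le_div_iff₀ h0]
          have := (abs_le.1 h5).1
          linarith
        · left
          rw [abs_of_nonpos h7] at h5 h6
          have := (abs_le.1 h5).2
          apply div_nonpos_of_nonpos_of_nonneg _ h0.le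
          linarith
  have e2 : q t0 = ∫ t in Bl, q t0 * (deriv Real.smoothTransition ((t - t0) / h) / h) := by
    rw [integral_const_mul, hBI, integral_Icc_eq_integral_Ioc,
      ← intervalIntegral.integral_of_le (by linarith)]
    have hd : ∀ t, HasDerivAt (fun t => Real.smoothTransition ((t - t0) / h))
        (deriv Real.smoothTransition ((t - t0) / h) / h) t := by
      intro t
      have := (step_diff ((t - t0) / h)).hasDerivAt.comp t
        (((hasDerivAt_id t).sub_const t0).div_const h)
      simpa [Function.comp_def, div_eq_mul_inv] using this
    rw [intervalIntegral.integral_eq_sub_of_hasDerivAt (fun t _ => hd t)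
      (Continuous.intervalIntegrable (by
        have := step_cont
        fun_prop) _ _)]
    rw [Real.smoothTransition.one_of_one_le, Real.smoothTransition.zero_of_nonpos]
    · simp
    · apply div_nonpos_of_nonpos_of_nonneg _ h0.le
      linarith
    · rw [le_div_iff₀ h0]; linarith
  have hfin : volume Bl ≠ ⊤ := by rw [hBI]; simp
  have i1 : IntegrableOn (fun t => q t * (deriv Real.smoothTransition (p t / h) / h)) Bl := by
    apply Integrable.mul_bdd (c := M / h) hq.integrableOn
    · have := step_cont
      exact (by fun_prop : Continuous _).aestronglyMeasurable
    · refine Filter.Eventually.of_forall fun t => ?_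
      rw [norm_div, Real.norm_of_nonneg h0.le]
      gcongr
      exact hM _
  have i2 : IntegrableOn (fun t => q t0 * (deriv Real.smoothTransition ((t - t0) / h) / h)) Bl := by
    have := step_cont
    rw [hBI]
    exact (by fun_prop : Continuous _).integrableOn_Icc
  have i3 : IntegrableOn (fun t => |q t - q t0|) Bl :=
    (hq.integrableOn.sub (integrableOn_const hfin)).abs
  have hvol : volume.real Bl = 4 * h := by
    rw [hBI, Real.volume_real_Icc_of_le (by linarith)]; ring
  rw [Real.dist_eq, e1]
  nth_rw 1 [e2]
  rw [← integral_sub i1 i2]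
  have key : ∀ t ∈ Bl, ‖q t * (deriv Real.smoothTransition (p t / h) / h) -
      q t0 * (deriv Real.smoothTransition ((t - t0) / h) / h)‖ ≤
      (M / h) * |q t - q t0| + ε / (8 * h) := by
    intro t ht
    have ht' : |t - t0| ≤ 2 * h := by simpa [hBl, Real.dist_eq] using ht
    have a1 := h1 (y := t) (by rw [Real.dist_eq]; linarith)
    have a2 : |p t / h - (t - t0) / h| < η := by
      rw [← sub_div, abs_div, abs_of_pos h0, div_lt_iff₀ h0]
      nlinarith
    have a3 := (hu (a := p t / h) (b := (t - t0) / h) (by rwa [Real.dist_eq])).le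
    rw [Real.dist_eq] at a3
    have a4 := hM (p t / h)
    rw [Real.norm_eq_abs] at a4 ⊢
    set A := deriv Real.smoothTransition (p t / h)
    set A' := deriv Real.smoothTransition ((t - t0) / h)
    have : q t * (A / h) - q t0 * (A' / h) = ((q t - q t0) * A + q t0 * (A - A')) / h := by ring
    rw [this, abs_div, abs_of_pos h0]
    have b1 : |q t0 * (A - A')| ≤ ε / 8 := by
      rw [abs_mul]
      calc |q t0| * |A - A'| ≤ (|q t0| + 1) * (ε / (8 * (|q t0| + 1))) := by
            gcongr; linarith
        _ = ε / 8 := by field_simp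
    have b2 : |(q t - q t0) * A| ≤ M * |q t - q t0| := by
      rw [abs_mul, mul_comm]; gcongr
    calc _ ≤ (M * |q t - q t0| + ε / 8) / h := by
            gcongr; exact (abs_add_le _ _).trans (add_le_add b2 b1)
      _ = _ := by field_simp
  have hBm : MeasurableSet Bl := Metric.isClosed_closedBall.measurableSet
  have i4 : IntegrableOn (fun t => (M / h) * |q t - q t0| + ε / (8 * h)) Bl :=
    (i3.const_mul _).add (integrableOn_const hfin)
  rw [← Real.norm_eq_abs]
  calc _ ≤ ∫ t in Bl, ((M / h) * |q t - q t0| + ε / (8 * h)) := by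
        refine norm_integral_le_of_norm_le i4 ?_
        exact (ae_restrict_iff' hBm).2 (Filter.Eventually.of_forall key)
    _ = (M / h) * (∫ t in Bl, |q t - q t0|) + ε / 2 := by
        rw [integral_add (i3.const_mul _) (integrableOn_const hfin), integral_const_mul,
          setIntegral_const, hvol, smul_eq_mul]
        field_simp
        ring
    _ < ε := by
        rw [setAverage_eq, hvol, smul_eq_mul] at h2
        have : (∫ t in Bl, |q t - q t0|) < 4 * h * (ε / (8 * (M + 1))) := by
          rwa [inv_mul_lt_iff₀ (by positivity)] at h2
        have c1 : (M / h) * (∫ t in Bl, |q t - q t0|) ≤ (M / h) * (4 * h * (ε / (8 * (M + 1)))) := by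
          gcongr
        have c2 : (M / h) * (4 * h * (ε / (8 * (M + 1)))) = M / (M + 1) * (ε / 2) := by
          field_simp; ring
        have c3 : M / (M + 1) < 1 := by rw [div_lt_one (by positivity)]; linarith
        nlinarith

/-- The chain rule along a curve, in gradient form. -/
theorem hasDerivAt_comp_curve {γ : ℝ → EuclideanSpace ℝ (Fin 2)} {φ : EuclideanSpace ℝ (Fin 2) → ℝ}
    {t : ℝ} {v : EuclideanSpace ℝ (Fin 2)} (hφ : Differentiable ℝ φ) (hγ : HasDerivAt γ v t) :
    HasDerivAt (fun s => φ (γ s)) ⟪v, gradient φ (γ t)⟫ t := by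
  have h := (hφ (γ t)).hasGradientAt.hasFDerivAt.comp_hasDerivAt t hγ
  rw [real_inner_comm]
  simpa [Function.comp_def] using h

/-- The local coordinate along the tangent at a differentiability point. -/
theorem local_coord {γ : ℝ → EuclideanSpace ℝ (Fin 2)} {v : EuclideanSpace ℝ (Fin 2)} {t0 : ℝ}
    (hv : v ≠ 0) (hγ : HasDerivAt γ v t0) :
    HasDerivAt (fun t => ⟪γ t - γ t0, (‖v‖ ^ 2)⁻¹ • v⟫) 1 t0 ∧
    ∃ δ > 0, ∀ t, |t - t0| ≤ δ →
      |⟪γ t - γ t0, (‖v‖ ^ 2)⁻¹ • v⟫ - (t - t0)| ≤ |t - t0| / 2 := by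
  have h1 : HasDerivAt (fun t => ⟪γ t - γ t0, (‖v‖ ^ 2)⁻¹ • v⟫) 1 t0 := by
    have := (hγ.sub_const (γ t0)).inner ℝ (hasDerivAt_const t0 ((‖v‖ ^ 2)⁻¹ • v))
    have hn : ‖v‖ ≠ 0 := norm_ne_zero_iff.2 hv
    rw [inner_zero_right, real_inner_smul_right, real_inner_self_eq_norm_sq,
      inv_mul_cancel₀ (pow_ne_zero 2 hn), zero_add] at this
    exact this
  refine ⟨h1, ?_⟩
  have h2 := (hasDerivAt_iff_isLittleO.1 h1).def (c := 1 / 2) (by norm_num)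
  obtain ⟨r, hr, h2⟩ := Metric.eventually_nhds_iff.1 h2
  refine ⟨r / 2, by positivity, fun t ht => ?_⟩
  have := h2 (y := t) (by rw [Real.dist_eq]; linarith)
  simp only [sub_self, inner_zero_left, sub_zero, smul_eq_mul, mul_one, Real.norm_eq_abs] at this
  linarith

theorem key_two {Ω : Set (EuclideanSpace ℝ (Fin 2))} (hΩ : IsOpen Ω)
    {γ : ℝ → EuclideanSpace ℝ (Fin 2)} (hγ : Continuous γ) {len : ℝ}
    (hsub : ∀ t ∈ Ioo 0 len, γ t ∈ Ω)
    (hinj : ∀ s ∈ Ioo 0 len, ∀ t ∈ Icc 0 len, γ s = γ t → s = t)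
    {F : ℝ → EuclideanSpace ℝ (Fin 2)} (hF : Integrable F)
    {g : ℝ → EuclideanSpace ℝ (Fin 2)} {f : ℝ → ℝ}
    (hFg : ∀ᵐ t ∂(volume.restrict (Ioo 0 len)), HasDerivAt γ (g t) t ∧ F t = f t • g t)
    (hint : ∀ φ : EuclideanSpace ℝ (Fin 2) → ℝ, ContDiff ℝ (⊤ : ℕ∞) φ → HasCompactSupport φ →
      tsupport φ ⊆ Ω → (∫ t in Ioo 0 len, ⟪F t, gradient φ (γ t)⟫) = 0)
    {t1 t2 : ℝ} (h01 : 0 < t1) (h12 : t1 < t2) (h2l : t2 < len)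
    (hg1 : g t1 ≠ 0) (hg2 : g t2 ≠ 0)
    (hd1 : HasDerivAt γ (g t1) t1) (hd2 : HasDerivAt γ (g t2) t2)
    (hL1 : Tendsto (fun h : ℝ => ⨍ y in Metric.closedBall t1 (2 * h), ‖F y - F t1‖) (𝓝[>] 0) (𝓝 0))
    (hL2 : Tendsto (fun h : ℝ => ⨍ y in Metric.closedBall t2 (2 * h), ‖F y - F t2‖) (𝓝[>] 0) (𝓝 0)) :
    ⟪F t1, (‖g t1‖ ^ 2)⁻¹ • g t1⟫ = ⟪F t2, (‖g t2‖ ^ 2)⁻¹ • g t2⟫ := by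
  obtain ⟨hp1, δ1, hδ1, hc1⟩ := local_coord hg1 hd1
  obtain ⟨hp2, δ2, hδ2, hc2⟩ := local_coord hg2 hd2
  set e1 := (‖g t1‖ ^ 2)⁻¹ • g t1 with he1
  set e2 := (‖g t2‖ ^ 2)⁻¹ • g t2 with he2
  set p1 : ℝ → ℝ := fun t => ⟪γ t - γ t1, e1⟫ with hp1def
  set p2 : ℝ → ℝ := fun t => ⟪γ t - γ t2, e2⟫ with hp2def
  have hp1c : Continuous p1 := by rw [hp1def]; fun_prop
  have hp2c : Continuous p2 := by rw [hp2def]; fun_prop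
  obtain ⟨δ, hδ, hδlt⟩ : ∃ δ > 0, δ < δ1 ∧ δ < δ2 ∧ δ < t1 ∧ δ < (t2 - t1) / 2 ∧ δ < len - t2 := by
    have hpos : 0 < min (min δ1 δ2) (min t1 (min ((t2 - t1) / 2) (len - t2))) := by
      refine lt_min (lt_min hδ1 hδ2) (lt_min h01 (lt_min ?_ ?_)) <;> linarith
    obtain ⟨δ, h0, h⟩ := exists_between hpos
    simp only [lt_min_iff] at h
    exact ⟨δ, h0, h.1.1, h.1.2, h.2.1, h.2.2.1, h.2.2.2⟩
  obtain ⟨hδa, hδb, hδc, hδd, hδe⟩ := hδlt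
  have hc1' : ∀ t, |t - t1| ≤ δ → |p1 t - (t - t1)| ≤ |t - t1| / 2 :=
    fun t ht => hc1 t (by linarith)
  have hc2' : ∀ t, |t - t2| ≤ δ → |p2 t - (t - t2)| ≤ |t - t2| / 2 :=
    fun t ht => hc2 t (by linarith)
  -- Lebesgue points of the projected fields
  have leb : ∀ (t0 : ℝ) (e : EuclideanSpace ℝ (Fin 2)),
      Tendsto (fun h : ℝ => ⨍ y in Metric.closedBall t0 (2 * h), ‖F y - F t0‖) (𝓝[>] 0) (𝓝 0) →
      Tendsto (fun h : ℝ => ⨍ y in Metric.closedBall t0 (2 * h), |⟪F y, e⟫ - ⟪F t0, e⟫|)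
        (𝓝[>] 0) (𝓝 0) := by
    intro t0 e hL
    have hL' := hL.const_mul ‖e‖
    rw [mul_zero] at hL'
    refine squeeze_zero (fun h => ?_) (fun h => ?_) hL'
    · rw [setAverage_eq]
      exact smul_nonneg (by positivity) (integral_nonneg fun _ => abs_nonneg _)
    · rw [setAverage_eq, setAverage_eq, smul_eq_mul, smul_eq_mul, mul_left_comm,
        ← integral_const_mul ‖e‖]
      have hfin : volume (Metric.closedBall t0 (2 * h)) ≠ ⊤ := measure_closedBall_lt_top.ne
      have i3 : IntegrableOn (fun y => F y - F t0) (Metric.closedBall t0 (2 * h)) :=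
        hF.integrableOn.sub (integrableOn_const hfin)
      refine mul_le_mul_of_nonneg_left (integral_mono ?_ ?_ ?_) (inv_nonneg.2 measureReal_nonneg)
      · simp only [← inner_sub_left]
        exact (i3.inner_const e).abs
      · exact i3.norm.const_mul _
      · intro y
        simp only [← inner_sub_left]
        rw [mul_comm]
        exact abs_real_inner_le_norm _ _
  have lim1 := ramp_limit (q := fun t => ⟪F t, e1⟫) hδ hp1c hc1' hp1 (by simp [hp1def])
    (hF.inner_const e1) (leb t1 e1 hL1)
  have lim2 := ramp_limit (q := fun t => ⟪F t, e2⟫) hδ hp2c hc2' hp2 (by simp [hp2def])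
    (hF.inner_const e2) (leb t2 e2 hL2)
  refine tendsto_nhds_unique_of_eventuallyEq lim1 lim2 ?_
  -- cutoffs
  have hclosed : ∀ a b : ℝ, IsClosed (γ '' Icc a b) := fun a b =>
    (isCompact_Icc.image hγ).isClosed
  have cut : ∀ a b c d : ℝ, 0 < a → b < len → c < a → b < d →
      ∃ φ : EuclideanSpace ℝ (Fin 2) → ℝ, ContDiff ℝ (⊤ : ℕ∞) φ ∧
      HasCompactSupport φ ∧ tsupport φ ⊆ Ω ∧ (∀ t ∈ Icc a b, φ (γ t) = 1) ∧
      (∀ t ∈ Icc 0 c, φ (γ t) = 0) ∧ (∀ t ∈ Icc d len, φ (γ t) = 0) := by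
    intro a b c d ha hb hca hbd
    by_cases hab : a ≤ b
    swap
    · refine ⟨fun _ => 0, contDiff_const, HasCompactSupport.zero, by simp [tsupport], ?_, by simp, by simp⟩
      intro t ht
      exact absurd (ht.1.trans ht.2) hab
    obtain ⟨φ, h1, h2, h3, h4⟩ := exists_cutoff (K := γ '' Icc a b)
      (U := Ω ∩ (γ '' Icc 0 c)ᶜ ∩ (γ '' Icc d len)ᶜ) (isCompact_Icc.image hγ)
      ((hΩ.inter (hclosed _ _).isOpen_compl).inter (hclosed _ _).isOpen_compl) (by
        rintro _ ⟨t, ht, rfl⟩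
        have htm : t ∈ Ioo 0 len := ⟨by linarith [ht.1], by linarith [ht.2]⟩
        refine ⟨⟨hsub t htm, ?_⟩, ?_⟩
        · rintro ⟨s, hs, hst⟩
          have := hinj t htm s ⟨hs.1, by linarith [hs.2]⟩ hst.symm
          linarith [hs.2, ht.1]
        · rintro ⟨s, hs, hst⟩
          have := hinj t htm s ⟨by linarith [hs.1], hs.2⟩ hst.symm
          linarith [hs.1, ht.2])
    refine ⟨φ, h1, h2, fun x hx => (h3 hx).1.1, fun t ht => h4 _ (mem_image_of_mem _ ht), ?_, ?_⟩
    · intro t ht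
      by_contra hne
      exact (h3 (subset_tsupport _ hne)).1.2 (mem_image_of_mem _ ht)
    · intro t ht
      by_contra hne
      exact (h3 (subset_tsupport _ hne)).2 (mem_image_of_mem _ ht)
  obtain ⟨χ, χs, χc, χt, χ1, χ0, χ0'⟩ := cut (t1 + δ / 2) (t2 - δ / 2) (t1 - δ / 2) (t2 + δ / 2)
    (by linarith) (by linarith) (by linarith) (by linarith)
  obtain ⟨η, ηs, ηc, ηt, η1, η0, η0'⟩ := cut (t1 - δ / 2) (t1 + δ / 2) (t1 - δ) (t1 + δ)
    (by linarith) (by linarith) (by linarith) (by linarith)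
  obtain ⟨ζ, ζs, ζc, ζt, ζ1, ζ0, ζ0'⟩ := cut (t2 - δ / 2) (t2 + δ / 2) (t2 - δ) (t2 + δ)
    (by linarith) (by linarith) (by linarith) (by linarith)
  filter_upwards [Ioo_mem_nhdsGT (show (0:ℝ) < δ / 8 by positivity)] with h hh
  obtain ⟨h0, hhδ⟩ := hh
  -- behaviour of the ramps
  have ramp : ∀ (p : ℝ → ℝ) (t0 : ℝ), (∀ t, |t - t0| ≤ δ → |p t - (t - t0)| ≤ |t - t0| / 2) →
      (∀ t, t0 - δ ≤ t → t ≤ t0 - δ / 2 → Real.smoothTransition (p t / h) = 0) ∧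
      (∀ t, t0 + δ / 2 ≤ t → t ≤ t0 + δ → Real.smoothTransition (p t / h) = 1) := by
    intro p t0 hp
    constructor
    · intro t ha hb
      have h5 := hp t (by rw [abs_le]; constructor <;> linarith)
      rw [abs_of_nonpos (by linarith : t - t0 ≤ 0)] at h5
      apply Real.smoothTransition.zero_of_nonpos
      apply div_nonpos_of_nonpos_of_nonneg _ h0.le
      linarith [(abs_le.1 h5).2]
    · intro t ha hb
      have h5 := hp t (by rw [abs_le]; constructor <;> linarith)
      rw [abs_of_nonneg (by linarith : 0 ≤ t - t0)] at h5
      apply Real.smoothTransition.one_of_one_le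
      rw [le_div_iff₀ h0]
      linarith [(abs_le.1 h5).1]
  obtain ⟨r10, r11⟩ := ramp p1 t1 hc1'
  obtain ⟨r20, r21⟩ := ramp p2 t2 hc2'
  set φ : EuclideanSpace ℝ (Fin 2) → ℝ := fun x =>
    χ x + η x * (Real.smoothTransition (⟪x - γ t1, e1⟫ / h) - χ x) +
      ζ x * ((1 - Real.smoothTransition (⟪x - γ t2, e2⟫ / h)) - χ x) with hφdef
  have hS : ContDiff ℝ (⊤ : ℕ∞) Real.smoothTransition := Real.smoothTransition.contDiff
  have φs : ContDiff ℝ (⊤ : ℕ∞) φ := by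
    have s1 : ∀ (x0 e : EuclideanSpace ℝ (Fin 2)),
        ContDiff ℝ (⊤ : ℕ∞) (fun x => Real.smoothTransition (⟪x - x0, e⟫ / h)) := by
      intro x0 e
      exact hS.comp (((contDiff_id.sub contDiff_const).inner ℝ contDiff_const).div_const h)
    exact (χs.add (ηs.mul ((s1 _ _).sub χs))).add (ζs.mul ((contDiff_const.sub (s1 _ _)).sub χs))
  have φsupp : tsupport φ ⊆ tsupport χ ∪ tsupport η ∪ tsupport ζ := by
    apply closure_minimal _ (((isClosed_tsupport _).union (isClosed_tsupport _)).union
      (isClosed_tsupport _))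
    intro x hx
    by_contra hn
    simp only [mem_union, not_or] at hn
    apply hx
    simp [hφdef, image_eq_zero_of_notMem_tsupport hn.1.1, image_eq_zero_of_notMem_tsupport hn.1.2,
      image_eq_zero_of_notMem_tsupport hn.2]
  have φc : HasCompactSupport φ :=
    ((χc.isCompact.union ηc.isCompact).union ζc.isCompact).of_isClosed_subset
      (isClosed_tsupport _) φsupp
  have φt : tsupport φ ⊆ Ω := φsupp.trans (union_subset (union_subset χt ηt) ζt)
  -- values of φ along the curve
  have v1 : ∀ t, t1 - δ ≤ t → t ≤ t1 + δ → φ (γ t) = Real.smoothTransition (p1 t / h) := by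
    intro t ha hb
    have z : ζ (γ t) = 0 := ζ0 t ⟨by linarith, by linarith⟩
    simp only [hφdef, z, zero_mul, add_zero]
    change χ (γ t) + η (γ t) * (Real.smoothTransition (p1 t / h) - χ (γ t)) = _
    rcases le_total t (t1 - δ / 2) with hc | hc
    · rw [χ0 t ⟨by linarith, hc⟩, r10 t ha hc]; ring
    rcases le_total t (t1 + δ / 2) with hd | hd
    · rw [η1 t ⟨hc, hd⟩]; ring
    · rw [χ1 t ⟨hd, by linarith⟩, r11 t hd hb]; ring
  have v2 : ∀ t, t2 - δ ≤ t → t ≤ t2 + δ → φ (γ t) = 1 - Real.smoothTransition (p2 t / h) := by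
    intro t ha hb
    have z : η (γ t) = 0 := η0' t ⟨by linarith, by linarith⟩
    simp only [hφdef, z, zero_mul, add_zero]
    change χ (γ t) + ζ (γ t) * (1 - Real.smoothTransition (p2 t / h) - χ (γ t)) = _
    rcases le_total t (t2 - δ / 2) with hc | hc
    · rw [χ1 t ⟨by linarith, hc⟩, r20 t ha hc]; ring
    rcases le_total t (t2 + δ / 2) with hd | hd
    · rw [ζ1 t ⟨hc, hd⟩]; ring
    · rw [χ0' t ⟨hd, by linarith⟩, r21 t hd hb]; ring
  have v3 : ∀ t, 0 ≤ t → t ≤ t1 - δ → φ (γ t) = 0 := by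
    intro t ha hb
    simp only [hφdef, ζ0 t ⟨ha, by linarith⟩, η0 t ⟨ha, hb⟩, χ0 t ⟨ha, by linarith⟩]; ring
  have v4 : ∀ t, t1 + δ ≤ t → t ≤ t2 - δ → φ (γ t) = 1 := by
    intro t ha hb
    simp only [hφdef, ζ0 t ⟨by linarith, hb⟩, η0' t ⟨ha, by linarith⟩,
      χ1 t ⟨by linarith, by linarith⟩]; ring
  have v5 : ∀ t, t2 + δ ≤ t → t ≤ len → φ (γ t) = 0 := by
    intro t ha hb
    simp only [hφdef, ζ0' t ⟨ha, hb⟩, η0' t ⟨by linarith, hb⟩, χ0' t ⟨by linarith, hb⟩]; ring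
  have main := hint φ φs φc φt
  have φd : Differentiable ℝ φ := φs.differentiable (by simp)
  -- derivative of ramps
  have rd : ∀ (x0 e : EuclideanSpace ℝ (Fin 2)) (t : ℝ), HasDerivAt γ (g t) t →
      HasDerivAt (fun s => Real.smoothTransition (⟪γ s - x0, e⟫ / h))
        (deriv Real.smoothTransition (⟪γ t - x0, e⟫ / h) * (⟪g t, e⟫ / h)) t := by
    intro x0 e t ht
    have a := ((ht.sub_const x0).inner ℝ (hasDerivAt_const t e)).div_const h
    rw [inner_zero_right, zero_add] at a
    exact (step_diff _).hasDerivAt.comp t a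
  set G1 : ℝ → ℝ := fun t => ⟪F t, e1⟫ * (deriv Real.smoothTransition (p1 t / h) / h) with hG1
  set G2 : ℝ → ℝ := fun t => ⟪F t, e2⟫ * (deriv Real.smoothTransition (p2 t / h) / h) with hG2
  obtain ⟨M, hM⟩ := step_cs.exists_bound_of_continuous step_cont
  have gi : ∀ (p : ℝ → ℝ) (e : EuclideanSpace ℝ (Fin 2)), Continuous p →
      Integrable (fun t => ⟪F t, e⟫ * (deriv Real.smoothTransition (p t / h) / h)) := by
    intro p e hp
    apply Integrable.mul_bdd (c := M / h) (hF.inner_const e)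
    · have := step_cont
      exact (by fun_prop : Continuous _).aestronglyMeasurable
    · refine Filter.Eventually.of_forall fun t => ?_
      rw [norm_div, Real.norm_of_nonneg h0.le]
      gcongr
      exact hM _
  have iG1 : Integrable G1 := gi p1 e1 hp1c
  have iG2 : Integrable G2 := gi p2 e2 hp2c
  have pt : ∀ᵐ t ∂(volume.restrict (Ioo 0 len)), ⟪F t, gradient φ (γ t)⟫ =
      (Ioo (t1 - δ) (t1 + δ)).indicator G1 t - (Ioo (t2 - δ) (t2 + δ)).indicator G2 t := by
    have hne : ∀ a : ℝ, ∀ᵐ t ∂(volume.restrict (Ioo 0 len)), t ≠ a := fun a =>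
      ae_restrict_of_ae (by simp [ae_iff])
    filter_upwards [hFg, ae_restrict_mem measurableSet_Ioo, hne (t1 - δ), hne (t1 + δ),
      hne (t2 - δ), hne (t2 + δ)] with t ht htm n1 n2 n3 n4
    have hd := hasDerivAt_comp_curve φd ht.1
    have hzero : ∀ a b c : ℝ, a < t → t < b → (∀ s, a ≤ s → s ≤ b → φ (γ s) = c) →
        ⟪F t, gradient φ (γ t)⟫ = 0 := by
      intro a b c ha hb hc
      have : HasDerivAt (fun s => φ (γ s)) 0 t :=
        (hasDerivAt_const t c).congr_of_eventuallyEq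
          (by filter_upwards [Ioo_mem_nhds ha hb] with s hs using hc s hs.1.le hs.2.le)
      rw [ht.2, real_inner_smul_left, hd.unique this, mul_zero]
    rcases lt_or_gt_of_ne n1 with c1 | c1
    · rw [hzero 0 (t1 - δ) 0 htm.1 c1 v3, indicator_of_notMem, indicator_of_notMem, sub_zero]
      · rintro ⟨a, b⟩; linarith
      · rintro ⟨a, b⟩; linarith
    rcases lt_or_gt_of_ne n2 with c2 | c2
    · rw [indicator_of_mem (show t ∈ Ioo (t1 - δ) (t1 + δ) from ⟨c1, c2⟩), indicator_of_notMem, sub_zero]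
      · have h' := (rd (γ t1) e1 t ht.1).congr_of_eventuallyEq (f₁ := fun s => φ (γ s))
          (by filter_upwards [Ioo_mem_nhds c1 c2] with s hs using v1 s hs.1.le hs.2.le)
        rw [hG1]
        simp only
        rw [ht.2, real_inner_smul_left, hd.unique h', real_inner_smul_left]
        simp only [hp1def]
        ring
      · rintro ⟨a, b⟩; linarith
    rcases lt_or_gt_of_ne n3 with c3 | c3
    · rw [hzero _ _ 1 c2 c3 v4, indicator_of_notMem, indicator_of_notMem, sub_zero]
      · rintro ⟨a, b⟩; linarith
      · rintro ⟨a, b⟩; linarith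
    rcases lt_or_gt_of_ne n4 with c4 | c4
    · rw [indicator_of_mem (show t ∈ Ioo (t2 - δ) (t2 + δ) from ⟨c3, c4⟩), indicator_of_notMem, zero_sub]
      · have h' := ((rd (γ t2) e2 t ht.1).const_sub 1).congr_of_eventuallyEq (f₁ := fun s => φ (γ s))
          (by filter_upwards [Ioo_mem_nhds c3 c4] with s hs using v2 s hs.1.le hs.2.le)
        rw [hG2]
        simp only
        rw [ht.2, real_inner_smul_left, hd.unique h', real_inner_smul_left]
        simp only [hp2def]
        ring
      · rintro ⟨a, b⟩; linarith
    · rw [hzero _ _ 0 c4 htm.2 v5, indicator_of_notMem, indicator_of_notMem, sub_zero]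
      · rintro ⟨a, b⟩; linarith
      · rintro ⟨a, b⟩; linarith
  rw [integral_congr_ae pt, integral_sub (iG1.indicator measurableSet_Ioo).integrableOn
    (iG2.indicator measurableSet_Ioo).integrableOn, setIntegral_indicator measurableSet_Ioo,
    setIntegral_indicator measurableSet_Ioo,
    inter_eq_right.2 (Ioo_subset_Ioo (by linarith) (by linarith)),
    inter_eq_right.2 (Ioo_subset_Ioo (by linarith) (by linarith))] at main
  exact sub_eq_zero.1 main

theorem null_of_image_null {γ g : ℝ → EuclideanSpace ℝ (Fin 2)} {N : Set ℝ}
    (hd : ∀ t ∈ N, HasDerivAt γ (g t) t ∧ g t ≠ 0) (hN : μH[1] (γ '' N) = 0) : volume N = 0 := by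
  let A : ℕ → Set ℝ := fun n => {t | t ∈ N ∧ ∀ s, |s - t| ≤ 1 / ((n : ℝ) + 1) →
    |s - t| ≤ ((n : ℝ) + 1) * ‖γ s - γ t‖}
  let P : ℕ → ℤ → Set ℝ := fun n k =>
    A n ∩ Icc ((k : ℝ) / ((n : ℝ) + 1)) (((k : ℝ) + 1) / ((n : ℝ) + 1))
  have hcover : N ⊆ ⋃ n, ⋃ k, P n k := by
    intro t ht
    obtain ⟨h1, h2⟩ := hd t ht
    have hg : 0 < ‖g t‖ := norm_pos_iff.2 h2
    have h3 := (hasDerivAt_iff_isLittleO.1 h1).def (c := ‖g t‖ / 2) (by positivity)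
    obtain ⟨r, hr, h3⟩ := Metric.eventually_nhds_iff.1 h3
    obtain ⟨n, hn⟩ := exists_nat_gt (max (1 / r) (2 / ‖g t‖))
    have hn1 : 1 / r < (n : ℝ) := (le_max_left _ _).trans_lt hn
    have hn2 : 2 / ‖g t‖ < (n : ℝ) := (le_max_right _ _).trans_lt hn
    have hn0 : (0 : ℝ) < (n : ℝ) + 1 := by positivity
    refine mem_iUnion.2 ⟨n, mem_iUnion.2 ⟨⌊t * ((n : ℝ) + 1)⌋, ⟨ht, ?_⟩, ?_, ?_⟩⟩
    · intro s hs
      have hlt : |s - t| < r := by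
        refine hs.trans_lt ?_
        rw [div_lt_iff₀ hn0]
        rw [div_lt_iff₀ hr] at hn1
        nlinarith
      have h4 := h3 (y := s) (by rwa [Real.dist_eq])
      have h5 : ‖(s - t) • g t‖ ≤ ‖γ s - γ t‖ + ‖γ s - γ t - (s - t) • g t‖ := by
        have := norm_sub_le (γ s - γ t) (γ s - γ t - (s - t) • g t)
        simpa using this
      rw [norm_smul, Real.norm_eq_abs] at h5
      rw [Real.norm_eq_abs] at h4
      have h6 : |s - t| * ‖g t‖ ≤ 2 * ‖γ s - γ t‖ := by linarith
      rw [div_lt_iff₀ hg] at hn2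
      have h7 : 2 * ‖γ s - γ t‖ ≤ ((n : ℝ) + 1) * ‖g t‖ * ‖γ s - γ t‖ := by
        gcongr
        nlinarith
      have h8 : |s - t| * ‖g t‖ ≤ (((n : ℝ) + 1) * ‖γ s - γ t‖) * ‖g t‖ := by linarith
      exact le_of_mul_le_mul_right h8 hg
    · rw [div_le_iff₀ hn0]; exact Int.floor_le _
    · rw [le_div_iff₀ hn0]; exact (Int.lt_floor_add_one _).le
  refine measure_mono_null hcover (measure_iUnion_null fun n => measure_iUnion_null fun k => ?_)
  have hn0 : (0 : ℝ) < (n : ℝ) + 1 := by positivity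
  have hest : ∀ s ∈ P n k, ∀ t ∈ P n k, |s - t| ≤ ((n : ℝ) + 1) * ‖γ s - γ t‖ := by
    intro s hs t ht
    apply ht.1.2
    have e : ((k : ℝ) + 1) / ((n : ℝ) + 1) = (k : ℝ) / ((n : ℝ) + 1) + 1 / ((n : ℝ) + 1) := by ring
    have a1 := hs.2.1
    have a2 := hs.2.2
    have a3 := ht.2.1
    have a4 := ht.2.2
    rw [e] at a2 a4
    rw [abs_le]
    constructor <;> linarith
  have hinj : InjOn γ (P n k) := by
    intro s hs t ht hst
    have := hest s hs t ht
    rw [hst, sub_self, norm_zero, mul_zero] at this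
    exact sub_eq_zero.1 (abs_nonpos_iff.1 this)
  have hlip : LipschitzOnWith ((n : ℝ≥0) + 1) (Function.invFunOn γ (P n k)) (γ '' P n k) := by
    apply LipschitzOnWith.of_dist_le_mul
    rintro _ ⟨s, hs, rfl⟩ _ ⟨t, ht, rfl⟩
    rw [hinj.leftInvOn_invFunOn hs, hinj.leftInvOn_invFunOn ht, Real.dist_eq, dist_eq_norm]
    simpa using hest s hs t ht
  have himg : Function.invFunOn γ (P n k) '' (γ '' P n k) = P n k :=
    hinj.leftInvOn_invFunOn.image_image
  have h1 := hlip.hausdorffMeasure_image_le (d := 1) zero_le_one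
  have h0 : μH[1] (γ '' P n k) = 0 :=
    measure_mono_null (image_mono fun t ht => ht.1.1) hN
  rw [himg, h0, mul_zero, hausdorffMeasure_real] at h1
  exact le_antisymm h1 zero_le

theorem pull_measure {γ : ℝ → EuclideanSpace ℝ (Fin 2)} {K : ℝ≥0} (lip : LipschitzWith K γ)
    {len : ℝ} (hinj : InjOn γ (Ioo 0 len)) (hfin : μH[1] (γ '' Ioo 0 len) ≠ ⊤) :
    ∃ ν : Measure ℝ, IsFiniteMeasure ν ∧ ν ≪ volume ∧
      (∀ s, MeasurableSet s → ν s = μH[1] (γ '' (s ∩ Ioo 0 len))) ∧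
      Measure.map γ ν = (μH[1] : Measure (EuclideanSpace ℝ (Fin 2))).restrict (γ '' Ioo 0 len) := by
  let e : Ioo 0 len → EuclideanSpace ℝ (Fin 2) := fun t => γ t
  have : PolishSpace (Ioo 0 len) := (isOpen_Ioo (a := (0:ℝ)) (b := len)).polishSpace
  have he : MeasurableEmbedding e :=
    Continuous.measurableEmbedding (lip.continuous.comp continuous_subtype_val)
      (fun a b hab => Subtype.ext (hinj a.2 b.2 hab))
  let ν : Measure ℝ := Measure.map Subtype.val (Measure.comap e μH[1])
  have hν : ∀ s, MeasurableSet s → ν s = μH[1] (γ '' (s ∩ Ioo 0 len)) := by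
    intro s hs
    rw [Measure.map_apply measurable_subtype_coe hs, he.comap_apply]
    congr 1
    ext x
    constructor
    · rintro ⟨t, ht, rfl⟩; exact ⟨t, ⟨ht, t.2⟩, rfl⟩
    · rintro ⟨t, ht, rfl⟩; exact ⟨⟨t, ht.2⟩, ht.1, rfl⟩
  refine ⟨ν, ⟨?_⟩, ?_, hν, ?_⟩
  · rw [hν _ MeasurableSet.univ, univ_inter]; exact hfin.lt_top
  · refine Measure.AbsolutelyContinuous.mk fun s hs h0 => ?_
    rw [hν s hs]
    have h1 := lip.hausdorffMeasure_image_le (d := 1) zero_le_one (s ∩ Ioo 0 len)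
    rw [hausdorffMeasure_real, measure_mono_null inter_subset_left h0, mul_zero] at h1
    exact le_antisymm h1 zero_le
  · rw [Measure.map_map lip.continuous.measurable measurable_subtype_coe]
    change Measure.map e _ = _
    rw [he.map_comap]
    congr 1
    ext x
    constructor
    · rintro ⟨t, rfl⟩; exact ⟨t, t.2, rfl⟩
    · rintro ⟨t, ht, rfl⟩; exact ⟨⟨t, ht⟩, rfl⟩

theorem restrict_dom {Ω C : Set (EuclideanSpace ℝ (Fin 2))} (P : SimpleOmegaClosedCurve Ω C) :
    (volume : Measure ℝ).restrict P.dom = volume.restrict (Ioo 0 P.len) := by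
  rcases P.cases with ⟨-, h, -⟩ | ⟨h, -⟩
  · rw [h]; exact Measure.restrict_congr_set Ioo_ae_eq_Ico.symm
  · rw [h]

theorem restrict_curve {Ω C : Set (EuclideanSpace ℝ (Fin 2))} (P : SimpleOmegaClosedCurve Ω C) :
    (μH[1] : Measure (EuclideanSpace ℝ (Fin 2))).restrict C =
      (μH[1] : Measure (EuclideanSpace ℝ (Fin 2))).restrict (P.γ '' Ioo 0 P.len) := by
  rcases P.cases with ⟨-, h, -, hC⟩ | ⟨h, -, hC, -⟩
  · have hC' : C = insert (P.γ 0) (P.γ '' Ioo 0 P.len) :=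
      hC.trans (by rw [h, ← Ioo_insert_left P.len_pos, image_insert_eq])
    refine (congrArg (fun s => (μH[1] : Measure (EuclideanSpace ℝ (Fin 2))).restrict s) hC').trans ?_
    have : NullSingletonClass (μH[1] : Measure (EuclideanSpace ℝ (Fin 2))) :=
      Measure.nullSingletonClass_hausdorff _ one_pos
    exact Measure.restrict_congr_set (insert_ae_eq_self _ _)
  · have hC' : C = P.γ '' Ioo 0 P.len := hC.trans (by rw [h])
    exact congrArg (fun s => (μH[1] : Measure (EuclideanSpace ℝ (Fin 2))).restrict s) hC'

theorem curve_facts {Ω C : Set (EuclideanSpace ℝ (Fin 2))} (hΩ : IsOpen Ω)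
    (P : SimpleOmegaClosedCurve Ω C) :
    P.γ '' Ioo 0 P.len ⊆ C ∧
    (∀ s ∈ Ioo 0 P.len, ∀ t ∈ Icc 0 P.len, P.γ s = P.γ t → s = t) := by
  have hsub : P.γ '' Ioo 0 P.len ⊆ C := by
    rcases P.cases with ⟨-, h, -, hC⟩ | ⟨h, -, hC, -⟩
    · exact (image_mono (by rw [h]; exact Ioo_subset_Ico_self)).trans hC.ge
    · exact (image_mono h.ge).trans hC.ge
  refine ⟨hsub, ?_⟩
  intro s hs t ht hst
  rcases P.cases with ⟨hper, h, hinj, hC⟩ | ⟨h, hinj, hC, hf0, hf1, -⟩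
  · rw [h] at hinj
    rcases eq_or_lt_of_le ht.2 with he | hlt
    · have h0 : P.γ P.len = P.γ 0 := by simpa using hper 0
      rw [he, h0] at hst
      have := hinj (Ioo_subset_Ico_self hs) ⟨le_rfl, P.len_pos⟩ hst
      exact absurd this hs.1.ne'
    · exact hinj (Ioo_subset_Ico_self hs) ⟨ht.1, hlt⟩ hst
  · rw [h] at hinj
    have hin : P.γ t ∈ Ω := hst ▸ P.sub (hsub (mem_image_of_mem _ hs))
    have hnf : P.γ t ∉ frontier Ω := fun hf => by
      rw [hΩ.frontier_eq] at hf
      exact hf.2 hin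
    refine hinj hs ⟨lt_of_le_of_ne ht.1 ?_, lt_of_le_of_ne ht.2 ?_⟩ hst
    · rintro rfl; exact hnf hf0
    · intro he; rw [he] at hnf; exact hnf hf1

/-- The reversed parametrization. -/
def SimpleOmegaClosedCurve.reverse {Ω C : Set (EuclideanSpace ℝ (Fin 2))}
    (P : SimpleOmegaClosedCurve Ω C) : SimpleOmegaClosedCurve Ω C where
  len := P.len
  len_pos := P.len_pos
  γ := fun t => P.γ (P.len - t)
  K := P.K
  lip := by
    have h : LipschitzWith 1 (fun t : ℝ => P.len - t) := by
      apply LipschitzWith.of_dist_le_mul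
      intro x y
      rw [Real.dist_eq, Real.dist_eq, NNReal.coe_one, one_mul,
        show P.len - x - (P.len - y) = -(x - y) by ring, abs_neg]
    have := P.lip.comp h
    rwa [mul_one] at this
  dom := P.dom
  cases := by
    rcases P.cases with ⟨hper, h, hinj, hC⟩ | ⟨h, hinj, hC, hf0, hf1, hcl⟩
    · left
      have h0 : P.γ P.len = P.γ 0 := by simpa using hper 0
      have hr : ∀ t ∈ Ico 0 P.len, ∃ u ∈ Ico 0 P.len, P.γ (P.len - t) = P.γ u ∧
          ((t = 0 ∧ u = 0) ∨ (0 < t ∧ u = P.len - t)) := by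
        intro t ht
        rcases eq_or_lt_of_le ht.1 with he | hlt
        · exact ⟨0, ⟨le_rfl, P.len_pos⟩, by rw [← he, sub_zero, h0], Or.inl ⟨he.symm, rfl⟩⟩
        · exact ⟨P.len - t, ⟨by linarith [ht.2], by linarith⟩, rfl, Or.inr ⟨hlt, rfl⟩⟩
      refine ⟨?_, h, ?_, ?_⟩
      · intro t
        change P.γ (P.len - (t + P.len)) = P.γ (P.len - t)
        rw [← sub_sub]
        exact hper.sub_eq _
      · rw [h] at hinj ⊢
        intro s hs t ht hst
        obtain ⟨u, hu, e1, c1⟩ := hr s hs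
        obtain ⟨v, hv, e2, c2⟩ := hr t ht
        have huv := hinj hu hv (e1.symm.trans (hst.trans e2))
        rcases c1 with ⟨a, b⟩ | ⟨a, b⟩ <;> rcases c2 with ⟨c, d⟩ | ⟨c, d⟩ <;>
          linarith [hs.2, ht.2]
      · refine hC.trans ?_
        rw [h]
        apply Subset.antisymm
        · rintro _ ⟨t, ht, rfl⟩
          rcases eq_or_lt_of_le ht.1 with he | hlt
          · exact ⟨0, ⟨le_rfl, P.len_pos⟩, by simp only [sub_zero, h0, ← he]⟩
          · exact ⟨P.len - t, ⟨by linarith [ht.2], by linarith⟩, by simp⟩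
        · rintro _ ⟨t, ht, rfl⟩
          obtain ⟨u, hu, e1, -⟩ := hr t ht
          exact ⟨u, hu, e1.symm⟩
    · right
      refine ⟨h, ?_, ?_, by simpa using hf1, by simpa using hf0, ?_⟩
      · rw [h] at hinj ⊢
        intro s hs t ht hst
        have := hinj
          (show P.len - s ∈ Ioo 0 P.len from ⟨by linarith [hs.2], by linarith [hs.1]⟩)
          (show P.len - t ∈ Ioo 0 P.len from ⟨by linarith [ht.2], by linarith [ht.1]⟩) hst
        linarith
      · refine hC.trans ?_
        rw [h]
        apply Subset.antisymm
        · rintro _ ⟨t, ht, rfl⟩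
          exact ⟨P.len - t, ⟨by linarith [ht.2], by linarith [ht.1]⟩, by simp⟩
        · rintro _ ⟨t, ht, rfl⟩
          exact ⟨P.len - t, ⟨by linarith [ht.2], by linarith [ht.1]⟩, rfl⟩
      · rintro _ ⟨t, ht, rfl⟩
        exact hcl ⟨P.len - t, ⟨by linarith [ht.2], by linarith [ht.1]⟩, rfl⟩
  sub := P.sub
  finlen := P.finlen

theorem sigma_exists
    (Ω : Set (EuclideanSpace ℝ (Fin 2))) (hΩ : IsOpen Ω)
    (C : Set (EuclideanSpace ℝ (Fin 2)))
    (B : EuclideanSpace ℝ (Fin 2) → EuclideanSpace ℝ (Fin 2))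
    (hBmeas : Measurable B) (MB : ℝ) (hBbd : ∀ x, ‖B x‖ ≤ MB)
    (hBnorm : ∀ᵐ x ∂((μH[1] : Measure (EuclideanSpace ℝ (Fin 2))).restrict C), ‖B x‖ = 1)
    (P : SimpleOmegaClosedCurve Ω C) (g : ℝ → EuclideanSpace ℝ (Fin 2))
    (htang : ∀ᵐ t ∂(volume.restrict P.dom),
      HasDerivAt P.γ (g t) t ∧ g t ≠ 0 ∧ ∃ c : ℝ, g t = c • B (P.γ t))
    (hdiv : ∀ φ : EuclideanSpace ℝ (Fin 2) → ℝ, ContDiff ℝ (⊤ : ℕ∞) φ → HasCompactSupport φ →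
      tsupport φ ⊆ Ω → (∫ x in C, ⟪B x, gradient φ x⟫ ∂μH[1]) = 0) :
    ∃ σ : ℝ, (σ = 1 ∨ σ = -1) ∧
      ∀ᵐ t ∂(volume.restrict P.dom), ‖g t‖⁻¹ • g t = σ • B (P.γ t) ∧ ‖B (P.γ t)‖ = 1 := by
  rw [restrict_dom] at htang ⊢
  rw [restrict_curve P] at hBnorm
  obtain ⟨hsub, hinj⟩ := curve_facts hΩ P
  have hcont := P.lip.continuous
  have hinjOn : InjOn P.γ (Ioo 0 P.len) := fun s hs t ht h =>
    hinj s hs t (Ioo_subset_Icc_self ht) h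
  obtain ⟨ν, hνfin, hνac, hν, hmap⟩ := pull_measure P.lip hinjOn
    (ne_top_of_le_ne_top P.finlen (measure_mono hsub))
  -- Lebesgue measure on the parameter interval is absolutely continuous w.r.t. `ν`
  have hac : (volume : Measure ℝ).restrict (Ioo 0 P.len) ≪ ν := by
    refine Measure.AbsolutelyContinuous.mk fun s hs h0 => ?_
    rw [hν s hs] at h0
    rw [Measure.restrict_apply hs]
    obtain ⟨T, hT, hTm⟩ : ∃ T : Set ℝ, (∀ t ∈ T, HasDerivAt P.γ (g t) t ∧ g t ≠ 0) ∧
        volume ((s ∩ Ioo 0 P.len) \ T) = 0 := by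
      refine ⟨{t | HasDerivAt P.γ (g t) t ∧ g t ≠ 0}, fun t ht => ht, ?_⟩
      have h2 := (ae_restrict_iff' measurableSet_Ioo).1 htang
      refine measure_mono_null ?_ (ae_iff.1 h2)
      rintro t ⟨⟨-, ht⟩, hn⟩ hc
      exact hn ⟨(hc ht).1, (hc ht).2.1⟩
    have h3 : volume ((s ∩ Ioo 0 P.len) ∩ T) = 0 :=
      null_of_image_null (fun t ht => hT t ht.2)
        (measure_mono_null (image_mono inter_subset_left) h0)
    refine measure_mono_null (fun t ht => ?_) (measure_union_null h3 hTm)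
    by_cases h : t ∈ T
    · exact Or.inl ⟨ht, h⟩
    · exact Or.inr ⟨ht, h⟩
  set θ : ℝ → ℝ := fun t => (ν.rnDeriv volume t).toReal with hθ
  have hθpos : ∀ᵐ t ∂(volume.restrict (Ioo 0 P.len)), 0 < θ t := by
    have h1 := hac.ae_le (Measure.rnDeriv_pos hνac)
    have h2 := ae_restrict_of_ae (s := Ioo 0 P.len) (Measure.rnDeriv_lt_top ν volume)
    filter_upwards [h1, h2] with t a b
    exact ENNReal.toReal_pos a.ne' b.ne
  have hB1 : ∀ᵐ t ∂(volume.restrict (Ioo 0 P.len)), ‖B (P.γ t)‖ = 1 := by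
    rw [← hmap] at hBnorm
    exact hac.ae_le (ae_of_ae_map hcont.aemeasurable hBnorm)
  set F : ℝ → EuclideanSpace ℝ (Fin 2) := fun t => θ t • B (P.γ t) with hFdef
  have hF : Integrable F := by
    have hθi : Integrable θ := Measure.integrable_toReal_rnDeriv
    exact hθi.smul_bdd MB (hBmeas.comp hcont.measurable).aestronglyMeasurable
      (Filter.Eventually.of_forall fun t => hBbd _)
  have hθout : ∀ᵐ t ∂(volume.restrict (Ioo 0 P.len)ᶜ), θ t = 0 := by
    have h0 : ν (Ioo 0 P.len)ᶜ = 0 := by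
      rw [hν _ measurableSet_Ioo.compl]; simp
    have h1 : ∫⁻ t in (Ioo 0 P.len)ᶜ, ν.rnDeriv volume t = 0 := by
      rw [Measure.setLIntegral_rnDeriv hνac, h0]
    rw [lintegral_eq_zero_iff (Measure.measurable_rnDeriv _ _)] at h1
    filter_upwards [h1] with t ht
    simp [hθ, ht]
  have hint : ∀ φ : EuclideanSpace ℝ (Fin 2) → ℝ, ContDiff ℝ (⊤ : ℕ∞) φ → HasCompactSupport φ →
      tsupport φ ⊆ Ω → (∫ t in Ioo 0 P.len, ⟪F t, gradient φ (P.γ t)⟫) = 0 := by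
    intro φ h1 h2 h3
    have h4 := hdiv φ h1 h2 h3
    have hgr : Continuous (gradient φ) :=
      (InnerProductSpace.toDual ℝ (EuclideanSpace ℝ (Fin 2))).symm.continuous.comp
        (h1.continuous_fderiv (by simp))
    have hm : Measurable fun x => ⟪B x, gradient φ x⟫ := hBmeas.inner hgr.measurable
    rw [restrict_curve P, ← hmap, integral_map hcont.aemeasurable hm.aestronglyMeasurable,
      ← integral_rnDeriv_smul hνac] at h4
    have hgs : HasCompactSupport (gradient φ) := by
      have := h2.fderiv (𝕜 := ℝ)
      exact this.comp_left (g := (InnerProductSpace.toDual ℝ (EuclideanSpace ℝ (Fin 2))).symm)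
        (map_zero _)
    obtain ⟨M, hM⟩ := hgs.exists_bound_of_continuous hgr
    have hθi : Integrable θ := Measure.integrable_toReal_rnDeriv
    have hMB : 0 ≤ MB := (norm_nonneg _).trans (hBbd 0)
    have hI : Integrable (fun t => (ν.rnDeriv volume t).toReal •
        ⟪B (P.γ t), gradient φ (P.γ t)⟫) := by
      refine hθi.smul_bdd (MB * M) (hm.comp hcont.measurable).aestronglyMeasurable
        (Filter.Eventually.of_forall fun t => ?_)
      exact (norm_inner_le_norm _ _).trans
        (mul_le_mul (hBbd _) (hM _) (norm_nonneg _) hMB)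
    have hz : ∫ t in (Ioo 0 P.len)ᶜ, (ν.rnDeriv volume t).toReal •
        ⟪B (P.γ t), gradient φ (P.γ t)⟫ = 0 := by
      apply integral_eq_zero_of_ae
      filter_upwards [hθout] with t ht
      have ht' : (ν.rnDeriv volume t).toReal = 0 := ht
      simp [ht']
    rw [← integral_add_compl (s := Ioo 0 P.len) measurableSet_Ioo hI, hz, add_zero] at h4
    refine Eq.trans (integral_congr_ae (Filter.Eventually.of_forall fun t => ?_)) h4
    simp [hFdef, hθ, real_inner_smul_left]
  -- scalar density
  set f : ℝ → ℝ := fun t => ⟪F t, (‖g t‖ ^ 2)⁻¹ • g t⟫ with hf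
  have hpt : ∀ t c, g t ≠ 0 → ‖B (P.γ t)‖ = 1 → g t = c • B (P.γ t) →
      c ≠ 0 ∧ f t = θ t / c ∧ F t = f t • g t ∧ ‖g t‖ = |c| := by
    intro t c hg hb hc
    have hc0 : c ≠ 0 := by rintro rfl; exact hg (by simpa using hc)
    have hn : ‖g t‖ = |c| := by rw [hc, norm_smul, hb, mul_one, Real.norm_eq_abs]
    have hft : f t = θ t / c := by
      simp only [hf, hFdef]
      rw [hn, hc, real_inner_smul_left, real_inner_smul_right, real_inner_smul_right,
        real_inner_self_eq_norm_sq, hb, sq_abs]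
      field_simp
    refine ⟨hc0, hft, ?_, hn⟩
    rw [hft, hc, smul_smul, div_mul_cancel₀ _ hc0]
  have hFg : ∀ᵐ t ∂(volume.restrict (Ioo 0 P.len)), HasDerivAt P.γ (g t) t ∧ F t = f t • g t := by
    filter_upwards [htang, hB1] with t ht hb
    obtain ⟨h1, h2, c, hc⟩ := ht
    exact ⟨h1, (hpt t c h2 hb hc).2.2.1⟩
  have hleb : ∀ᵐ t ∂(volume.restrict (Ioo 0 P.len)),
      Tendsto (fun h : ℝ => ⨍ y in Metric.closedBall t (2 * h), ‖F y - F t‖) (𝓝[>] 0) (𝓝 0) := by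
    have h1 := IsUnifLocDoublingMeasure.ae_tendsto_average_norm_sub (volume : Measure ℝ)
      hF.locallyIntegrable 1
    refine ae_restrict_of_ae ?_
    filter_upwards [h1] with t ht
    refine ht (fun _ => t) (fun h => 2 * h) ?_ ?_
    · refine tendsto_nhdsWithin_iff.2 ⟨?_, ?_⟩
      · have : Tendsto (fun h : ℝ => 2 * h) (𝓝 0) (𝓝 (2 * 0)) := tendsto_id.const_mul 2
        rw [mul_zero] at this
        exact this.mono_left nhdsWithin_le_nhds
      · filter_upwards [self_mem_nhdsWithin] with h hh
        simpa using hh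
    · filter_upwards [self_mem_nhdsWithin] with h hh
      apply Metric.mem_closedBall_self
      have : (0:ℝ) < h := hh
      positivity
  let Good : ℝ → Prop := fun t => t ∈ Ioo 0 P.len ∧ HasDerivAt P.γ (g t) t ∧ g t ≠ 0 ∧
    (∃ c : ℝ, g t = c • B (P.γ t)) ∧ ‖B (P.γ t)‖ = 1 ∧ 0 < θ t ∧
    Tendsto (fun h : ℝ => ⨍ y in Metric.closedBall t (2 * h), ‖F y - F t‖) (𝓝[>] 0) (𝓝 0)
  have hgood : ∀ᵐ t ∂(volume.restrict (Ioo 0 P.len)), Good t := by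
    filter_upwards [htang, hB1, hθpos, hleb, ae_restrict_mem measurableSet_Ioo] with t a b c d e
    exact ⟨e, a.1, a.2.1, a.2.2, b, c, d⟩
  have hlt : ∀ t1 t2, Good t1 → Good t2 → t1 < t2 → f t1 = f t2 := by
    intro t1 t2 G1 G2 h12
    exact key_two hΩ hcont (fun t ht => P.sub (hsub (mem_image_of_mem _ ht))) hinj hF hFg hint
      G1.1.1 h12 G2.1.2 G1.2.2.1 G2.2.2.1 G1.2.1 G2.2.1 G1.2.2.2.2.2.2 G2.2.2.2.2.2.2
  have heq : ∀ t1 t2, Good t1 → Good t2 → f t1 = f t2 := by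
    intro t1 t2 G1 G2
    rcases lt_trichotomy t1 t2 with h | h | h
    · exact hlt _ _ G1 G2 h
    · rw [h]
    · exact (hlt _ _ G2 G1 h).symm
  obtain ⟨t0, G0⟩ : ∃ t, Good t := by
    have : NeZero ((volume : Measure ℝ).restrict (Ioo 0 P.len)) := by
      refine ⟨fun h => ?_⟩
      rw [Measure.restrict_eq_zero, Real.volume_Ioo, sub_zero, ENNReal.ofReal_eq_zero] at h
      exact absurd P.len_pos (not_lt.2 h)
    exact hgood.exists
  obtain ⟨c0, hc0⟩ := G0.2.2.2.1
  obtain ⟨hc0ne, hf0, -, -⟩ := hpt t0 c0 G0.2.2.1 G0.2.2.2.2.1 hc0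
  have hθ0 := G0.2.2.2.2.2.1
  rcases lt_or_gt_of_ne hc0ne with hneg | hpos
  · refine ⟨-1, Or.inr rfl, ?_⟩
    filter_upwards [hgood] with t G
    refine ⟨?_, G.2.2.2.2.1⟩
    obtain ⟨c, hc⟩ := G.2.2.2.1
    obtain ⟨hcne, hft, -, hn⟩ := hpt t c G.2.2.1 G.2.2.2.2.1 hc
    have h1 : f t < 0 := by rw [heq t t0 G G0, hf0]; exact div_neg_of_pos_of_neg hθ0 hneg
    have hcneg : c < 0 := by
      by_contra hcn
      rw [hft] at h1
      exact absurd h1 (not_lt.2 (div_nonneg G.2.2.2.2.2.1.le (not_lt.1 hcn)))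
    rw [hn, hc, smul_smul, abs_of_neg hcneg]
    congr 1
    field_simp
  · refine ⟨1, Or.inl rfl, ?_⟩
    filter_upwards [hgood] with t G
    refine ⟨?_, G.2.2.2.2.1⟩
    obtain ⟨c, hc⟩ := G.2.2.2.1
    obtain ⟨hcne, hft, -, hn⟩ := hpt t c G.2.2.1 G.2.2.2.2.1 hc
    have h1 : 0 < f t := by rw [heq t t0 G G0, hf0]; exact div_pos hθ0 hpos
    have hcpos : 0 < c := by
      by_contra hcn
      rw [hft] at h1
      exact absurd h1 (not_lt.2 (div_nonpos_of_nonneg_of_nonpos G.2.2.2.2.2.1.le (not_lt.1 hcn)))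
    rw [hn, hc, smul_smul, abs_of_pos hcpos]
    congr 1
    field_simp

/-- **Orientation of a divergence-free field along a curve.**
If `B` is a bounded Borel field of unit norm `H¹`-a.e. on `C`, tangent to the simple
`Ω`-closed Lipschitz curve `C` (i.e. `γ'(t)` is parallel to `B(γ(t))` a.e.), and
`div (B H¹⌐C) = 0` in `D'(Ω)`, then there is a constant `σ ∈ {±1}` with
`γ'(t)/|γ'(t)| = σ B(γ(t))` for a.e. `t`; consequently `C` admits a Lipschitz
parametrization which agrees with `B`. -/
theorem orientation_along_curve
    (Ω : Set (EuclideanSpace ℝ (Fin 2))) (hΩ : IsOpen Ω)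
    (C : Set (EuclideanSpace ℝ (Fin 2)))
    (B : EuclideanSpace ℝ (Fin 2) → EuclideanSpace ℝ (Fin 2))
    (hBmeas : Measurable B) (MB : ℝ) (hBbd : ∀ x, ‖B x‖ ≤ MB)
    (hBnorm : ∀ᵐ x ∂((μH[1] : Measure (EuclideanSpace ℝ (Fin 2))).restrict C), ‖B x‖ = 1)
    (P : SimpleOmegaClosedCurve Ω C) (g : ℝ → EuclideanSpace ℝ (Fin 2))
    (htang : ∀ᵐ t ∂(volume.restrict P.dom),
      HasDerivAt P.γ (g t) t ∧ g t ≠ 0 ∧ ∃ c : ℝ, g t = c • B (P.γ t))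
    (hdiv : ∀ φ : EuclideanSpace ℝ (Fin 2) → ℝ, ContDiff ℝ (⊤ : ℕ∞) φ → HasCompactSupport φ →
      tsupport φ ⊆ Ω → (∫ x in C, ⟪B x, gradient φ x⟫ ∂μH[1]) = 0) :
    (∃ σ : ℝ, (σ = 1 ∨ σ = -1) ∧
      ∀ᵐ t ∂(volume.restrict P.dom), ‖g t‖⁻¹ • g t = σ • B (P.γ t)) ∧
    (∃ (Q : SimpleOmegaClosedCurve Ω C) (g' : ℝ → EuclideanSpace ℝ (Fin 2)),
      AgreesWith Q g' B) := by
  obtain ⟨σ, hσ, hae⟩ := sigma_exists Ω hΩ C B hBmeas MB hBbd hBnorm P g htang hdiv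
  refine ⟨⟨σ, hσ, hae.mono fun t ht => ht.1⟩, ?_⟩
  have hpos : ∀ᵐ t ∂(volume.restrict P.dom), HasDerivAt P.γ (g t) t ∧
      0 < σ * ⟪g t, B (P.γ t)⟫ := by
    filter_upwards [hae, htang] with t h1 h2
    refine ⟨h2.1, ?_⟩
    have hg : 0 < ‖g t‖ := norm_pos_iff.2 h2.2.1
    have h3 : g t = (‖g t‖ * σ) • B (P.γ t) := by
      rw [mul_smul, ← h1.1, smul_smul, mul_inv_cancel₀ hg.ne', one_smul]
    have h4 : ⟪g t, B (P.γ t)⟫ = ‖g t‖ * σ := by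
      nth_rw 1 [h3]
      rw [real_inner_smul_left, real_inner_self_eq_norm_sq, h1.2]
      ring
    rw [h4]
    rcases hσ with rfl | rfl
    · simpa using h2.2.1
    · simpa using h2.2.1
  rcases hσ with rfl | rfl
  · refine ⟨P, g, ?_⟩
    filter_upwards [hpos] with t ht
    exact ⟨ht.1, by simpa using ht.2⟩
  · refine ⟨P.reverse, fun t => -g (P.len - t), ?_⟩
    unfold AgreesWith
    change ∀ᵐ t ∂(volume.restrict P.dom), HasDerivAt (fun t => P.γ (P.len - t)) (-g (P.len - t)) t ∧
      0 < ⟪-g (P.len - t), B (P.γ (P.len - t))⟫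
    rw [restrict_dom] at hpos ⊢
    have hmp : MeasurePreserving (fun t : ℝ => P.len - t)
        (volume.restrict (Ioo 0 P.len)) (volume.restrict (Ioo 0 P.len)) := by
      have := (Measure.measurePreserving_sub_left (volume : Measure ℝ) P.len).restrict_preimage
        (measurableSet_Ioo (a := (0:ℝ)) (b := P.len))
      simpa using this
    filter_upwards [hmp.quasiMeasurePreserving.ae hpos] with t ht
    refine ⟨?_, ?_⟩
    · have := HasDerivAt.scomp t ht.1 ((hasDerivAt_id t).const_sub P.len)
      simpa [Function.comp_def] using this
    · rw [inner_neg_left]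
      linarith [ht.2]
end
end

section
/- Let Ω ⊂ ℝ² be open, let C ⊂ Ω be a simple Ω-closed Lipschitz curve, and let B : Ω → ℝ² be a bounded Borel vector field with |B(x)| = 1 and B(x) tangent to C for H¹-a.e. x ∈ C, satisfying ∫_C B·∇φ dH¹ = 0 for every φ ∈ C_c^∞(Ω). Suppose u ∈ L¹(H¹⌐C) and a finite Radon measure μ concentrated on C satisfy ∫_C u B·∇φ dH¹ + ∫_Ω φ dμ = 0 for every φ ∈ C_c^∞(Ω). Then for every Lipschitz parametrization γ : I_γ → Ω of C which agrees with B, the function u∘γ has bounded variation on I_γ; moreover, denoting by v⁺ and v⁻ the right-continuous and left-continuous representatives of u∘γ and letting μ_γ be the unique measure on I_γ with γ_#μ_γ = μ, for every β ∈ C¹(ℝ) one has ∫_C β(u) B·∇φ dH¹ + ∫_{I_γ} φ(γ(t)) f(v⁺(t), v⁻(t)) dμ_γ(t) = 0 for every φ ∈ C_c^∞(Ω), where f(p,q) = (β(p) − β(q))/(p − q) if p ≠ q and f(p,p) = β'(p). -/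
open MeasureTheory Set Filter
open scoped Topology ENNReal NNReal RealInnerProductSpace

noncomputable section

/-- The Vol'pert averaged superposition `f(p,q) = (β(p) - β(q))/(p - q)` for `p ≠ q`,
`f(p,p) = β'(p)`. -/
def volpert (β : ℝ → ℝ) (p q : ℝ) : ℝ :=
  if p = q then deriv β p else (β p - β q) / (p - q)

/-! ## One-dimensional preliminaries -/

lemma lip_ftc {f : ℝ → ℝ} {K : ℝ≥0} (hf : LipschitzWith K f) (a b : ℝ) :
    IntervalIntegrable (deriv f) volume a b ∧ ∫ t in a..b, deriv f t = f b - f a := by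
  have h := (hf.lipschitzOnWith (s := uIcc a b)).absolutelyContinuousOnInterval
  exact ⟨h.intervalIntegrable_deriv, h.integral_deriv_eq_sub⟩

lemma volpert_mvt {β : ℝ → ℝ} (hβ : ContDiff ℝ 1 β) (p q : ℝ) :
    ∃ ξ ∈ uIcc p q, volpert β p q = deriv β ξ := by
  have hd : Differentiable ℝ β := hβ.differentiable (by simp)
  have key : ∀ a b : ℝ, a < b → ∃ ξ ∈ Icc a b, (β b - β a) / (b - a) = deriv β ξ := by
    intro a b hab
    obtain ⟨c, hc, h⟩ := exists_deriv_eq_slope β hab hd.continuous.continuousOn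
      hd.differentiableOn
    exact ⟨c, Ioo_subset_Icc_self hc, h.symm⟩
  unfold volpert
  rcases lt_trichotomy p q with h | h | h
  · obtain ⟨c, hc, e⟩ := key p q h
    refine ⟨c, by rwa [uIcc_of_le h.le], ?_⟩
    rw [if_neg h.ne, ← e, ← neg_sub (β q), ← neg_sub q p, neg_div_neg_eq]
  · subst h
    exact ⟨p, by simp, by simp⟩
  · obtain ⟨c, hc, e⟩ := key q p h
    refine ⟨c, by rwa [uIcc_of_ge h.le], ?_⟩
    rw [if_neg h.ne', ← e]

lemma volpert_mul {β : ℝ → ℝ} (p q : ℝ) : volpert β p q * (p - q) = β p - β q := by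
  unfold volpert
  split_ifs with h
  · subst h; simp
  · have : p - q ≠ 0 := sub_ne_zero.mpr h
    field_simp

lemma volpert_continuous {β : ℝ → ℝ} (hβ : ContDiff ℝ 1 β) :
    Continuous (fun z : ℝ × ℝ => volpert β z.1 z.2) := by
  have hd : Continuous (deriv β) := hβ.continuous_deriv (by simp)
  rw [continuous_iff_continuousAt]
  rintro ⟨p, q⟩
  by_cases h : p = q
  · subst h
    rw [ContinuousAt, Metric.tendsto_nhds_nhds]
    intro ε hε
    obtain ⟨δ, hδ, H⟩ := Metric.continuousAt_iff.mp (hd.continuousAt (x := p)) ε hε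
    refine ⟨δ, hδ, ?_⟩
    rintro ⟨x, y⟩ hxy
    simp only [Prod.dist_eq, max_lt_iff] at hxy
    obtain ⟨ξ, hξ, e⟩ := volpert_mvt hβ x y
    have : volpert β p p = deriv β p := by simp [volpert]
    simp only [e, this]
    apply H
    have hc : uIcc x y ⊆ Metric.ball p δ := by
      rw [← segment_eq_uIcc]
      exact (convex_ball p δ).segment_subset hxy.1 hxy.2
    exact hc hξ
  · have : ∀ᶠ z : ℝ × ℝ in 𝓝 (p, q), volpert β z.1 z.2 = (β z.1 - β z.2) / (z.1 - z.2) := by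
      have ho : IsOpen {z : ℝ × ℝ | z.1 ≠ z.2} := isOpen_ne_fun continuous_fst continuous_snd
      filter_upwards [ho.mem_nhds (show (p, q) ∈ {z : ℝ × ℝ | z.1 ≠ z.2} from h)] with z hz
      have hz' : z.1 ≠ z.2 := hz
      simp [volpert, hz']
    refine ContinuousAt.congr ?_ (this.mono fun z hz => hz.symm)
    have hb := hβ.continuous
    apply ContinuousAt.div
    · fun_prop
    · fun_prop
    · exact sub_ne_zero.mpr h

/-- distribution function (right-continuous) -/
def cdfR (νp νn : Measure ℝ) (c t : ℝ) : ℝ := c + (νp.real (Iic t) - νn.real (Iic t))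
/-- distribution function (left-continuous) -/
def cdfL (νp νn : Measure ℝ) (c t : ℝ) : ℝ := c + (νp.real (Iio t) - νn.real (Iio t))

lemma tendsto_real_Iic_right (ν : Measure ℝ) [IsFiniteMeasure ν] (t : ℝ) :
    Tendsto (fun s => ν.real (Iic s)) (𝓝[≥] t) (𝓝 (ν.real (Iic t))) := by
  have : ContinuousWithinAt (fun s => ν.real (Iic s)) (Ici t) t := by
    rw [← continuousWithinAt_Ioi_iff_Ici]
    have h : Tendsto (fun s => ν (Iic s)) (𝓝[>] t) (𝓝 (ν (⋂ r > t, Iic r))) := by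
      apply tendsto_measure_biInter_gt
      · intro r _; exact measurableSet_Iic.nullMeasurableSet
      · intro i j _ hij; exact Iic_subset_Iic.mpr hij
      · exact ⟨t + 1, by simp, measure_ne_top _ _⟩
    have e : (⋂ r > t, Iic r) = Iic t := by
      ext x; simp only [gt_iff_lt, mem_iInter, mem_Iic]
      exact ⟨fun H => le_of_forall_gt_imp_ge_of_dense H, fun H i hi => H.trans hi.le⟩
    rw [e] at h
    exact (ENNReal.tendsto_toReal (measure_ne_top _ _)).comp h
  exact this

lemma tendsto_real_Iic_left (ν : Measure ℝ) [IsFiniteMeasure ν] (t : ℝ) :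
    Tendsto (fun s => ν.real (Iic s)) (𝓝[<] t) (𝓝 (ν.real (Iio t))) := by
  have hm : Monotone (fun s => ν.real (Iic s)) :=
    fun a b hab => measureReal_mono (Iic_subset_Iic.mpr hab)
  obtain ⟨u, hu, hu1, hu2⟩ := exists_seq_strictMono_tendsto t
  have h1 := hm.tendsto_nhdsLT t
  have h2 : Tendsto (fun n => ν (Iic (u n))) atTop (𝓝 (ν (⋃ n, Iic (u n)))) :=
    tendsto_measure_iUnion_atTop fun a b hab => Iic_subset_Iic.mpr (hu.monotone hab)
  have e : (⋃ n, Iic (u n)) = Iio t := by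
    ext x; simp only [mem_iUnion, mem_Iic, mem_Iio]
    constructor
    · rintro ⟨n, hn⟩; exact hn.trans_lt (hu1 n)
    · intro hx; exact ((hu2.eventually (lt_mem_nhds hx)).exists).imp fun n hn => hn.le
  rw [e] at h2
  have h3 := (ENNReal.tendsto_toReal (measure_ne_top _ _)).comp h2
  have h4 : Tendsto u atTop (𝓝[<] t) :=
    tendsto_nhdsWithin_iff.mpr ⟨hu2, Eventually.of_forall hu1⟩
  have := tendsto_nhds_unique (h1.comp h4) h3
  rw [this] at h1
  exact h1

lemma tendsto_real_Iio_left (ν : Measure ℝ) [IsFiniteMeasure ν] (t : ℝ) :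
    Tendsto (fun s => ν.real (Iio s)) (𝓝[≤] t) (𝓝 (ν.real (Iio t))) := by
  have : ContinuousWithinAt (fun s => ν.real (Iio s)) (Iic t) t := by
    rw [← continuousWithinAt_Iio_iff_Iic]
    have hm : Monotone (fun s => ν.real (Iio s)) :=
      fun a b hab => measureReal_mono (Iio_subset_Iio hab)
    obtain ⟨u, hu, hu1, hu2⟩ := exists_seq_strictMono_tendsto t
    have h1 := hm.tendsto_nhdsLT t
    have h2 : Tendsto (fun n => ν (Iio (u n))) atTop (𝓝 (ν (⋃ n, Iio (u n)))) :=
      tendsto_measure_iUnion_atTop fun a b hab => Iio_subset_Iio (hu.monotone hab)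
    have e : (⋃ n, Iio (u n)) = Iio t := by
      ext x; simp only [mem_iUnion, mem_Iio]
      constructor
      · rintro ⟨n, hn⟩; exact hn.trans (hu1 n)
      · intro hx; exact (hu2.eventually (lt_mem_nhds hx)).exists
    rw [e] at h2
    have h3 := (ENNReal.tendsto_toReal (measure_ne_top _ _)).comp h2
    have h4 : Tendsto u atTop (𝓝[<] t) :=
      tendsto_nhdsWithin_iff.mpr ⟨hu2, Eventually.of_forall hu1⟩
    have := tendsto_nhds_unique (h1.comp h4) h3
    rw [this] at h1
    exact h1
  exact this

lemma cdfR_tendsto_right (νp νn : Measure ℝ) [IsFiniteMeasure νp] [IsFiniteMeasure νn] (c t : ℝ) :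
    Tendsto (cdfR νp νn c) (𝓝[≥] t) (𝓝 (cdfR νp νn c t)) :=
  ((tendsto_real_Iic_right νp t).sub (tendsto_real_Iic_right νn t)).const_add c

lemma cdfR_tendsto_left (νp νn : Measure ℝ) [IsFiniteMeasure νp] [IsFiniteMeasure νn] (c t : ℝ) :
    Tendsto (cdfR νp νn c) (𝓝[<] t) (𝓝 (cdfL νp νn c t)) :=
  ((tendsto_real_Iic_left νp t).sub (tendsto_real_Iic_left νn t)).const_add c

lemma cdfL_tendsto_left (νp νn : Measure ℝ) [IsFiniteMeasure νp] [IsFiniteMeasure νn] (c t : ℝ) :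
    Tendsto (cdfL νp νn c) (𝓝[≤] t) (𝓝 (cdfL νp νn c t)) :=
  ((tendsto_real_Iio_left νp t).sub (tendsto_real_Iio_left νn t)).const_add c

lemma cdfR_measurable (νp νn : Measure ℝ) [IsFiniteMeasure νp] [IsFiniteMeasure νn] (c : ℝ) :
    Measurable (cdfR νp νn c) := by
  have hm : ∀ ν : Measure ℝ, IsFiniteMeasure ν → Measurable (fun s => ν.real (Iic s)) :=
    fun ν _ => Monotone.measurable fun a b hab => measureReal_mono (Iic_subset_Iic.mpr hab)
  exact ((hm νp inferInstance).sub (hm νn inferInstance)).const_add c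

lemma cdfR_bound (νp νn : Measure ℝ) [IsFiniteMeasure νp] [IsFiniteMeasure νn] (c t : ℝ) :
    |cdfR νp νn c t| ≤ |c| + (νp.real univ + νn.real univ) := by
  have h1 : νp.real (Iic t) ≤ νp.real univ := measureReal_mono (subset_univ _)
  have h2 : νn.real (Iic t) ≤ νn.real univ := measureReal_mono (subset_univ _)
  have h3 : 0 ≤ νp.real (Iic t) := measureReal_nonneg
  have h4 : 0 ≤ νn.real (Iic t) := measureReal_nonneg
  unfold cdfR
  refine (abs_add_le _ _).trans ?_
  gcongr
  rw [abs_le]; constructor <;> linarith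

lemma cdfR_sub (νp νn : Measure ℝ) [IsFiniteMeasure νp] [IsFiniteMeasure νn] (c : ℝ) {a b : ℝ}
    (hab : a ≤ b) : cdfR νp νn c b - cdfR νp νn c a = νp.real (Ioc a b) - νn.real (Ioc a b) := by
  have h : ∀ ν : Measure ℝ, IsFiniteMeasure ν →
      ν.real (Ioc a b) = ν.real (Iic b) - ν.real (Iic a) := by
    intro ν _
    have e : Ioc a b = Iic b \ Iic a := by
      ext x; simp only [mem_Ioc, Set.mem_sdiff, mem_Iic, not_le]; tauto
    rw [e, measureReal_sdiff (Iic_subset_Iic.mpr hab) measurableSet_Iic]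
  unfold cdfR
  rw [h νp inferInstance, h νn inferInstance]; ring

/-- grid point to the right -/
def gridR (A h t : ℝ) : ℝ := A + h * ⌈(t - A) / h⌉

lemma gridR_ge {A h : ℝ} (hh : 0 < h) (t : ℝ) : t ≤ gridR A h t := by
  have := Int.le_ceil ((t - A) / h)
  rw [div_le_iff₀ hh] at this
  unfold gridR; linarith

lemma gridR_lt {A h : ℝ} (hh : 0 < h) (t : ℝ) : gridR A h t - h < t := by
  have := Int.ceil_lt_add_one ((t - A) / h)
  have h2 : h * (⌈(t - A) / h⌉ : ℝ) < h * ((t - A) / h + 1) := by gcongr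
  have h3 : h * ((t - A) / h + 1) = t - A + h := by field_simp
  unfold gridR; linarith

lemma gridR_eq {A h : ℝ} (hh : 0 < h) (i : ℕ) {t : ℝ}
    (ht : t ∈ Ioc (A + h * i) (A + h * ((i + 1 : ℕ) : ℝ))) :
    gridR A h t = A + h * ((i + 1 : ℕ) : ℝ) := by
  have : ⌈(t - A) / h⌉ = ((i + 1 : ℕ) : ℤ) := by
    rw [Int.ceil_eq_iff]
    push_cast
    have h1 := ht.1
    have h2 := ht.2
    push_cast at h2
    rw [div_le_iff₀ hh, lt_div_iff₀ hh]
    constructor <;> nlinarith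
  unfold gridR
  rw [this]; simp

lemma gridR_measurable (A h : ℝ) : Measurable (gridR A h) := by
  unfold gridR
  have : Measurable (fun t : ℝ => ((⌈(t - A) / h⌉ : ℤ) : ℝ)) := by
    have h1 : Measurable (fun t : ℝ => (t - A) / h) := by fun_prop
    exact (measurable_of_countable (fun z : ℤ => (z : ℝ))).comp (Int.measurable_ceil.comp h1)
  exact (this.const_mul h).const_add A

lemma discrete_ibp {β ψ v : ℝ → ℝ} {K : ℝ≥0} (hψ : LipschitzWith K ψ)
    (νp νn : Measure ℝ) [IsFiniteMeasure νp] [IsFiniteMeasure νn]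
    (hv : ∀ a b : ℝ, a ≤ b → v b - v a = νp.real (Ioc a b) - νn.real (Ioc a b))
    {A L h : ℝ} (hh : 0 < h) (N : ℕ) (hN : A + h * N = L) :
    (∫ t in A..L, β (v (gridR A h t)) * deriv ψ t)
      + ((∫ t in A..L, ψ (gridR A h t - h) *
            volpert β (v (gridR A h t)) (v (gridR A h t - h)) ∂νp)
        - (∫ t in A..L, ψ (gridR A h t - h) *
            volpert β (v (gridR A h t)) (v (gridR A h t - h)) ∂νn))
      = ψ L * β (v L) - ψ A * β (v A) := by
  set T : ℕ → ℝ := fun i => A + h * i with hT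
  have hmono : ∀ i, T i ≤ T (i + 1) := by
    intro i; simp only [hT]; push_cast; nlinarith
  have hT0 : T 0 = A := by simp [hT]
  have hTN : T N = L := hN
  have hTs : ∀ i, T (i + 1) - h = T i := by intro i; simp only [hT]; push_cast; ring
  have hg : ∀ i, ∀ t ∈ uIoc (T i) (T (i + 1)), gridR A h t = T (i + 1) := by
    intro i t ht
    rw [uIoc_of_le (hmono i)] at ht
    exact gridR_eq hh i ht
  -- pieces
  have P1 : ∀ i, IntervalIntegrable (fun t => β (v (gridR A h t)) * deriv ψ t) volume
      (T i) (T (i + 1)) ∧ ∫ t in (T i)..(T (i + 1)), β (v (gridR A h t)) * deriv ψ t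
        = β (v (T (i + 1))) * (ψ (T (i + 1)) - ψ (T i)) := by
    intro i
    have hI := lip_ftc hψ (T i) (T (i + 1))
    have e : EqOn (fun t => β (v (T (i + 1))) * deriv ψ t)
        (fun t => β (v (gridR A h t)) * deriv ψ t) (uIoc (T i) (T (i + 1))) := by
      intro t ht; simp only [hg i t ht]
    refine ⟨(hI.1.const_mul _).congr e, ?_⟩
    rw [← hI.2, ← intervalIntegral.integral_const_mul]
    exact intervalIntegral.integral_congr_ae (Eventually.of_forall fun t ht => (e ht).symm)
  have P2 : ∀ (ν : Measure ℝ) [IsFiniteMeasure ν], ∀ i,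
      IntervalIntegrable (fun t => ψ (gridR A h t - h) *
            volpert β (v (gridR A h t)) (v (gridR A h t - h))) ν
      (T i) (T (i + 1)) ∧ ∫ t in (T i)..(T (i + 1)), ψ (gridR A h t - h) *
            volpert β (v (gridR A h t)) (v (gridR A h t - h)) ∂ν
        = ψ (T i) * volpert β (v (T (i + 1))) (v (T i)) * ν.real (Ioc (T i) (T (i + 1))) := by
    intro ν _ i
    have e : EqOn (fun t => ψ (T i) * volpert β (v (T (i + 1))) (v (T i)))
        (fun t => ψ (gridR A h t - h) *
            volpert β (v (gridR A h t)) (v (gridR A h t - h))) (uIoc (T i) (T (i + 1))) := by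
      intro t ht; simp only [hg i t ht, hTs]
    refine ⟨(intervalIntegrable_const).congr e, ?_⟩
    rw [intervalIntegral.integral_congr_ae (Eventually.of_forall fun t ht => (e ht).symm),
      intervalIntegral.integral_of_le (hmono i), setIntegral_const, smul_eq_mul, mul_comm]
  have S1 := intervalIntegral.sum_integral_adjacent_intervals (n := N) fun k _ => (P1 k).1
  have S2 := intervalIntegral.sum_integral_adjacent_intervals (n := N) fun k _ => (P2 νp k).1
  have S3 := intervalIntegral.sum_integral_adjacent_intervals (n := N) fun k _ => (P2 νn k).1
  rw [hT0, hTN] at S1 S2 S3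
  rw [← S1, ← S2, ← S3, ← Finset.sum_sub_distrib, ← Finset.sum_add_distrib]
  have hs := Finset.sum_range_sub (fun j => ψ (T j) * β (v (T j))) N
  rw [hT0, hTN] at hs
  rw [← hs]
  refine Finset.sum_congr rfl fun i _ => ?_
  · rw [(P1 i).2, (P2 νp i).2, (P2 νn i).2, ← mul_sub, ← hv _ _ (hmono i), mul_assoc,
      volpert_mul]
    ring

lemma ibp {β ψ : ℝ → ℝ} {K : ℝ≥0} (hψ : LipschitzWith K ψ) (hβ : ContDiff ℝ 1 β)
    (νp νn : Measure ℝ) [IsFiniteMeasure νp] [IsFiniteMeasure νn] (c : ℝ)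
    {A L : ℝ} (hAL : A < L) :
    (∫ t in A..L, β (cdfR νp νn c t) * deriv ψ t)
      + ((∫ t in A..L, ψ t * volpert β (cdfR νp νn c t) (cdfL νp νn c t) ∂νp)
        - (∫ t in A..L, ψ t * volpert β (cdfR νp νn c t) (cdfL νp νn c t) ∂νn))
      = ψ L * β (cdfR νp νn c L) - ψ A * β (cdfR νp νn c A) := by
  set v := cdfR νp νn c with hv
  set vm := cdfL νp νn c with hvm
  set H : ℕ → ℝ := fun n => (L - A) / ((n : ℝ) + 1) with hH
  have hHpos : ∀ n, 0 < H n := fun n => div_pos (sub_pos.mpr hAL) (by positivity)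
  have hHle : ∀ n, H n ≤ L - A := fun n => by
    apply div_le_self (sub_pos.mpr hAL).le
    have : (0 : ℝ) ≤ n := Nat.cast_nonneg n
    linarith
  have hH0 : Tendsto H atTop (𝓝 0) := by
    have := (tendsto_one_div_add_atTop_nhds_zero_nat (𝕜 := ℝ)).const_mul (L - A)
    simpa [hH, div_eq_mul_inv] using this
  have hq : ∀ t, Tendsto (fun n => gridR A (H n) t) atTop (𝓝[≥] t) := by
    intro t
    refine tendsto_nhdsWithin_iff.mpr ⟨?_, Eventually.of_forall fun n => gridR_ge (hHpos n) t⟩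
    refine tendsto_of_tendsto_of_tendsto_of_le_of_le (g := fun _ => t) (h := fun n => t + H n)
      tendsto_const_nhds (by simpa using hH0.const_add t)
      (fun n => gridR_ge (hHpos n) t) (fun n => ?_)
    have := gridR_lt (A := A) (hHpos n) t
    simp only; linarith
  have hp : ∀ t, Tendsto (fun n => gridR A (H n) t - H n) atTop (𝓝[<] t) := by
    intro t
    refine tendsto_nhdsWithin_iff.mpr ⟨?_, Eventually.of_forall fun n => gridR_lt (hHpos n) t⟩
    simpa using (tendsto_nhds_of_tendsto_nhdsWithin (hq t)).sub hH0
  have hvq : ∀ t, Tendsto (fun n => v (gridR A (H n) t)) atTop (𝓝 (v t)) :=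
    fun t => (cdfR_tendsto_right νp νn c t).comp (hq t)
  have hvp : ∀ t, Tendsto (fun n => v (gridR A (H n) t - H n)) atTop (𝓝 (vm t)) :=
    fun t => (cdfR_tendsto_left νp νn c t).comp (hp t)
  obtain ⟨M, hM⟩ : ∃ M, ∀ t, |v t| ≤ M := ⟨_, cdfR_bound νp νn c⟩
  have hvI : ∀ t, v t ∈ Icc (-M) M := fun t => abs_le.mp (hM t)
  obtain ⟨Mb, hMb⟩ := (isCompact_Icc (a := -M) (b := M)).exists_bound_of_continuousOn
    hβ.continuous.continuousOn
  obtain ⟨Md, hMd⟩ := (isCompact_Icc (a := -M) (b := M)).exists_bound_of_continuousOn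
    (hβ.continuous_deriv (by simp)).continuousOn
  have hvolb : ∀ s t, |volpert β (v s) (v t)| ≤ Md := by
    intro s t
    obtain ⟨ξ, hξ, e⟩ := volpert_mvt hβ (v s) (v t)
    rw [e]
    exact hMd ξ (uIcc_subset_Icc (hvI s) (hvI t) hξ)
  obtain ⟨Mψ, hMψ⟩ := (isCompact_Icc (a := A - (L - A)) (b := L)).exists_bound_of_continuousOn
    hψ.continuous.continuousOn
  have hMψ0 : 0 ≤ Mψ := (norm_nonneg _).trans (hMψ L ⟨by linarith, le_rfl⟩)
  have hmeasv : Measurable v := cdfR_measurable νp νn c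
  have hgm : ∀ n, Measurable (gridR A (H n)) := fun n => gridR_measurable _ _
  -- convergence of the first term
  have L1 : Tendsto (fun n => ∫ t in A..L, β (v (gridR A (H n) t)) * deriv ψ t) atTop
      (𝓝 (∫ t in A..L, β (v t) * deriv ψ t)) := by
    apply intervalIntegral.tendsto_integral_filter_of_dominated_convergence
      (fun t => Mb * ‖deriv ψ t‖)
    · refine Eventually.of_forall fun n => ?_
      exact (((hβ.continuous.measurable.comp (hmeasv.comp (hgm n))).mul
        (measurable_deriv ψ))).aestronglyMeasurable
    · refine Eventually.of_forall fun n => Eventually.of_forall fun t _ => ?_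
      rw [norm_mul]
      gcongr
      exact hMb _ (hvI _)
    · exact ((lip_ftc hψ A L).1.norm).const_mul _
    · refine Eventually.of_forall fun t _ => ?_
      exact ((hβ.continuous.tendsto _).comp (hvq t)).mul_const _
  have L2 : ∀ (ν : Measure ℝ) [IsFiniteMeasure ν], Tendsto (fun n => ∫ t in A..L,
      ψ (gridR A (H n) t - H n) *
            volpert β (v (gridR A (H n) t)) (v (gridR A (H n) t - H n)) ∂ν) atTop
      (𝓝 (∫ t in A..L, ψ t * volpert β (v t) (vm t) ∂ν)) := by
    intro ν _
    apply intervalIntegral.tendsto_integral_filter_of_dominated_convergence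
      (fun t => Mψ * Md)
    · refine Eventually.of_forall fun n => ?_
      have m1 : Measurable (fun t => gridR A (H n) t - H n) := (hgm n).sub_const _
      have m2 : Measurable (fun t => volpert β (v (gridR A (H n) t)) (v (gridR A (H n) t - H n))) :=
        (volpert_continuous hβ).measurable.comp
          ((hmeasv.comp (hgm n)).prodMk (hmeasv.comp m1))
      exact ((hψ.continuous.measurable.comp m1).mul m2).aestronglyMeasurable
    · refine Eventually.of_forall fun n => Eventually.of_forall fun t ht => ?_
      rw [norm_mul]
      rw [uIoc_of_le hAL.le] at ht
      have h1 := gridR_lt (A := A) (hHpos n) t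
      have h2 := gridR_ge (A := A) (hHpos n) t
      have h3 := hHle n
      gcongr
      · exact hMψ _ ⟨by linarith [ht.1], by linarith [ht.2]⟩
      · exact hvolb _ _
    · exact intervalIntegrable_const
    · refine Eventually.of_forall fun t _ => ?_
      refine ((hψ.continuous.tendsto _).comp (tendsto_nhds_of_tendsto_nhdsWithin (hp t))).mul ?_
      exact ((volpert_continuous hβ).tendsto (v t, vm t)).comp ((hvq t).prodMk_nhds (hvp t))
  have LL := L1.add ((L2 νp).sub (L2 νn))
  refine tendsto_nhds_unique LL ?_
  refine tendsto_const_nhds.congr fun n => ?_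
  refine (discrete_ibp hψ νp νn (fun a b hab => cdfR_sub νp νn c hab) (hHpos n) (n + 1) ?_).symm
  simp only [hH]; push_cast; field_simp; ring

/-! ## Area formula for Lipschitz curves -/

abbrev E2 := EuclideanSpace ℝ (Fin 2)

lemma edist_le_hausdorff {γ : ℝ → E2} (hc : Continuous γ) {a b : ℝ} (hab : a ≤ b) :
    ENNReal.ofReal ‖γ b - γ a‖ ≤ μH[1] (γ '' Icc a b) := by
  have hl : LipschitzWith 1 (fun x : E2 => dist x (γ a)) := LipschitzWith.dist_left (γ a)
  have h1 := hl.hausdorffMeasure_image_le (d := 1) zero_le_one (γ '' Icc a b)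
  simp only [ENNReal.coe_one, ENNReal.one_rpow, one_mul] at h1
  refine le_trans ?_ h1
  rw [hausdorffMeasure_real]
  have hconn : IsPreconnected ((fun x : E2 => dist x (γ a)) '' (γ '' Icc a b)) :=
    (isPreconnected_Icc.image γ hc.continuousOn).image _ hl.continuous.continuousOn
  have hsub : Icc 0 ‖γ b - γ a‖ ⊆ (fun x : E2 => dist x (γ a)) '' (γ '' Icc a b) := by
    apply hconn.Icc_subset
    · exact ⟨γ a, ⟨a, left_mem_Icc.mpr hab, rfl⟩, by simp⟩
    · exact ⟨γ b, ⟨b, right_mem_Icc.mpr hab, rfl⟩, by simp [dist_eq_norm]⟩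
  calc ENNReal.ofReal ‖γ b - γ a‖ = volume (Icc 0 ‖γ b - γ a‖) := by simp
    _ ≤ _ := measure_mono hsub

lemma lip_deriv_bound {γ : ℝ → E2} {K : ℝ≥0} (h : LipschitzWith K γ) (t : ℝ) :
    ‖deriv γ t‖ ≤ K := norm_deriv_le_of_lipschitz h

lemma speed_intervalIntegrable {γ : ℝ → E2} {K : ℝ≥0} (h : LipschitzWith K γ) (a b : ℝ) :
    IntervalIntegrable (fun t => ‖deriv γ t‖) volume a b := by
  refine (intervalIntegrable_const (c := (K : ℝ))).mono_fun
    (measurable_deriv γ).norm.aestronglyMeasurable (Eventually.of_forall fun t => ?_)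
  simp only [norm_norm, NNReal.norm_eq]
  exact lip_deriv_bound h t

lemma norm_sub_le_integral {γ : ℝ → E2} {K : ℝ≥0} (h : LipschitzWith K γ) {a b : ℝ}
    (hab : a ≤ b) : ‖γ b - γ a‖ ≤ ∫ t in a..b, ‖deriv γ t‖ := by
  set e := γ b - γ a with he
  have hlip : LipschitzWith (‖innerSL ℝ e‖₊ * K) (fun t => ⟪e, γ t⟫) :=
    (innerSL ℝ e).lipschitz.comp h
  have h1 := (lip_ftc hlip a b)
  have h2 : ∀ᵐ t : ℝ, deriv (fun t => ⟪e, γ t⟫) t ≤ ‖e‖ * ‖deriv γ t‖ := by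
    filter_upwards [h.ae_differentiableAt_real] with t ht
    have hd : HasDerivAt (fun t => ⟪e, γ t⟫) ⟪e, deriv γ t⟫ t :=
      (innerSL ℝ e).hasFDerivAt.comp_hasDerivAt t ht.hasDerivAt
    rw [hd.deriv]
    exact real_inner_le_norm _ _
  have h3 : ∫ t in a..b, deriv (fun t => ⟪e, γ t⟫) t ≤ ∫ t in a..b, ‖e‖ * ‖deriv γ t‖ :=
    intervalIntegral.integral_mono_ae hab h1.1
      ((speed_intervalIntegrable h a b).const_mul _) h2
  rw [h1.2, intervalIntegral.integral_const_mul, ← inner_sub_right, ← he,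
    real_inner_self_eq_norm_mul_norm] at h3
  rcases (norm_nonneg e).eq_or_lt with h0 | h0
  · rw [← h0]
    exact intervalIntegral.integral_nonneg hab fun t _ => norm_nonneg _
  · exact le_of_mul_le_mul_left h3 h0

lemma hausdorff_le_integral {γ : ℝ → E2} {K : ℝ≥0} (h : LipschitzWith K γ) {a b : ℝ}
    (hab : a ≤ b) : μH[1] (γ '' Icc a b) ≤ ENNReal.ofReal (∫ t in a..b, ‖deriv γ t‖) := by
  set A : ℝ → ℝ := fun t => ∫ s in a..t, ‖deriv γ s‖ with hA
  have hAsub : ∀ s t, A t - A s = ∫ x in s..t, ‖deriv γ x‖ := fun s t =>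
    intervalIntegral.integral_interval_sub_left (speed_intervalIntegrable h a t)
      (speed_intervalIntegrable h a s)
  have hdist : ∀ s t, dist (γ s) (γ t) ≤ dist (A s) (A t) := by
    have key : ∀ s t, s ≤ t → dist (γ s) (γ t) ≤ dist (A s) (A t) := by
      intro s t hst
      rw [dist_comm, dist_comm (A s), dist_eq_norm, Real.dist_eq, hAsub]
      exact (norm_sub_le_integral h hst).trans (le_abs_self _)
    intro s t
    rcases le_total s t with hst | hst
    · exact key s t hst
    · rw [dist_comm, dist_comm (A s)]; exact key t s hst
  have hmono : MonotoneOn A (Icc a b) := by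
    intro s _ t _ hst
    have : 0 ≤ A t - A s := by
      rw [hAsub]; exact intervalIntegral.integral_nonneg hst fun t _ => norm_nonneg _
    linarith
  set Γ : ℝ → E2 := fun x => γ (Function.invFunOn A (Icc a b) x) with hΓ
  have hinv : ∀ x ∈ A '' Icc a b, A (Function.invFunOn A (Icc a b) x) = x := fun x hx =>
    Function.invFunOn_eq hx
  have hΓA : ∀ t ∈ Icc a b, Γ (A t) = γ t := by
    intro t ht
    have := hdist (Function.invFunOn A (Icc a b) (A t)) t
    rw [hinv _ ⟨t, ht, rfl⟩, dist_self] at this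
    exact dist_le_zero.mp this
  have hLip : LipschitzOnWith 1 Γ (A '' Icc a b) := by
    apply LipschitzOnWith.of_dist_le_mul
    intro x hx y hy
    simp only [NNReal.coe_one, one_mul]
    refine (hdist _ _).trans ?_
    rw [hinv x hx, hinv y hy]
  have him : γ '' Icc a b = Γ '' (A '' Icc a b) := by
    rw [image_image]
    exact image_congr fun t ht => (hΓA t ht).symm
  have h1 := hLip.hausdorffMeasure_image_le (d := 1) zero_le_one
  simp only [ENNReal.coe_one, ENNReal.one_rpow, one_mul, hausdorffMeasure_real] at h1
  rw [him]
  refine h1.trans ?_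
  have hsub : A '' Icc a b ⊆ Icc (A a) (A b) := by
    rintro _ ⟨t, ht, rfl⟩
    exact ⟨hmono (left_mem_Icc.mpr hab) ht ht.1, hmono ht (right_mem_Icc.mpr hab) ht.2⟩
  refine (measure_mono hsub).trans ?_
  rw [Real.volume_Icc, hAsub]

lemma exists_arc_measure {γ : ℝ → E2} (hc : Continuous γ) {D : Set ℝ}
    (hD : MeasurableSet D) (hinj : InjOn γ D) :
    ∃ m : Measure ℝ, (∀ S, MeasurableSet S → m S = μH[1] (γ '' (S ∩ D))) ∧
      Measure.map γ m = (μH[1] : Measure E2).restrict (γ '' D) := by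
  have hemb : MeasurableEmbedding (D.domRestrict γ) := hc.continuousOn.measurableEmbedding hD hinj
  set m : Measure ℝ := Measure.map (Subtype.val : D → ℝ) (Measure.comap (D.domRestrict γ) μH[1])
  have hm : ∀ S, MeasurableSet S → m S = μH[1] (γ '' (S ∩ D)) := by
    intro S hS
    rw [Measure.map_apply measurable_subtype_coe hS, hemb.comap_apply]
    congr 1
    ext x; simp only [mem_image, mem_preimage, Subtype.exists, domRestrict_apply, mem_inter_iff]
    constructor
    · rintro ⟨t, ht, h1, h2⟩; exact ⟨t, ⟨h1, ht⟩, h2⟩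
    · rintro ⟨t, ⟨h1, ht⟩, h2⟩; exact ⟨t, ht, h1, h2⟩
  refine ⟨m, hm, ?_⟩
  ext S hS
  rw [Measure.map_apply hc.measurable hS, hm _ (hc.measurable hS), Measure.restrict_apply hS,
    image_preimage_inter]

lemma area_formula {γ : ℝ → E2} {K : ℝ≥0} (h : LipschitzWith K γ) {D : Set ℝ} {L : ℝ}
    (hD : MeasurableSet D) (hD1 : Ioo 0 L ⊆ D) (hD2 : D ⊆ Ico 0 L) (hinj : InjOn γ D) :
    (μH[1] : Measure E2).restrict (γ '' D) =
      Measure.map γ ((volume.restrict D).withDensity fun t => ‖deriv γ t‖ₑ) := by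
  obtain ⟨m, hm, hmap⟩ := exists_arc_measure h.continuous hD hinj
  rw [← hmap]
  congr 1
  have hpt : ∀ t, m {t} = 0 := by
    intro t
    rw [hm _ (measurableSet_singleton t)]
    refine measure_mono_null (t := {γ t}) ?_ ?_
    · rintro _ ⟨s, ⟨rfl, _⟩, rfl⟩; rfl
    · have := Measure.nullSingletonClass_hausdorff E2 (d := 1) one_pos
      exact measure_singleton _
  have hmle : ∀ S, MeasurableSet S → m S ≤ K * volume S := by
    intro S hS
    rw [hm S hS]
    have h1 := h.hausdorffMeasure_image_le (d := 1) zero_le_one (S ∩ D)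
    simp only [ENNReal.rpow_one, hausdorffMeasure_real] at h1
    exact h1.trans (by gcongr; exact inter_subset_left)
  have hmD : m Dᶜ = 0 := by
    rw [hm _ hD.compl]; simp
  have hfin : IsFiniteMeasure m := by
    constructor
    rw [← measure_add_measure_compl hD, hmD, add_zero]
    refine (hmle D hD).trans_lt ?_
    refine ENNReal.mul_lt_top ENNReal.coe_lt_top ?_
    refine (measure_mono hD2).trans_lt ?_
    simp
  have hIoc : ∀ a b, 0 ≤ a → a ≤ b → b ≤ L →
      m (Ioc a b) = ENNReal.ofReal (∫ t in a..b, ‖deriv γ t‖) := by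
    intro a b ha hab hb
    apply le_antisymm
    · rw [hm _ measurableSet_Ioc]
      refine (measure_mono ?_).trans (hausdorff_le_integral h hab)
      exact image_mono (inter_subset_left.trans Ioc_subset_Icc_self)
    · set S : ℝ → ℝ := fun t => m.real (Iic t) with hS
      have hSsub : ∀ s t, s ≤ t → S t - S s = m.real (Ioc s t) := by
        intro s t hst
        have e : Ioc s t = Iic t \ Iic s := by
          ext x; simp only [mem_Ioc, Set.mem_sdiff, mem_Iic, not_le]; tauto
        rw [e, measureReal_sdiff (Iic_subset_Iic.mpr hst) measurableSet_Iic]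
      have hSlip : LipschitzWith K S := by
        have key : ∀ s t, s ≤ t → dist (S s) (S t) ≤ K * dist s t := by
          intro s t hst
          rw [dist_comm, dist_comm s, Real.dist_eq, Real.dist_eq, hSsub s t hst,
            abs_of_nonneg measureReal_nonneg, abs_of_nonneg (sub_nonneg.mpr hst)]
          have := hmle (Ioc s t) measurableSet_Ioc
          rw [Real.volume_Ioc] at this
          have h2 := ENNReal.toReal_mono (by finiteness) this
          simpa [Measure.real, ENNReal.toReal_mul, sub_nonneg.mpr hst] using h2
        apply LipschitzWith.of_dist_le_mul
        intro s t
        rcases le_total s t with hst | hst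
        · exact key s t hst
        · rw [dist_comm, dist_comm s]; exact key t s hst
      have hγS : ∀ s t, 0 ≤ s → s ≤ t → t ≤ L → ‖γ t - γ s‖ ≤ S t - S s := by
        intro s t hs hst ht
        rw [hSsub s t hst, Measure.real, ← ENNReal.ofReal_le_iff_le_toReal (measure_ne_top _ _)]
        refine (edist_le_hausdorff h.continuous hst).trans ?_
        have hsub : γ '' Icc s t ⊆ γ '' (Ioc s t ∩ D) ∪ ({γ s} ∪ {γ t}) := by
          rintro _ ⟨x, hx, rfl⟩
          rcases hx.1.eq_or_lt with h0 | h0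
          · subst h0; simp
          rcases hx.2.eq_or_lt with h1 | h1
          · subst h1; simp
          left
          exact ⟨x, ⟨⟨h0, hx.2⟩, hD1 ⟨by linarith, by linarith⟩⟩, rfl⟩
        have hna := Measure.nullSingletonClass_hausdorff E2 (d := 1) one_pos
        refine (measure_mono hsub).trans ((measure_union_le _ _).trans ?_)
        rw [hm _ measurableSet_Ioc]
        have : μH[1] ({γ s} ∪ {γ t} : Set E2) = 0 := by
          rw [measure_union_null_iff]; simp
        rw [this, add_zero]
      have hder : ∀ᵐ t : ℝ, t ∈ Ioo a b → ‖deriv γ t‖ ≤ deriv S t := by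
        filter_upwards [h.ae_differentiableAt_real, hSlip.ae_differentiableAt_real] with t h1 h2 ht
        have l1 := (hasDerivAt_iff_tendsto_slope.mp h1.hasDerivAt).mono_left
          (nhdsWithin_mono t (show Ioi t ⊆ {t}ᶜ from fun x hx => ne_of_gt hx))
        have l2 := (hasDerivAt_iff_tendsto_slope.mp h2.hasDerivAt).mono_left
          (nhdsWithin_mono t (show Ioi t ⊆ {t}ᶜ from fun x hx => ne_of_gt hx))
        refine le_of_tendsto_of_tendsto l1.norm l2 ?_
        filter_upwards [Ioo_mem_nhdsGT ht.2] with x hx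
        rw [slope_def_module, slope_def_module, norm_smul, norm_inv, Real.norm_of_nonneg
          (sub_pos.mpr hx.1).le, smul_eq_mul]
        have := hγS t x (by linarith [ht.1]) hx.1.le (by linarith [hx.2])
        have hp : 0 ≤ (x - t)⁻¹ := inv_nonneg.mpr (sub_pos.mpr hx.1).le
        gcongr
      have hle : ∫ t in a..b, ‖deriv γ t‖ ≤ ∫ t in a..b, deriv S t := by
        rw [intervalIntegral.integral_of_le hab, intervalIntegral.integral_of_le hab]
        have i1 := (speed_intervalIntegrable h a b)
        have i2 := (lip_ftc hSlip a b).1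
        rw [intervalIntegrable_iff_integrableOn_Ioc_of_le hab] at i1 i2
        rw [integral_Ioc_eq_integral_Ioo, integral_Ioc_eq_integral_Ioo]
        refine setIntegral_mono_ae_restrict (i1.mono_set Ioo_subset_Ioc_self)
          (i2.mono_set Ioo_subset_Ioc_self) ?_
        exact (ae_restrict_iff' measurableSet_Ioo).mpr hder
      rw [(lip_ftc hSlip a b).2, hSsub a b hab] at hle
      exact ENNReal.ofReal_le_of_le_toReal hle
  have hDae : (volume.restrict D) = volume.restrict (Ioc 0 L) := by
    apply Measure.restrict_congr_set
    have e1 : (Ioo 0 L : Set ℝ) =ᵐ[volume] Ioc 0 L := Ioo_ae_eq_Ioc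
    have e2 : (Ico 0 L : Set ℝ) =ᵐ[volume] Ioc 0 L := Ico_ae_eq_Ioc
    exact (hD2.eventuallyLE.trans e2.le).antisymm (e1.symm.le.trans hD1.eventuallyLE)
  rw [hDae]
  set M := (volume.restrict (Ioc 0 L)).withDensity fun t => ‖deriv γ t‖ₑ with hMdef
  have hMapp : ∀ S, MeasurableSet S → M S = ∫⁻ t in S ∩ Ioc 0 L, ‖deriv γ t‖ₑ := by
    intro S hS
    rw [hMdef, withDensity_apply _ hS, Measure.restrict_restrict hS]
  have hmapp : ∀ S, MeasurableSet S → m S = m (S ∩ Ioc 0 L) := by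
    intro S hS
    refine measure_congr ?_
    have : ∀ᵐ t ∂m, t ∈ Ioc 0 L := by
      have h0 : ∀ᵐ t ∂m, t ≠ 0 := by
        rw [ae_iff]; simpa using hpt 0
      have h1 : ∀ᵐ t ∂m, t ∈ D := by
        rw [ae_iff]; exact hmD
      filter_upwards [h0, h1] with t h0 h1
      exact ⟨lt_of_le_of_ne (hD2 h1).1 (Ne.symm h0), (hD2 h1).2.le⟩
    filter_upwards [this] with t ht
    apply propext
    exact ⟨fun h => ⟨h, ht⟩, fun h => h.1⟩
  refine Measure.ext_of_Ioc m M fun a b hab => ?_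
  rw [hmapp _ measurableSet_Ioc, hMapp _ measurableSet_Ioc, Ioc_inter_Ioc]
  rcases le_total (a ⊔ 0) (b ⊓ L) with hle | hle
  · rw [hIoc _ _ le_sup_right hle inf_le_right, intervalIntegral.integral_of_le hle,
      ofReal_integral_norm_eq_lintegral_enorm]
    have i1 := speed_intervalIntegrable h (a ⊔ 0) (b ⊓ L)
    rw [intervalIntegrable_iff_integrableOn_Ioc_of_le hle] at i1
    exact (integrable_norm_iff (measurable_deriv γ).aestronglyMeasurable).mp i1
  · rw [Ioc_eq_empty (not_lt.mpr hle)]; simp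

/-! ## Structure of the curve, tangency, change of variables -/

namespace SimpleOmegaClosedCurve

variable {Ω C : Set (EuclideanSpace ℝ (Fin 2))}

lemma facts (Q : SimpleOmegaClosedCurve Ω C) :
    MeasurableSet Q.dom ∧ Ioo 0 Q.len ⊆ Q.dom ∧ Q.dom ⊆ Ico 0 Q.len ∧ InjOn Q.γ Q.dom ∧
      C = Q.γ '' Q.dom := by
  rcases Q.cases with ⟨_, h1, h2, h3⟩ | ⟨h1, h2, h3, _⟩
  · refine ⟨by rw [h1]; exact measurableSet_Ico, by rw [h1]; exact Ioo_subset_Ico_self,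
      by rw [h1], h2, h3⟩
  · refine ⟨by rw [h1]; exact measurableSet_Ioo, by rw [h1],
      by rw [h1]; exact Ioo_subset_Ico_self, h2, h3⟩

lemma mem_C (Q : SimpleOmegaClosedCurve Ω C) {t : ℝ} (ht : t ∈ Q.dom) : Q.γ t ∈ C :=
  Q.facts.2.2.2.2.symm.le ⟨t, ht, rfl⟩

lemma inj_strong (Q : SimpleOmegaClosedCurve Ω C) (hΩ : IsOpen Ω) {s t : ℝ}
    (ht : t ∈ Ioo 0 Q.len) (hs : s ∈ Icc 0 Q.len) (h : Q.γ s = Q.γ t) : s = t := by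
  have hL := Q.len_pos
  rcases Q.cases with ⟨hp, h1, h2, h3⟩ | ⟨h1, h2, h3, h4, h5, _⟩
  · rw [h1] at h2
    rcases hs.2.eq_or_lt with e | e
    · exfalso
      have h0 : Q.γ 0 = Q.γ t := by
        rw [← h, e]; have := hp 0; rw [zero_add] at this; exact this.symm
      have := h2 ⟨le_rfl, hL⟩ ⟨ht.1.le, ht.2⟩ h0
      exact absurd this ht.1.ne
    · exact h2 ⟨hs.1, e⟩ ⟨ht.1.le, ht.2⟩ h
  · have hC : Q.γ t ∈ Ω := Q.sub (Q.mem_C (by rw [h1]; exact ht))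
    have hfr : ∀ x ∈ frontier Ω, x ∉ Ω := fun x hx hx' => by
      rw [hΩ.frontier_eq] at hx; exact hx.2 hx'
    rw [h1] at h2
    rcases hs.1.eq_or_lt with e0 | e0
    · subst e0; rw [← h] at hC; exact absurd hC (hfr _ h4)
    rcases hs.2.eq_or_lt with e | e
    · subst e; rw [← h] at hC; exact absurd hC (hfr _ h5)
    exact h2 ⟨e0, e⟩ ht h

lemma dom_restrict (Q : SimpleOmegaClosedCurve Ω C) :
    (volume.restrict Q.dom) = volume.restrict (Ioc 0 Q.len) := by
  obtain ⟨_, hD1, hD2, _⟩ := Q.facts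
  apply Measure.restrict_congr_set
  have e1 : (Ioo 0 Q.len : Set ℝ) =ᵐ[volume] Ioc 0 Q.len := Ioo_ae_eq_Ioc
  have e2 : (Ico 0 Q.len : Set ℝ) =ᵐ[volume] Ioc 0 Q.len := Ico_ae_eq_Ioc
  exact (hD2.eventuallyLE.trans e2.le).antisymm (e1.symm.le.trans hD1.eventuallyLE)

lemma ae_interior (Q : SimpleOmegaClosedCurve Ω C) :
    ∀ᵐ t ∂(volume.restrict Q.dom), t ∈ Ioo 0 Q.len := by
  rw [Q.dom_restrict, ← Measure.restrict_congr_set Ioo_ae_eq_Ioc]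
  exact ae_restrict_mem measurableSet_Ioo

/-- the speed measure of the curve -/
def speed (Q : SimpleOmegaClosedCurve Ω C) : Measure ℝ :=
  (volume.restrict Q.dom).withDensity fun t => ((‖deriv Q.γ t‖₊ : ℝ≥0) : ℝ≥0∞)

lemma area (Q : SimpleOmegaClosedCurve Ω C) :
    (μH[1] : Measure E2).restrict C = Measure.map Q.γ Q.speed := by
  obtain ⟨hD, hD1, hD2, hi, hC⟩ := Q.facts
  conv_lhs => rw [hC]
  exact area_formula Q.lip hD hD1 hD2 hi

lemma tendsto_inv (P : SimpleOmegaClosedCurve Ω C) (hΩ : IsOpen Ω) {t₀ : ℝ}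
    (ht₀ : t₀ ∈ Ioo 0 P.len) :
    Tendsto (Function.invFunOn P.γ P.dom) (𝓝[C] (P.γ t₀)) (𝓝 t₀) := by
  obtain ⟨_, _, hD2, _, hC⟩ := P.facts
  intro U hU
  obtain ⟨V, hVU, hVo, hV⟩ := mem_nhds_iff.mp hU
  have hK : IsCompact (P.γ '' (Icc 0 P.len \ V)) :=
    (isCompact_Icc.diff hVo).image P.lip.continuous
  have hn : P.γ t₀ ∉ P.γ '' (Icc 0 P.len \ V) := by
    rintro ⟨s, hs, e⟩
    have := P.inj_strong hΩ ht₀ hs.1 e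
    subst this
    exact hs.2 hV
  have h1 : (P.γ '' (Icc 0 P.len \ V))ᶜ ∈ 𝓝 (P.γ t₀) := hK.isClosed.isOpen_compl.mem_nhds hn
  rw [mem_map]
  filter_upwards [mem_nhdsWithin_of_mem_nhds h1, self_mem_nhdsWithin] with x hx hxC
  rw [hC] at hxC
  have m1 := Function.invFunOn_mem hxC
  have m2 := Function.invFunOn_eq hxC
  by_contra hnU
  exact hx ⟨_, ⟨Ico_subset_Icc_self (hD2 m1), fun h => hnU (hVU h)⟩, m2⟩

lemma parallel (P : SimpleOmegaClosedCurve Ω C) (hΩ : IsOpen Ω) {t₀ s : ℝ}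
    (ht₀ : t₀ ∈ Ioo 0 P.len) {γ : ℝ → E2} {g g₀ n : E2} (hg : HasDerivAt γ g s)
    (hγC : ∀ᶠ s' in 𝓝 s, γ s' ∈ C) (he : P.γ t₀ = γ s) (hg₀ : HasDerivAt P.γ g₀ t₀)
    (hg₀0 : g₀ ≠ 0) (hn : ⟪g₀, n⟫ = 0) : ⟪g, n⟫ = 0 := by
  obtain ⟨_, _, hD2, _, hC⟩ := P.facts
  set τ : ℝ → ℝ := fun s' => Function.invFunOn P.γ P.dom (γ s') with hτ
  have hτt : Tendsto τ (𝓝 s) (𝓝 t₀) := by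
    refine (P.tendsto_inv hΩ ht₀).comp (tendsto_nhdsWithin_iff.mpr ⟨?_, hγC⟩)
    rw [he]; exact hg.continuousAt
  have hPτ : ∀ᶠ s' in 𝓝 s, P.γ (τ s') = γ s' := by
    filter_upwards [hγC] with s' hs'
    exact Function.invFunOn_eq (hC.le hs')
  have o1 : (fun t => P.γ t - P.γ t₀ - (t - t₀) • g₀) =o[𝓝 t₀] fun t => t - t₀ :=
    hasDerivAt_iff_isLittleO.mp hg₀
  have O1 : (fun t => t - t₀) =O[𝓝 t₀] fun t => P.γ t - P.γ t₀ := by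
    have h1 := (HasDerivAtFilter.isBigO_sub_rev hg₀ hg₀0)
    have h2 : Tendsto (fun t : ℝ => (t, t₀)) (𝓝 t₀) (𝓝 t₀ ×ˢ pure t₀) :=
      tendsto_id.prodMk tendsto_const_pure
    exact h1.comp_tendsto h2
  have O2 : (fun s' => γ s' - γ s) =O[𝓝 s] fun s' => s' - s := hg.isBigO_sub
  have o2 : (fun s' => γ s' - γ s - (τ s' - t₀) • g₀) =o[𝓝 s] fun s' => τ s' - t₀ := by
    refine (o1.comp_tendsto hτt).congr' ?_ (Eventually.of_forall fun _ => rfl)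
    filter_upwards [hPτ] with s' hs'
    simp only [Function.comp, hs', he]
  have O3 : (fun s' => τ s' - t₀) =O[𝓝 s] fun s' => γ s' - γ s := by
    refine (O1.comp_tendsto hτt).congr' (Eventually.of_forall fun _ => rfl) ?_
    filter_upwards [hPτ] with s' hs'
    simp only [Function.comp, hs', he]
  have o3 := (o2.trans_isBigO O3).trans_isBigO O2
  have o4 : (fun s' => ⟪γ s' - γ s, n⟫) =o[𝓝 s] fun s' => s' - s := by
    refine Asymptotics.IsBigO.trans_isLittleO ?_ o3
    refine Asymptotics.IsBigO.of_bound ‖n‖ (Eventually.of_forall fun s' => ?_)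
    have : ⟪γ s' - γ s, n⟫ = ⟪γ s' - γ s - (τ s' - t₀) • g₀, n⟫ := by
      rw [inner_sub_left (γ s' - γ s), inner_smul_left, hn]; simp
    rw [this, mul_comm]
    exact norm_inner_le_norm _ _
  have d1 : HasDerivAt (fun s' => ⟪γ s', n⟫) 0 s := by
    rw [hasDerivAt_iff_isLittleO]
    refine o4.congr_left fun s' => ?_
    simp [inner_sub_left]
  have d2 : HasDerivAt (fun s' => ⟪γ s', n⟫) ⟪g, n⟫ s := by
    have := hg.inner ℝ (hasDerivAt_const s n)
    simpa using this
  exact d2.unique d1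

lemma tangent_ae (P Q : SimpleOmegaClosedCurve Ω C) (hΩ : IsOpen Ω) {B : E2 → E2}
    {g g₀ : ℝ → E2}
    (hBnorm : ∀ᵐ x ∂((μH[1] : Measure (EuclideanSpace ℝ (Fin 2))).restrict C), ‖B x‖ = 1)
    (htang : ∀ᵐ t ∂(volume.restrict P.dom),
      HasDerivAt P.γ (g₀ t) t ∧ g₀ t ≠ 0 ∧ ∃ c : ℝ, g₀ t = c • B (P.γ t))
    (hA : AgreesWith Q g B) :
    ∀ᵐ t ∂(volume.restrict Q.dom), DifferentiableAt ℝ Q.γ t ∧ deriv Q.γ t ≠ 0 ∧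
      deriv Q.γ t = ‖deriv Q.γ t‖ • B (Q.γ t) := by
  obtain ⟨hD, hD1, hD2, hi, hC⟩ := P.facts
  obtain ⟨hD', hD1', hD2', hi', hC'⟩ := Q.facts
  have h1 : ∀ᵐ x ∂((μH[1] : Measure E2).restrict C), ∃ t ∈ Ioo 0 P.len, P.γ t = x ∧
      HasDerivAt P.γ (g₀ t) t ∧ g₀ t ≠ 0 ∧ ∃ c : ℝ, g₀ t = c • B (P.γ t) := by
    have h0 := htang.and P.ae_interior
    rw [ae_restrict_iff' hD] at h0
    rw [ae_iff] at h0
    have hnull := P.lip.hausdorffMeasure_image_le (d := 1) zero_le_one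
      {a | ¬(a ∈ P.dom → (HasDerivAt P.γ (g₀ a) a ∧ g₀ a ≠ 0 ∧ ∃ c : ℝ, g₀ a = c • B (P.γ a)) ∧
        a ∈ Ioo 0 P.len)}
    rw [hausdorffMeasure_real, h0, mul_zero, nonpos_iff_eq_zero] at hnull
    have hCm : MeasurableSet C := by
      rw [hC]; exact hD.image_of_continuousOn_injOn P.lip.continuous.continuousOn hi
    rw [ae_restrict_iff' hCm]
    filter_upwards [compl_mem_ae_iff.mpr hnull] with x hx hxC
    rw [hC] at hxC
    obtain ⟨t, ht, rfl⟩ := hxC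
    by_cases hgood : (HasDerivAt P.γ (g₀ t) t ∧ g₀ t ≠ 0 ∧ ∃ c : ℝ, g₀ t = c • B (P.γ t)) ∧
        t ∈ Ioo 0 P.len
    · exact ⟨t, hgood.2, rfl, hgood.1⟩
    · exact absurd ⟨t, fun h => hgood (h ht), rfl⟩ hx
  have h2 := h1.and hBnorm
  rw [Q.area] at h2
  have h3 := ae_of_ae_map Q.lip.continuous.aemeasurable h2
  rw [speed, ae_withDensity_iff (by fun_prop)] at h3
  filter_upwards [h3, hA, Q.ae_interior] with s hs hAs hsI
  have hder : deriv Q.γ s = g s := hAs.1.deriv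
  have hg0 : g s ≠ 0 := by
    intro h0; have := hAs.2; rw [h0] at this; simp at this
  rw [hder] at hs ⊢
  obtain ⟨⟨t, ht, hts, hgt, hgt0, c, hc⟩, hB⟩ := hs (by simpa using hg0)
  refine ⟨hAs.1.differentiableAt, hg0, ?_⟩
  have hγC : ∀ᶠ s' in 𝓝 s, Q.γ s' ∈ C := by
    filter_upwards [isOpen_Ioo.mem_nhds hsI] with s' hs'
    exact Q.mem_C (hD1' hs')
  set b := B (Q.γ s) with hb
  have hbb : ⟪b, b⟫ = 1 := by rw [real_inner_self_eq_norm_sq, hB]; norm_num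
  set n := g s - ⟪g s, b⟫ • b with hn
  have hbn : ⟪b, n⟫ = 0 := by
    rw [hn, inner_sub_right, inner_smul_right, hbb, real_inner_comm]; ring
  have hg0n : ⟪g₀ t, n⟫ = 0 := by
    rw [hc, hts, inner_smul_left, hbn]; simp
  have hgn := P.parallel hΩ ht hAs.1 hγC hts hgt hgt0 hg0n
  have hnn : ⟪n, n⟫ = 0 := by
    conv_lhs => rw [hn]
    rw [inner_sub_left, inner_smul_left, hbn, hgn]; simp
  have hn0 : n = 0 := inner_self_eq_zero.mp hnn
  have hg' : g s = ⟪g s, b⟫ • b := sub_eq_zero.mp hn0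
  have hnorm : ‖g s‖ = ⟪g s, b⟫ := by
    conv_lhs => rw [hg']
    rw [norm_smul, hB, mul_one, Real.norm_of_nonneg hAs.2.le]
  rw [hnorm]; exact hg'

lemma change_var (Q : SimpleOmegaClosedCurve Ω C) {B : E2 → E2} (hB : Measurable B)
    (ht : ∀ᵐ t ∂(volume.restrict Q.dom), DifferentiableAt ℝ Q.γ t ∧ deriv Q.γ t ≠ 0 ∧
      deriv Q.γ t = ‖deriv Q.γ t‖ • B (Q.γ t)) {h : E2 → ℝ} (hh : Measurable h)
    {φ : E2 → ℝ} (hφ : ContDiff ℝ (⊤ : ℕ∞) φ) :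
    ∫ x in C, h x * ⟪B x, gradient φ x⟫ ∂μH[1] =
      ∫ t in Q.dom, h (Q.γ t) * deriv (fun s => φ (Q.γ s)) t := by
  have hgr : Continuous (gradient φ) := by
    unfold gradient
    exact (InnerProductSpace.toDual ℝ E2).symm.continuous.comp (hφ.continuous_fderiv (by simp))
  have hm : Measurable (fun x => h x * ⟪B x, gradient φ x⟫) :=
    hh.mul (hB.inner hgr.measurable)
  rw [Q.area, integral_map Q.lip.continuous.aemeasurable hm.aestronglyMeasurable, speed,
    integral_withDensity_eq_integral_smul (measurable_deriv Q.γ).nnnorm]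
  refine integral_congr_ae ?_
  filter_upwards [ht] with t ⟨h1, h2, h3⟩
  have hd : HasDerivAt (fun s => φ (Q.γ s)) (fderiv ℝ φ (Q.γ t) (deriv Q.γ t)) t :=
    ((hφ.differentiable (by simp)) (Q.γ t)).hasFDerivAt.comp_hasDerivAt t h1.hasDerivAt
  rw [hd.deriv, NNReal.smul_def, smul_eq_mul, coe_nnnorm]
  have : fderiv ℝ φ (Q.γ t) (deriv Q.γ t) = ⟪deriv Q.γ t, gradient φ (Q.γ t)⟫ := by
    rw [real_inner_comm, ← toDual_gradient]; rfl
  rw [this]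
  conv_rhs => rw [h3]
  rw [inner_smul_left]
  simp only [conj_trivial]
  ring

lemma speed_integrable (Q : SimpleOmegaClosedCurve Ω C) {u : E2 → ℝ}
    (hu : IntegrableOn u C μH[1]) (hum : Measurable u) :
    Integrable (fun t => u (Q.γ t)) Q.speed := by
  rw [IntegrableOn, Q.area] at hu
  exact (integrable_map_measure hum.aestronglyMeasurable Q.lip.continuous.aemeasurable).mp hu

/-- cutoff functions adapted to the curve -/
lemma cutoff (Q : SimpleOmegaClosedCurve Ω C) (hΩ : IsOpen Ω) {F O : Set ℝ} (hF : IsCompact F)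
    (hO : IsOpen O) (hFO : F ⊆ O) (hOI : F ⊆ Ioo 0 Q.len) :
    ∃ θ : E2 → ℝ, ContDiff ℝ (⊤ : ℕ∞) θ ∧ HasCompactSupport θ ∧ tsupport θ ⊆ Ω ∧
      (∀ x, θ x ∈ Icc (0 : ℝ) 1) ∧ (∀ t ∈ F, θ (Q.γ t) = 1) ∧
      (∀ t ∈ Q.dom, t ∉ O → θ (Q.γ t) = 0) := by
  obtain ⟨_, hD1, hD2, _, hC⟩ := Q.facts
  have hK1 : IsCompact (Q.γ '' F) := hF.image Q.lip.continuous
  have hK2 : IsCompact (Q.γ '' (Icc 0 Q.len \ O)) :=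
    (isCompact_Icc.diff hO).image Q.lip.continuous
  have hU : IsOpen (Ω ∩ (Q.γ '' (Icc 0 Q.len \ O))ᶜ) := hΩ.inter hK2.isClosed.isOpen_compl
  have hsub : Q.γ '' F ⊆ Ω ∩ (Q.γ '' (Icc 0 Q.len \ O))ᶜ := by
    rintro _ ⟨t, ht, rfl⟩
    refine ⟨Q.sub (Q.mem_C (hD1 (hOI ht))), ?_⟩
    rintro ⟨s, hs, e⟩
    have := Q.inj_strong hΩ (hOI ht) hs.1 e
    subst this
    exact hs.2 (hFO ht)
  obtain ⟨T, hT, hT1, hT2⟩ := exists_compact_between hK1 hU hsub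
  obtain ⟨f, hf1, hf0, hf⟩ := exists_contMDiffMap_one_nhds_of_subset_interior
    (n := (⊤ : ℕ∞)) (modelWithCornersSelf ℝ E2) hK1.isClosed hT1
  have hts : tsupport f ⊆ T := by
    apply closure_minimal _ hT.isClosed
    intro x hx
    by_contra hxT
    exact hx (hf0 x hxT)
  refine ⟨f, f.contMDiff.contDiff, HasCompactSupport.of_support_subset_isCompact hT
    (subset_closure.trans hts), fun x hx => (hT2 (hts hx)).1, hf, ?_, ?_⟩
  · intro t ht
    exact hf1.self_of_nhdsSet _ ⟨t, ht, rfl⟩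
  · intro t ht hO'
    apply hf0
    intro hx
    exact (hT2 hx).2 ⟨t, ⟨Ico_subset_Icc_self (hD2 ht), hO'⟩, rfl⟩

end SimpleOmegaClosedCurve

/-! ## Lebesgue points and the two-point argument -/

/-- one-sided Lebesgue points -/
def LebPt (F : ℝ → ℝ) (a : ℝ) : Prop :=
  Tendsto (fun r : ℝ => r⁻¹ * ∫ t in Ioc a (a + r), |F t - F a|) (𝓝[>] 0) (𝓝 0)

lemma lebPt_ae {F : ℝ → ℝ} (hF : LocallyIntegrable F) : ∀ᵐ a, LebPt F a := by
  filter_upwards [(Besicovitch.vitaliFamily (volume : Measure ℝ)).ae_tendsto_average_norm_sub hF]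
    with a ha
  have h1 := ha.comp (Besicovitch.tendsto_filterAt (volume : Measure ℝ) a)
  have h2 : Tendsto (fun r : ℝ => 2 * ⨍ y in Metric.closedBall a r, ‖F y - F a‖) (𝓝[>] 0) (𝓝 0) := by
    simpa using h1.const_mul 2
  refine squeeze_zero' ?_ ?_ h2
  · filter_upwards [self_mem_nhdsWithin] with r hr
    have hr : (0 : ℝ) < r := hr
    have : 0 ≤ ∫ t in Ioc a (a + r), |F t - F a| := integral_nonneg fun _ => abs_nonneg _
    positivity
  · filter_upwards [self_mem_nhdsWithin] with r hr
    have hr : (0 : ℝ) < r := hr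
    rw [setAverage_eq]
    have e : volume.real (Metric.closedBall a r) = 2 * r := by
      rw [measureReal_def, Real.volume_closedBall, ENNReal.toReal_ofReal (by positivity)]
    rw [e, smul_eq_mul, mul_inv, ← mul_assoc, ← mul_assoc, mul_inv_cancel₀ (by norm_num), one_mul]
    refine mul_le_mul_of_nonneg_left ?_ (by positivity)
    have hi : IntegrableOn (fun y => ‖F y - F a‖) (Metric.closedBall a r) := by
      refine Integrable.norm (Integrable.sub ?_ ?_)
      · exact hF.integrableOn_isCompact (isCompact_closedBall a r)
      · exact integrableOn_const (isCompact_closedBall a r).measure_lt_top.ne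
    refine setIntegral_mono_set hi (Eventually.of_forall fun _ => abs_nonneg _) ?_
    refine HasSubset.Subset.eventuallyLE ?_
    intro t ht
    rw [Metric.mem_closedBall, Real.dist_eq, abs_le]
    constructor <;> linarith [ht.1, ht.2]

lemma edge {W G : ℝ → ℝ} {a : ℝ} (hG0 : ∀ t, 0 ≤ G t)
    (hWG : LocallyIntegrable (fun t => W t * G t)) (hGi : LocallyIntegrable G)
    (h1 : LebPt (fun t => W t * G t) a) (h2 : LebPt G a) {ψ : ℝ → ℝ → ℝ} {p q c ε : ℝ}
    (hc : 0 ≤ c) (hε : 0 < ε)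
    (hlip : ∀ r, 0 < r → r < ε → ∃ K, LipschitzWith K (ψ r))
    (hintg : ∀ r, 0 < r → r < ε → IntegrableOn (fun t => W t * deriv (ψ r) t) (Ioc a (a + r)))
    (hder : ∀ r, 0 < r → r < ε → ∀ᵐ t, t ∈ Ioc a (a + r) → |deriv (ψ r) t| ≤ c / r * G t)
    (hp : ∀ r, 0 < r → r < ε → ψ r a = p) (hq : ∀ r, 0 < r → r < ε → ψ r (a + r) = q) :
    Tendsto (fun r : ℝ => ∫ t in Ioc a (a + r), W t * deriv (ψ r) t) (𝓝[>] 0)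
      (𝓝 (W a * (q - p))) := by
  have hlim : Tendsto (fun r : ℝ => c * (r⁻¹ * ∫ t in Ioc a (a + r), |W t * G t - W a * G a|)
      + c * |W a| * (r⁻¹ * ∫ t in Ioc a (a + r), |G t - G a|)) (𝓝[>] 0) (𝓝 0) := by
    simpa using (h1.const_mul c).add (h2.const_mul (c * |W a|))
  rw [tendsto_iff_norm_sub_tendsto_zero]
  refine squeeze_zero' (Eventually.of_forall fun _ => norm_nonneg _) ?_ hlim
  filter_upwards [Ioo_mem_nhdsGT hε] with r ⟨hr, hrε⟩
  obtain ⟨K, hK⟩ := hlip r hr hrε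
  obtain ⟨f1, f2⟩ := lip_ftc hK a (a + r)
  have hle : a ≤ a + r := by linarith
  rw [intervalIntegral.integral_of_le hle, hp r hr hrε, hq r hr hrε] at f2
  rw [intervalIntegrable_iff_integrableOn_Ioc_of_le hle] at f1
  rw [← f2, ← integral_const_mul, ← integral_sub (hintg r hr hrε) (f1.const_mul _)]
  have hio : ∀ {H : ℝ → ℝ}, LocallyIntegrable H → ∀ m : ℝ,
      IntegrableOn (fun t => |H t - m|) (Ioc a (a + r)) := by
    intro H hH m
    refine Integrable.abs (Integrable.sub ?_ ?_)
    · exact (hH.integrableOn_isCompact isCompact_Icc).mono_set Ioc_subset_Icc_self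
    · exact integrableOn_const (by simp)
  rw [← mul_assoc, ← mul_assoc, ← integral_const_mul, ← integral_const_mul,
    ← integral_add ((hio hWG _).const_mul _) ((hio hGi _).const_mul _)]
  refine norm_integral_le_of_norm_le
    (((hio hWG _).const_mul _).add ((hio hGi _).const_mul _)) ?_
  rw [ae_restrict_iff' measurableSet_Ioc]
  filter_upwards [hder r hr hrε] with t ht htm
  have hb := ht htm
  rw [← sub_mul, norm_mul, Real.norm_eq_abs, Real.norm_eq_abs]
  have hcr : 0 ≤ c / r := by positivity
  calc |W t - W a| * |deriv (ψ r) t| ≤ |W t - W a| * (c / r * G t) := by gcongr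
    _ = c / r * |(W t * G t - W a * G a) + W a * (G a - G t)| := by
        have : (W t * G t - W a * G a) + W a * (G a - G t) = (W t - W a) * G t := by ring
        rw [this, abs_mul, abs_of_nonneg (hG0 t)]; ring
    _ ≤ c / r * (|W t * G t - W a * G a| + |W a| * |G t - G a|) := by
        gcongr
        refine (abs_add_le _ _).trans ?_
        rw [abs_mul, abs_sub_comm (G a)]
    _ = _ := by rw [div_eq_mul_inv]; ring

lemma smoothTransition_deriv_bound : ∃ m : ℝ, 0 ≤ m ∧ ∀ x, |deriv Real.smoothTransition x| ≤ m := by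
  have hc : Continuous (deriv Real.smoothTransition) :=
    (Real.smoothTransition.contDiff (n := 1)).continuous_deriv le_rfl
  obtain ⟨m, hm⟩ := (isCompact_Icc (a := (0 : ℝ)) (b := 1)).exists_bound_of_continuousOn
    hc.continuousOn
  refine ⟨m, (norm_nonneg _).trans (hm 0 (by simp)), fun x => ?_⟩
  by_cases hx : x ∈ Icc (0 : ℝ) 1
  · exact hm x hx
  · have h0 : 0 ≤ m := (norm_nonneg _).trans (hm 0 (by simp))
    suffices deriv Real.smoothTransition x = 0 by rw [this]; simpa using h0
    rw [mem_Icc, not_and_or, not_le, not_le] at hx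
    rcases hx with hx | hx
    · have : Real.smoothTransition =ᶠ[𝓝 x] fun _ => 0 := by
        filter_upwards [isOpen_Iio.mem_nhds hx] with y hy
        exact Real.smoothTransition.zero_of_nonpos (le_of_lt hy)
      rw [this.deriv_eq]; simp
    · have : Real.smoothTransition =ᶠ[𝓝 x] fun _ => 1 := by
        filter_upwards [isOpen_Ioi.mem_nhds hx] with y hy
        exact Real.smoothTransition.one_of_one_le (le_of_lt hy)
      rw [this.deriv_eq]; simp

/-- transverse smooth steps at a regular point of the curve -/
lemma step {γ : ℝ → E2} {a : ℝ} (hd : DifferentiableAt ℝ γ a) (hd0 : deriv γ a ≠ 0) :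
    ∃ (S : ℝ → E2 → ℝ) (c δ : ℝ), 0 ≤ c ∧ 0 < δ ∧ (∀ r, ContDiff ℝ (⊤ : ℕ∞) (S r)) ∧
      (∀ r x, S r x ∈ Icc (0 : ℝ) 1) ∧
      (∀ r, 0 < r → ∀ t, |t - a| ≤ δ → t ≤ a → S r (γ t) = 0) ∧
      (∀ r, 0 < r → ∀ t, |t - a| ≤ δ → a + r ≤ t → S r (γ t) = 1) ∧
      (∀ r, 0 < r → ∀ t, DifferentiableAt ℝ γ t →
        |deriv (fun s => S r (γ s)) t| ≤ c / r * ‖deriv γ t‖) := by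
  set e := deriv γ a with he
  have hne : 0 < ‖e‖ := norm_pos_iff.mpr hd0
  obtain ⟨m, hm0, hm⟩ := smoothTransition_deriv_bound
  set h : ℝ → ℝ := fun t => ⟪γ t - γ a, e⟫ / ‖e‖ ^ 2 with hh
  have hderiv : ∀ t, DifferentiableAt ℝ γ t → HasDerivAt h (⟪deriv γ t, e⟫ / ‖e‖ ^ 2) t := by
    intro t ht
    have h1 := ((ht.hasDerivAt.sub_const (γ a)).inner ℝ (hasDerivAt_const t e)).div_const (‖e‖ ^ 2)
    simpa using h1
  have hha : HasDerivAt h 1 a := by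
    have := hderiv a hd
    rwa [real_inner_self_eq_norm_sq, div_self (by positivity)] at this
  have hest : ∀ᶠ t in 𝓝 a, |h t - (t - a)| ≤ 1 / 2 * |t - a| := by
    have := (hasDerivAt_iff_isLittleO.mp hha).bound (c := 1 / 2) (by norm_num)
    filter_upwards [this] with t ht
    have h0 : h a = 0 := by simp [hh]
    simpa [h0] using ht
  obtain ⟨δ, hδ, hball⟩ := Metric.eventually_nhds_iff.mp hest
  refine ⟨fun r x => Real.smoothTransition (2 / r * (⟪x - γ a, e⟫ / ‖e‖ ^ 2)), 2 * m / ‖e‖, δ / 2,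
    by positivity, by positivity, ?_, ?_, ?_, ?_, ?_⟩
  · intro r
    refine Real.smoothTransition.contDiff.comp (contDiff_const.mul (ContDiff.div_const ?_ _))
    exact (contDiff_id.sub contDiff_const).inner ℝ contDiff_const
  · intro r x
    exact ⟨Real.smoothTransition.nonneg _, Real.smoothTransition.le_one _⟩
  · intro r hr t ht hta
    apply Real.smoothTransition.zero_of_nonpos
    have h1 := hball (y := t) (by rw [Real.dist_eq]; linarith)
    rw [abs_of_nonpos (a := t - a) (by linarith)] at h1
    have h2 := (abs_le.mp h1).2
    have h3 : h t ≤ 0 := by linarith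
    exact mul_nonpos_of_nonneg_of_nonpos (by positivity) h3
  · intro r hr t ht hta
    apply Real.smoothTransition.one_of_one_le
    have h1 := hball (y := t) (by rw [Real.dist_eq]; linarith)
    rw [abs_of_nonneg (a := t - a) (by linarith)] at h1
    have h2 := (abs_le.mp h1).1
    have h3 : r / 2 ≤ h t := by linarith
    calc (1 : ℝ) = 2 / r * (r / 2) := by field_simp
      _ ≤ 2 / r * h t := by gcongr
  · intro r hr t ht
    have h1 : HasDerivAt (fun s => Real.smoothTransition (2 / r * h s))
        (deriv Real.smoothTransition (2 / r * h t) * (2 / r * (⟪deriv γ t, e⟫ / ‖e‖ ^ 2))) t := by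
      have h0 := ((Real.smoothTransition.contDiff (n := 1)).differentiable (by simp)
        (2 / r * h t)).hasDerivAt
      exact HasDerivAt.comp t h0 ((hderiv t ht).const_mul (2 / r))
    have h2 : deriv (fun s => Real.smoothTransition (2 / r * (⟪γ s - γ a, e⟫ / ‖e‖ ^ 2))) t = _ :=
      h1.deriv
    rw [h2, abs_mul, abs_mul, abs_of_pos (a := 2 / r) (by positivity), abs_div,
      abs_of_pos (a := ‖e‖ ^ 2) (by positivity)]
    have h3 := abs_real_inner_le_norm (deriv γ t) e
    calc _ ≤ m * (2 / r * (‖deriv γ t‖ * ‖e‖ / ‖e‖ ^ 2)) := by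
          gcongr
          exact hm _
      _ = _ := by field_simp

namespace SimpleOmegaClosedCurve

variable {Ω C : Set (EuclideanSpace ℝ (Fin 2))}

lemma test_lip (Q : SimpleOmegaClosedCurve Ω C) {φ : E2 → ℝ} (hφ : ContDiff ℝ (⊤ : ℕ∞) φ)
    (hc : HasCompactSupport φ) : ∃ K, LipschitzWith K (fun t => φ (Q.γ t)) := by
  obtain ⟨K, hK⟩ := hφ.lipschitzWith_of_hasCompactSupport hc (by simp)
  exact ⟨K * Q.K, hK.comp Q.lip⟩

lemma test_integrable (Q : SimpleOmegaClosedCurve Ω C) {φ : E2 → ℝ}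
    (hφ : ContDiff ℝ (⊤ : ℕ∞) φ) (hc : HasCompactSupport φ) {W : ℝ → ℝ} (hW : Measurable W)
    (hWi : Integrable (fun t => W t * ‖deriv Q.γ t‖)) :
    Integrable (fun t => W t * deriv (fun s => φ (Q.γ s)) t) := by
  obtain ⟨K, hK⟩ := hφ.lipschitzWith_of_hasCompactSupport hc (by simp)
  refine (hWi.norm.const_mul K).mono' (hW.mul (measurable_deriv _)).aestronglyMeasurable ?_
  filter_upwards [Q.lip.ae_differentiableAt_real] with t ht
  have hd : HasDerivAt (fun s => φ (Q.γ s)) (fderiv ℝ φ (Q.γ t) (deriv Q.γ t)) t :=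
    ((hφ.differentiable (by simp)) (Q.γ t)).hasFDerivAt.comp_hasDerivAt t ht.hasDerivAt
  rw [hd.deriv, norm_mul, norm_mul, norm_norm]
  have h1 := (fderiv ℝ φ (Q.γ t)).le_opNorm (deriv Q.γ t)
  have h2 := norm_fderiv_le_of_lipschitz ℝ hK (x₀ := Q.γ t)
  calc _ ≤ ‖W t‖ * (K * ‖deriv Q.γ t‖) := by
        gcongr
        exact h1.trans (by gcongr)
    _ = _ := by ring

lemma deriv_zero_of_Ioo {f : ℝ → ℝ} {p q k t : ℝ} (h : ∀ s ∈ Ioo p q, f s = k)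
    (ht : t ∈ Ioo p q) : deriv f t = 0 := by
  have : f =ᶠ[𝓝 t] fun _ => k := by
    filter_upwards [isOpen_Ioo.mem_nhds ht] with s hs using h s hs
  rw [this.deriv_eq]; simp

lemma two_point (Q : SimpleOmegaClosedCurve Ω C) (hΩ : IsOpen Ω) {νp νn : Measure ℝ}
    [IsFiniteMeasure νp] [IsFiniteMeasure νn] (hνp : νp Q.domᶜ = 0) (hνn : νn Q.domᶜ = 0)
    {W : ℝ → ℝ} (hW : Measurable W) (hWi : Integrable (fun t => W t * ‖deriv Q.γ t‖))
    (hGi : LocallyIntegrable (fun t => ‖deriv Q.γ t‖))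
    (hstar : ∀ φ : E2 → ℝ, ContDiff ℝ (⊤ : ℕ∞) φ → HasCompactSupport φ → tsupport φ ⊆ Ω →
      (∫ t in Ioc 0 Q.len, W t * deriv (fun s => φ (Q.γ s)) t) +
        ((∫ t, φ (Q.γ t) ∂νp) - ∫ t, φ (Q.γ t) ∂νn) = 0)
    {a b : ℝ} (ha : a ∈ Ioo 0 Q.len) (hb : b ∈ Ioo 0 Q.len) (hab : a < b)
    (hda : DifferentiableAt ℝ Q.γ a) (hda0 : deriv Q.γ a ≠ 0)
    (hdb : DifferentiableAt ℝ Q.γ b) (hdb0 : deriv Q.γ b ≠ 0)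
    (la1 : LebPt (fun t => W t * ‖deriv Q.γ t‖) a) (la2 : LebPt (fun t => ‖deriv Q.γ t‖) a)
    (lb1 : LebPt (fun t => W t * ‖deriv Q.γ t‖) b) (lb2 : LebPt (fun t => ‖deriv Q.γ t‖) b) :
    W b - W a = νp.real (Ioc a b) - νn.real (Ioc a b) := by
  obtain ⟨hD, hD1, hD2, _, hC⟩ := Q.facts
  obtain ⟨ha0, haL⟩ := ha
  obtain ⟨hb0, hbL⟩ := hb
  obtain ⟨Sa, ca, δa, hca, hδa, Sa1, Sa2, Sa3, Sa4, Sa5⟩ := step hda hda0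
  obtain ⟨Sb, cb, δb, hcb, hδb, Sb1, Sb2, Sb3, Sb4, Sb5⟩ := step hdb hdb0
  obtain ⟨δ, hδ, d1, d2, d3, d4, d5⟩ : ∃ δ : ℝ, 0 < δ ∧ 3 * δ ≤ δa ∧ 3 * δ ≤ δb ∧ 4 * δ ≤ a ∧
      4 * δ ≤ Q.len - b ∧ 5 * δ ≤ b - a := by
    refine ⟨min (min (δa / 3) (δb / 3)) (min (min (a / 4) ((Q.len - b) / 4)) ((b - a) / 5)),
      ?_, ?_, ?_, ?_, ?_, ?_⟩
    · simp only [lt_min_iff]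
      refine ⟨⟨?_, ?_⟩, ⟨⟨?_, ?_⟩, ?_⟩⟩ <;> linarith
    · have : min (min (δa / 3) (δb / 3)) (min (min (a / 4) ((Q.len - b) / 4)) ((b - a) / 5)) ≤ δa / 3 := by simp
      linarith
    · have : min (min (δa / 3) (δb / 3)) (min (min (a / 4) ((Q.len - b) / 4)) ((b - a) / 5)) ≤ δb / 3 := by simp
      linarith
    · have : min (min (δa / 3) (δb / 3)) (min (min (a / 4) ((Q.len - b) / 4)) ((b - a) / 5)) ≤ a / 4 := by simp
      linarith
    · have : min (min (δa / 3) (δb / 3)) (min (min (a / 4) ((Q.len - b) / 4)) ((b - a) / 5)) ≤ (Q.len - b) / 4 := by simp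
      linarith
    · have : min (min (δa / 3) (δb / 3)) (min (min (a / 4) ((Q.len - b) / 4)) ((b - a) / 5)) ≤ (b - a) / 5 := by simp
      linarith
  have mkcut : ∀ p q : ℝ, 0 < p - δ → q + δ < Q.len → ∃ θ : E2 → ℝ, ContDiff ℝ (⊤ : ℕ∞) θ ∧
      HasCompactSupport θ ∧ tsupport θ ⊆ Ω ∧ (∀ x, θ x ∈ Icc (0 : ℝ) 1) ∧
      (∀ t, p ≤ t → t ≤ q → θ (Q.γ t) = 1) ∧
      (∀ t ∈ Q.dom, t ≤ p - δ → θ (Q.γ t) = 0) ∧ (∀ t ∈ Q.dom, q + δ ≤ t → θ (Q.γ t) = 0) := by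
    intro p q hp hq
    obtain ⟨θ, t1, t2, t3, t4, t5, t6⟩ := Q.cutoff hΩ (F := Icc p q) (O := Ioo (p - δ) (q + δ))
      isCompact_Icc isOpen_Ioo (fun t ht => ⟨by linarith [ht.1], by linarith [ht.2]⟩)
      (fun t ht => ⟨by linarith [ht.1], by linarith [ht.2]⟩)
    refine ⟨θ, t1, t2, t3, t4, fun t h1 h2 => t5 t ⟨h1, h2⟩, fun t ht h => t6 t ht ?_,
      fun t ht h => t6 t ht ?_⟩
    · intro h'; linarith [h'.1]
    · intro h'; linarith [h'.2]
  obtain ⟨Θ, T1, T2, T3, T4, T5, T6, T7⟩ := mkcut (a - δ) (b + δ) (by linarith) (by linarith)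
  obtain ⟨A, A1, A2, A3, A4, A5, A6, A7⟩ := mkcut (a - 2 * δ) (a + δ) (by linarith) (by linarith)
  obtain ⟨H, H1, H2, H3, H4, H5, H6, H7⟩ := mkcut (b - δ) (b + 2 * δ) (by linarith) (by linarith)
  set Φ : ℝ → E2 → ℝ := fun r x => Θ x * ((1 - A x * (1 - Sa r x)) * (1 - H x * Sb r x)) with hΦ
  set ψ : ℝ → ℝ → ℝ := fun r t => Φ r (Q.γ t) with hψ
  have Φ1 : ∀ r, ContDiff ℝ (⊤ : ℕ∞) (Φ r) := fun r =>
    T1.mul ((contDiff_const.sub (A1.mul (contDiff_const.sub (Sa1 r)))).mul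
      (contDiff_const.sub (H1.mul (Sb1 r))))
  have Φ2 : ∀ r, HasCompactSupport (Φ r) := fun r => T2.mul_right
  have Φ3 : ∀ r, tsupport (Φ r) ⊆ Ω := fun r => (tsupport_mul_subset_left).trans T3
  have Φ4 : ∀ r x, |Φ r x| ≤ 1 := by
    intro r x
    have hA := A4 x; have hS := Sa2 r x; have hT := T4 x; have hH := H4 x; have hSb := Sb2 r x
    have e1 : 0 ≤ 1 - A x * (1 - Sa r x) := by nlinarith [hA.1, hA.2, hS.1, hS.2]
    have e2 : 1 - A x * (1 - Sa r x) ≤ 1 := by nlinarith [hA.1, hA.2, hS.1, hS.2]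
    have e3 : 0 ≤ 1 - H x * Sb r x := by nlinarith [hH.1, hH.2, hSb.1, hSb.2]
    have e4 : 1 - H x * Sb r x ≤ 1 := by nlinarith [hH.1, hH.2, hSb.1, hSb.2]
    have e5 : (1 - A x * (1 - Sa r x)) * (1 - H x * Sb r x) ≤ 1 := mul_le_one₀ e2 e3 e4
    rw [abs_of_nonneg (mul_nonneg hT.1 (mul_nonneg e1 e3))]
    exact mul_le_one₀ hT.2 (mul_nonneg e1 e3) e5
  -- evaluation of the factors
  have f1 : ∀ r, 0 < r → ∀ t ∈ Q.dom, a + r ≤ t → 1 - A (Q.γ t) * (1 - Sa r (Q.γ t)) = 1 := by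
    intro r hr t ht h
    rcases le_total t (a + 2 * δ) with h' | h'
    · rw [Sa4 r hr t (by rw [abs_le]; constructor <;> linarith) h]; ring
    · rw [A7 t ht (by linarith)]; ring
  have f2 : ∀ r, 0 < r → ∀ t ∈ Q.dom, t ≤ b → 1 - H (Q.γ t) * Sb r (Q.γ t) = 1 := by
    intro r hr t ht h
    rcases le_total t (b - 2 * δ) with h' | h'
    · rw [H6 t ht (by linarith)]; ring
    · rw [Sb3 r hr t (by rw [abs_le]; constructor <;> linarith) h]; ring
  have v1 : ∀ r, 0 < r → ∀ t ∈ Q.dom, t ≤ a → ψ r t = 0 := by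
    intro r hr t ht h
    simp only [hψ, hΦ]
    rcases le_total t (a - 2 * δ) with h' | h'
    · rw [T6 t ht (by linarith)]; ring
    · rw [A5 t h' (by linarith), Sa3 r hr t (by rw [abs_le]; constructor <;> linarith) h]; ring
  have v2 : ∀ r, 0 < r → ∀ t ∈ Q.dom, a ≤ t → t ≤ a + δ → ψ r t = Sa r (Q.γ t) := by
    intro r hr t ht h h'
    simp only [hψ, hΦ]
    rw [f2 r hr t ht (by linarith), T5 t (by linarith) (by linarith),
      A5 t (by linarith) h']; ring
  have v3 : ∀ r, 0 < r → ∀ t ∈ Q.dom, a + r ≤ t → t ≤ b → ψ r t = 1 := by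
    intro r hr t ht h h'
    simp only [hψ, hΦ]
    rw [f2 r hr t ht h', f1 r hr t ht h, T5 t (by linarith) (by linarith)]; ring
  have v4 : ∀ r, 0 < r → r < δ → ∀ t ∈ Q.dom, b ≤ t → t ≤ b + δ →
      ψ r t = 1 - Sb r (Q.γ t) := by
    intro r hr hrδ t ht h h'
    simp only [hψ, hΦ]
    rw [f1 r hr t ht (by linarith), T5 t (by linarith) (by linarith),
      H5 t (by linarith) (by linarith)]; ring
  have v5 : ∀ r, 0 < r → ∀ t ∈ Q.dom, b + r ≤ t → ψ r t = 0 := by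
    intro r hr t ht h
    simp only [hψ, hΦ]
    rcases le_total t (b + 2 * δ) with h' | h'
    · rw [H5 t (by linarith) h', Sb4 r hr t (by rw [abs_le]; constructor <;> linarith) h]; ring
    · rw [T7 t ht (by linarith)]; ring
  have hdm : ∀ t, 0 < t → t < Q.len → t ∈ Q.dom := fun t h h' => hD1 ⟨h, h'⟩
  have hintg : ∀ r, Integrable (fun t => W t * deriv (ψ r) t) := fun r =>
    Q.test_integrable (Φ1 r) (Φ2 r) hW hWi
  -- limits at the two edges
  have La : Tendsto (fun r : ℝ => ∫ t in Ioc a (a + r), W t * deriv (ψ r) t) (𝓝[>] 0)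
      (𝓝 (W a * (1 - 0))) := by
    refine edge (fun t => norm_nonneg _) hWi.locallyIntegrable hGi la1 la2 hca hδ
      (fun r _ _ => Q.test_lip (Φ1 r) (Φ2 r)) (fun r _ _ => (hintg r).integrableOn) ?_ ?_ ?_
    · intro r hr hrδ
      have hne : ∀ᵐ t : ℝ, t ≠ a + r := by simp [ae_iff]
      filter_upwards [Q.lip.ae_differentiableAt_real, hne] with t ht htn htm
      have : ψ r =ᶠ[𝓝 t] fun s => Sa r (Q.γ s) := by
        filter_upwards [isOpen_Ioo.mem_nhds (show t ∈ Ioo a (a + r) from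
          ⟨htm.1, lt_of_le_of_ne htm.2 htn⟩)] with s hs
        exact v2 r hr s (hdm s (by linarith [hs.1]) (by linarith [hs.2])) hs.1.le
          (by linarith [hs.2])
      rw [this.deriv_eq]
      exact Sa5 r hr t ht
    · intro r hr hrδ
      exact v1 r hr a (hdm a ha0 haL) le_rfl
    · intro r hr hrδ
      exact v3 r hr _ (hdm _ (by linarith) (by linarith)) le_rfl (by linarith)
  have Lb : Tendsto (fun r : ℝ => ∫ t in Ioc b (b + r), W t * deriv (ψ r) t) (𝓝[>] 0)
      (𝓝 (W b * (0 - 1))) := by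
    refine edge (fun t => norm_nonneg _) hWi.locallyIntegrable hGi lb1 lb2 hcb hδ
      (fun r _ _ => Q.test_lip (Φ1 r) (Φ2 r)) (fun r _ _ => (hintg r).integrableOn) ?_ ?_ ?_
    · intro r hr hrδ
      have hne : ∀ᵐ t : ℝ, t ≠ b + r := by simp [ae_iff]
      filter_upwards [Q.lip.ae_differentiableAt_real, hne] with t ht htn htm
      have : ψ r =ᶠ[𝓝 t] fun s => 1 - Sb r (Q.γ s) := by
        filter_upwards [isOpen_Ioo.mem_nhds (show t ∈ Ioo b (b + r) from
          ⟨htm.1, lt_of_le_of_ne htm.2 htn⟩)] with s hs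
        exact v4 r hr hrδ s (hdm s (by linarith [hs.1]) (by linarith [hs.2])) hs.1.le
          (by linarith [hs.2])
      rw [this.deriv_eq, deriv_const_sub, abs_neg]
      exact Sb5 r hr t ht
    · intro r hr hrδ
      exact v3 r hr b (hdm b hb0 hbL) (by linarith) le_rfl
    · intro r hr hrδ
      exact v5 r hr _ (hdm _ (by linarith) (by linarith)) le_rfl
  have hsplit : ∀ r, 0 < r → r < δ → ∫ t in Ioc 0 Q.len, W t * deriv (ψ r) t =
      (∫ t in Ioc a (a + r), W t * deriv (ψ r) t) + ∫ t in Ioc b (b + r), W t * deriv (ψ r) t := by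
    intro r hr hrδ
    rw [← setIntegral_union _ measurableSet_Ioc (hintg r).integrableOn (hintg r).integrableOn]
    · refine setIntegral_eq_of_subset_of_ae_sdiff_eq_zero measurableSet_Ioc.nullMeasurableSet ?_ ?_
      · rintro t (ht | ht) <;> constructor <;> linarith [ht.1, ht.2]
      · have n1 : ∀ᵐ t : ℝ, t ≠ a := by simp [ae_iff]
        have n2 : ∀ᵐ t : ℝ, t ≠ b := by simp [ae_iff]
        have n3 : ∀ᵐ t : ℝ, t ≠ Q.len := by simp [ae_iff]
        filter_upwards [n1, n2, n3] with t h1 h2 h3 ⟨ht, htn⟩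
        have h4 := lt_of_le_of_ne ht.2 h3
        rw [mem_union, not_or, mem_Ioc, mem_Ioc, not_and_or, not_and_or] at htn
        suffices deriv (ψ r) t = 0 by rw [this, mul_zero]
        rcases lt_or_gt_of_ne h1 with h | h
        · exact deriv_zero_of_Ioo (p := 0) (q := a) (k := 0) (fun s hs => v1 r hr s
            (hdm s hs.1 (by linarith [hs.2])) hs.2.le) ⟨ht.1, h⟩
        rcases lt_or_gt_of_ne h2 with h' | h'
        · exact deriv_zero_of_Ioo (p := a + r) (q := b) (k := 1) (fun s hs => v3 r hr s
            (hdm s (by linarith [hs.1]) (by linarith [hs.2])) hs.1.le hs.2.le)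
            ⟨not_le.mp (htn.1.resolve_left (not_not.mpr h)), h'⟩
        · exact deriv_zero_of_Ioo (p := b + r) (q := Q.len) (k := 0) (fun s hs => v5 r hr s
            (hdm s (by linarith [hs.1]) hs.2) hs.1.le)
            ⟨not_le.mp (htn.2.resolve_left (not_not.mpr h')), h4⟩
    · rw [Set.disjoint_left]
      intro t h1 h2
      linarith [h1.2, h2.1]
  have dct : ∀ ν : Measure ℝ, IsFiniteMeasure ν → ν Q.domᶜ = 0 →
      Tendsto (fun r => ∫ t, ψ r t ∂ν) (𝓝[>] 0) (𝓝 (ν.real (Ioc a b))) := by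
    intro ν hν hνd
    rw [← integral_indicator_one measurableSet_Ioc]
    refine tendsto_integral_filter_of_dominated_convergence (fun _ => (1 : ℝ)) ?_ ?_ ?_ ?_
    · exact Eventually.of_forall fun r =>
        ((Φ1 r).continuous.comp Q.lip.continuous).aestronglyMeasurable
    · exact Eventually.of_forall fun r => Eventually.of_forall fun t => Φ4 r _
    · exact integrable_const _
    · have hdom : ∀ᵐ t ∂ν, t ∈ Q.dom := hνd
      filter_upwards [hdom] with t ht
      refine tendsto_const_nhds.congr' ?_
      rcases le_or_gt t a with h | h
      · filter_upwards [self_mem_nhdsWithin] with r hr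
        rw [v1 r hr t ht h, indicator_of_notMem]
        exact fun h' => absurd h'.1 (not_lt.mpr h)
      rcases le_or_gt t b with h' | h'
      · filter_upwards [Ioo_mem_nhdsGT (sub_pos.mpr h)] with r hr
        rw [v3 r hr.1 t ht (by linarith [hr.2]) h', indicator_of_mem (show t ∈ Ioc a b from ⟨h, h'⟩)]; rfl
      · filter_upwards [Ioo_mem_nhdsGT (sub_pos.mpr h')] with r hr
        rw [v5 r hr.1 t ht (by linarith [hr.2]), indicator_of_notMem]
        exact fun h'' => absurd h''.2 (not_le.mpr h')
  have hlim := (La.add Lb).add ((dct νp inferInstance hνp).sub (dct νn inferInstance hνn))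
  have hzero : Tendsto (fun r : ℝ => ((∫ t in Ioc a (a + r), W t * deriv (ψ r) t) +
      ∫ t in Ioc b (b + r), W t * deriv (ψ r) t) + ((∫ t, ψ r t ∂νp) - ∫ t, ψ r t ∂νn))
      (𝓝[>] 0) (𝓝 0) := by
    refine tendsto_const_nhds.congr' ?_
    filter_upwards [Ioo_mem_nhdsGT hδ] with r hr
    rw [← hsplit r hr.1 hr.2]
    exact (hstar (Φ r) (Φ1 r) (Φ2 r) (Φ3 r)).symm
  have := tendsto_nhds_unique hlim hzero
  linarith

end SimpleOmegaClosedCurve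

/-! ## The cumulative distribution representative -/

lemma cdfR_bv (νp νn : Measure ℝ) [IsFiniteMeasure νp] [IsFiniteMeasure νn] (c : ℝ) (s : Set ℝ) :
    BoundedVariationOn (cdfR νp νn c) s := by
  set m : ℝ → ℝ := fun t => νp.real (Iic t) + νn.real (Iic t) with hm
  have mp : ∀ ν : Measure ℝ, IsFiniteMeasure ν → Monotone (fun s => ν.real (Iic s)) :=
    fun ν _ a b hab => measureReal_mono (Iic_subset_Iic.mpr hab)
  have hmono : Monotone m := (mp νp inferInstance).add (mp νn inferInstance)
  have hb : BoundedVariationOn m s := by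
    refine (hmono.monotoneOn s).boundedVariationOn (C := νp.real univ + νn.real univ)
      fun x _ => ?_
    have h1 : νp.real (Iic x) ≤ νp.real univ := measureReal_mono (subset_univ _)
    have h2 : νn.real (Iic x) ≤ νn.real univ := measureReal_mono (subset_univ _)
    rw [abs_of_nonneg (by positivity)]
    simp only [hm]; linarith
  refine ne_top_of_le_ne_top hb ?_
  refine iSup_mono fun p => Finset.sum_le_sum fun i _ => ?_
  have hle : p.2.1 i ≤ p.2.1 (i + 1) := p.2.2.1 (Nat.le_succ i)
  have h1 := mp νp inferInstance hle
  have h2 := mp νn inferInstance hle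
  simp only at h1 h2
  rw [edist_dist, edist_dist, Real.dist_eq, Real.dist_eq]
  refine ENNReal.ofReal_le_ofReal ?_
  rw [abs_of_nonneg (sub_nonneg.mpr (hmono hle)), abs_le]
  simp only [hm, cdfR]
  constructor <;> linarith

lemma cdfL_ae (νp νn : Measure ℝ) [IsFiniteMeasure νp] [IsFiniteMeasure νn] (c : ℝ) :
    ∀ᵐ t, cdfL νp νn c t = cdfR νp νn c t := by
  have h : ∀ ν : Measure ℝ, IsFiniteMeasure ν → ∀ᵐ t, ν.real (Iio t) = ν.real (Iic t) := by
    intro ν _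
    have hc : {t : ℝ | 0 < ν {t}}.Countable :=
      Measure.countable_meas_pos_of_disjoint_iUnion (μ := ν) (As := fun t : ℝ => {t})
        (fun t => measurableSet_singleton t) (fun s t hst => by simpa using hst)
    filter_upwards [hc.ae_notMem volume] with t ht
    have h0 : ν {t} = 0 := by simpa using ht
    have : ν.real (Iio t ∪ {t}) = ν.real (Iio t) := by
      rw [measureReal_def, measureReal_def]
      congr 1
      refine le_antisymm ((measure_union_le _ _).trans (by rw [h0, add_zero]))
        (measure_mono subset_union_left)
    rw [← this, Iio_union_right]
  filter_upwards [h νp inferInstance, h νn inferInstance] with t h1 h2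
  unfold cdfL cdfR
  rw [h1, h2]

namespace SimpleOmegaClosedCurve

variable {Ω C : Set (EuclideanSpace ℝ (Fin 2))}

/-- identification of `u ∘ γ` with a cumulative distribution function -/
lemma exists_repr (Q : SimpleOmegaClosedCurve Ω C) (hΩ : IsOpen Ω) {νp νn : Measure ℝ}
    [IsFiniteMeasure νp] [IsFiniteMeasure νn] (hνp : νp Q.domᶜ = 0) (hνn : νn Q.domᶜ = 0)
    (hne : ∀ᵐ t ∂(volume.restrict Q.dom), deriv Q.γ t ≠ 0)
    {w : ℝ → ℝ} (hw : Measurable w) (hwi : Integrable w Q.speed)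
    (hstar : ∀ φ : E2 → ℝ, ContDiff ℝ (⊤ : ℕ∞) φ → HasCompactSupport φ → tsupport φ ⊆ Ω →
      (∫ t in Q.dom, w t * deriv (fun s => φ (Q.γ s)) t) +
        ((∫ t, φ (Q.γ t) ∂νp) - ∫ t, φ (Q.γ t) ∂νn) = 0) :
    ∃ c, ∀ᵐ t ∂(volume.restrict Q.dom), cdfR νp νn c t = w t := by
  have hIoc : MeasurableSet (Ioc (0 : ℝ) Q.len) := measurableSet_Ioc
  set W : ℝ → ℝ := (Ioc 0 Q.len).indicator w with hWd
  have hW : Measurable W := hw.indicator hIoc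
  have hWi : Integrable (fun t => W t * ‖deriv Q.γ t‖) := by
    rw [speed, integrable_withDensity_iff_integrable_smul (measurable_deriv Q.γ).nnnorm,
      Q.dom_restrict] at hwi
    have h1 := (integrable_indicator_iff hIoc).mpr hwi
    refine h1.congr (Eventually.of_forall fun t => ?_)
    by_cases ht : t ∈ Ioc 0 Q.len
    · simp only [hWd, indicator_of_mem ht, NNReal.smul_def, smul_eq_mul, coe_nnnorm]; ring
    · simp only [hWd, indicator_of_notMem ht, zero_mul]
  have hGi : LocallyIntegrable (fun t => ‖deriv Q.γ t‖) := by
    refine (locallyIntegrable_const (Q.K : ℝ)).mono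
      (measurable_deriv Q.γ).norm.aestronglyMeasurable (Eventually.of_forall fun t => ?_)
    rw [norm_norm, Real.norm_of_nonneg Q.K.coe_nonneg]
    exact lip_deriv_bound Q.lip t
  have hstar' : ∀ φ : E2 → ℝ, ContDiff ℝ (⊤ : ℕ∞) φ → HasCompactSupport φ → tsupport φ ⊆ Ω →
      (∫ t in Ioc 0 Q.len, W t * deriv (fun s => φ (Q.γ s)) t) +
        ((∫ t, φ (Q.γ t) ∂νp) - ∫ t, φ (Q.γ t) ∂νn) = 0 := by
    intro φ h1 h2 h3
    refine Eq.trans ?_ (hstar φ h1 h2 h3)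
    rw [Q.dom_restrict]
    refine congrArg₂ (· + ·) ?_ rfl
    refine setIntegral_congr_fun hIoc fun t ht => ?_
    simp only [hWd, indicator_of_mem ht]
  have hgood : ∀ᵐ t ∂(volume.restrict Q.dom), t ∈ Ioo 0 Q.len ∧ DifferentiableAt ℝ Q.γ t ∧
      deriv Q.γ t ≠ 0 ∧ LebPt (fun t => W t * ‖deriv Q.γ t‖) t ∧
      LebPt (fun t => ‖deriv Q.γ t‖) t := by
    filter_upwards [Q.ae_interior, ae_restrict_of_ae Q.lip.ae_differentiableAt_real, hne,
      ae_restrict_of_ae (lebPt_ae hWi.locallyIntegrable), ae_restrict_of_ae (lebPt_ae hGi)]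
      with t h1 h2 h3 h4 h5 using ⟨h1, h2, h3, h4, h5⟩
  have hnz : (volume.restrict Q.dom) ≠ 0 := by
    rw [Q.dom_restrict]
    intro h0
    have := congrArg (fun m : Measure ℝ => m univ) h0
    simp at this
    linarith [Q.len_pos]
  have : (ae (volume.restrict Q.dom)).NeBot := ae_neBot.mpr hnz
  obtain ⟨a, ha1, ha2, ha3, ha4, ha5⟩ := hgood.exists
  refine ⟨W a - (νp.real (Iic a) - νn.real (Iic a)), ?_⟩
  filter_upwards [hgood] with t ⟨h1, h2, h3, h4, h5⟩
  have hWt : W t = w t := indicator_of_mem (Ioo_subset_Ioc_self h1) _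
  rw [← hWt]
  set c := W a - (νp.real (Iic a) - νn.real (Iic a)) with hc
  have hca : cdfR νp νn c a = W a := by rw [hc]; unfold cdfR; ring
  rcases lt_trichotomy a t with h | h | h
  · have := Q.two_point hΩ hνp hνn hW hWi hGi hstar' ha1 h1 h ha2 ha3 h2 h3 ha4 ha5 h4 h5
    have := cdfR_sub νp νn c h.le
    linarith
  · rw [← h, hca]
  · have := Q.two_point hΩ hνp hνn hW hWi hGi hstar' h1 ha1 h h2 h3 ha2 ha3 h4 h5 ha4 ha5
    have := cdfR_sub νp νn c h.le
    linarith

/-- In the periodic case the total mass vanishes. -/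
lemma mass_zero (Q : SimpleOmegaClosedCurve Ω C) (hΩ : IsOpen Ω) {νp νn : Measure ℝ}
    [IsFiniteMeasure νp] [IsFiniteMeasure νn] (hp : Function.Periodic Q.γ Q.len)
    (hdom : Q.dom = Ico 0 Q.len) {w : ℝ → ℝ}
    (hstar : ∀ φ : E2 → ℝ, ContDiff ℝ (⊤ : ℕ∞) φ → HasCompactSupport φ → tsupport φ ⊆ Ω →
      (∫ t in Q.dom, w t * deriv (fun s => φ (Q.γ s)) t) +
        ((∫ t, φ (Q.γ t) ∂νp) - ∫ t, φ (Q.γ t) ∂νn) = 0) :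
    νp.real univ - νn.real univ = 0 := by
  have hall : ∀ t, Q.γ t ∈ Q.γ '' Icc 0 Q.len := by
    intro t
    obtain ⟨s, hs, e⟩ := hp.exists_mem_Ico₀ Q.len_pos t
    exact ⟨s, Ico_subset_Icc_self hs, e.symm⟩
  have hK1 : IsCompact (Q.γ '' Icc 0 Q.len) := isCompact_Icc.image Q.lip.continuous
  have hsub : Q.γ '' Icc 0 Q.len ⊆ Ω := by
    rintro _ ⟨t, -, rfl⟩
    obtain ⟨s, hs, e⟩ := hp.exists_mem_Ico₀ Q.len_pos t
    rw [e]
    exact Q.sub (Q.mem_C (by rw [hdom]; exact hs))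
  obtain ⟨T, hT, hT1, hT2⟩ := exists_compact_between hK1 hΩ hsub
  obtain ⟨f, hf1, hf0, hf⟩ := exists_contMDiffMap_one_nhds_of_subset_interior
    (n := (⊤ : ℕ∞)) (modelWithCornersSelf ℝ E2) hK1.isClosed hT1
  have hts : tsupport f ⊆ T := by
    apply closure_minimal _ hT.isClosed
    intro x hx
    by_contra hxT
    exact hx (hf0 x hxT)
  have h1 : ∀ t, f (Q.γ t) = 1 := fun t => hf1.self_of_nhdsSet _ (hall t)
  have := hstar f f.contMDiff.contDiff (HasCompactSupport.of_support_subset_isCompact hT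
    (subset_closure.trans hts)) (hts.trans hT2)
  simpa [h1] using this

/-- the renormalized identity in the parameter domain -/
lemma renorm (Q : SimpleOmegaClosedCurve Ω C) (hΩ : IsOpen Ω) {νp νn : Measure ℝ}
    [IsFiniteMeasure νp] [IsFiniteMeasure νn] (hνp : νp Q.domᶜ = 0) (hνn : νn Q.domᶜ = 0)
    (hmass : Function.Periodic Q.γ Q.len → Q.dom = Ico 0 Q.len →
      νp.real univ - νn.real univ = 0)
    (c : ℝ) {β : ℝ → ℝ} (hβ : ContDiff ℝ 1 β) {φ : E2 → ℝ}
    (hφ : ContDiff ℝ (⊤ : ℕ∞) φ) (hφc : HasCompactSupport φ) (hφs : tsupport φ ⊆ Ω) :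
    (∫ t in Q.dom, β (cdfR νp νn c t) * deriv (fun s => φ (Q.γ s)) t) +
      ((∫ t, φ (Q.γ t) * volpert β (cdfR νp νn c t) (cdfL νp νn c t) ∂νp) -
        ∫ t, φ (Q.γ t) * volpert β (cdfR νp νn c t) (cdfL νp νn c t) ∂νn) = 0 := by
  obtain ⟨hD, hD1, hD2, _, hC⟩ := Q.facts
  have hL := Q.len_pos
  obtain ⟨K, hK⟩ := Q.test_lip hφ hφc
  set ψ : ℝ → ℝ := fun t => φ (Q.γ t) with hψ
  set v := cdfR νp νn c with hv
  have hI : ∀ a b : ℝ, IntervalIntegrable (fun t => β (v t) * deriv ψ t) volume a b := by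
    intro a b
    obtain ⟨m, hm⟩ := (isCompact_Icc (a := -(|c| + (νp.real univ + νn.real univ)))
      (b := |c| + (νp.real univ + νn.real univ))).exists_bound_of_continuousOn
      hβ.continuous.continuousOn
    refine ((lip_ftc hK a b).1.norm.const_mul m).mono_fun'
      ((hβ.continuous.measurable.comp (cdfR_measurable νp νn c)).mul
        (measurable_deriv _)).aestronglyMeasurable (Eventually.of_forall fun t => ?_)
    simp only [norm_mul]
    gcongr
    exact hm _ (abs_le.mp (cdfR_bound νp νn c t))
  have hν0 : ∀ ν : Measure ℝ, ν Q.domᶜ = 0 → ∀ t < 0, ν.real (Iic t) = 0 := by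
    intro ν h t ht
    rw [measureReal_def, measure_mono_null _ h, ENNReal.toReal_zero]
    intro s hs hs'
    have := (hD2 hs').1
    have : s ≤ t := hs
    linarith
  have hνL : ∀ ν : Measure ℝ, ν Q.domᶜ = 0 → ν.real (Iic Q.len) = ν.real univ := by
    intro ν h
    rw [measureReal_def, measureReal_def]
    congr 1
    refine measure_congr (eventuallyEq_univ.mpr ?_)
    have : ∀ᵐ t ∂ν, t ∈ Q.dom := h
    filter_upwards [this] with t ht
    exact (hD2 ht).2.le
  have hvneg : ∀ t < 0, v t = c := by
    intro t ht
    simp only [hv, cdfR, hν0 νp hνp t ht, hν0 νn hνn t ht]; ring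
  have hvL : v Q.len = c + (νp.real univ - νn.real univ) := by
    simp only [hv, cdfR, hνL νp hνp, hνL νn hνn]
  have hi : ∀ (ν : Measure ℝ), ν Q.domᶜ = 0 → ∀ h : ℝ → ℝ,
      ∫ t in (-1)..Q.len, h t ∂ν = ∫ t, h t ∂ν := by
    intro ν hν h
    rw [intervalIntegral.integral_of_le (by linarith)]
    have : ν.restrict (Ioc (-1) Q.len) = ν := by
      refine Measure.restrict_eq_self_of_ae_mem ?_
      have : ∀ᵐ t ∂ν, t ∈ Q.dom := hν
      filter_upwards [this] with t ht
      exact ⟨by linarith [(hD2 ht).1], (hD2 ht).2.le⟩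
    rw [this]
  have hib := ibp hK hβ νp νn c (show (-1 : ℝ) < Q.len by linarith)
  rw [hi νp hνp, hi νn hνn, ← intervalIntegral.integral_add_adjacent_intervals (hI (-1) 0)
    (hI 0 Q.len)] at hib
  have h10 : ∫ t in (-1 : ℝ)..0, β (v t) * deriv ψ t = β c * (ψ 0 - ψ (-1)) := by
    rw [← (lip_ftc hK (-1) 0).2, ← intervalIntegral.integral_const_mul]
    refine intervalIntegral.integral_congr_ae ?_
    have hne : ∀ᵐ t : ℝ, t ≠ 0 := by simp [ae_iff]
    filter_upwards [hne] with t ht htm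
    rw [uIoc_of_le (by norm_num)] at htm
    rw [hvneg t (lt_of_le_of_ne htm.2 ht)]
  have hend : ψ Q.len * β (v Q.len) = ψ 0 * β c := by
    rcases Q.cases with ⟨hp, hdom, -, -⟩ | ⟨-, -, -, h0, hl, -⟩
    · rw [hvL, hmass hp hdom, add_zero]
      have := hp 0
      rw [zero_add] at this
      simp only [hψ, this]
    · have hfr : ∀ x ∈ frontier Ω, φ x = 0 := fun x hx => by
        rw [hΩ.frontier_eq] at hx
        by_contra hne
        exact hx.2 (hφs (subset_tsupport _ hne))
      simp only [hψ, hfr _ h0, hfr _ hl, zero_mul]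
  rw [Q.dom_restrict, ← intervalIntegral.integral_of_le hL.le]
  have hvm : v (-1) = c := hvneg _ (by norm_num)
  rw [h10] at hib
  have hib' : (∫ t in (0 : ℝ)..Q.len, β (v t) * deriv ψ t) +
      ((∫ t, ψ t * volpert β (v t) (cdfL νp νn c t) ∂νp) -
        ∫ t, ψ t * volpert β (v t) (cdfL νp νn c t) ∂νn) =
      ψ Q.len * β (v Q.len) - ψ (-1) * β (v (-1)) - β c * (ψ 0 - ψ (-1)) := by
    rw [← hib]; ring
  rw [hend, hvm] at hib'
  exact hib'.trans (by ring)

end SimpleOmegaClosedCurve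

/-- **Traces and renormalization along a curve.**
Let `C` be a simple `Ω`-closed Lipschitz curve, `B` a bounded Borel field of unit norm,
tangent to `C` `H¹`-a.e., with `div (B H¹⌐C) = 0` in `D'(Ω)`.  If `u ∈ L¹(H¹⌐C)` and the
finite signed measure `μ = μp - μn` concentrated on `C` satisfy `div (u B H¹⌐C) = μ` in
`D'(Ω)`, then along every parametrization `γ` agreeing with `B` the function `u ∘ γ` has
bounded variation, and, denoting by `v⁺`/`v⁻` its right/left continuous representatives
and `μ_γ` the lift of `μ`, one has `div (β(u) B H¹⌐C) = f(v⁺,v⁻)·μ` for every `β ∈ C¹(ℝ)`,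
with `f` the Vol'pert averaged superposition. -/
theorem traces_and_renormalization_along_curve
    (Ω : Set (EuclideanSpace ℝ (Fin 2))) (hΩ : IsOpen Ω)
    (C : Set (EuclideanSpace ℝ (Fin 2)))
    (B : EuclideanSpace ℝ (Fin 2) → EuclideanSpace ℝ (Fin 2))
    (hBmeas : Measurable B) (MB : ℝ) (hBbd : ∀ x, ‖B x‖ ≤ MB)
    (hBnorm : ∀ᵐ x ∂((μH[1] : Measure (EuclideanSpace ℝ (Fin 2))).restrict C), ‖B x‖ = 1)
    (P₀ : SimpleOmegaClosedCurve Ω C) (g₀ : ℝ → EuclideanSpace ℝ (Fin 2))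
    (htang : ∀ᵐ t ∂(volume.restrict P₀.dom),
      HasDerivAt P₀.γ (g₀ t) t ∧ g₀ t ≠ 0 ∧ ∃ c : ℝ, g₀ t = c • B (P₀.γ t))
    (hdiv : ∀ φ : EuclideanSpace ℝ (Fin 2) → ℝ, ContDiff ℝ (⊤ : ℕ∞) φ → HasCompactSupport φ →
      tsupport φ ⊆ Ω → (∫ x in C, ⟪B x, gradient φ x⟫ ∂μH[1]) = 0)
    (u : EuclideanSpace ℝ (Fin 2) → ℝ) (humeas : Measurable u)
    (hu : IntegrableOn u C μH[1])
    (μp μn : Measure (EuclideanSpace ℝ (Fin 2)))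
    [IsFiniteMeasure μp] [IsFiniteMeasure μn] (hμp : μp Cᶜ = 0) (hμn : μn Cᶜ = 0)
    (heq : ∀ φ : EuclideanSpace ℝ (Fin 2) → ℝ, ContDiff ℝ (⊤ : ℕ∞) φ → HasCompactSupport φ →
      tsupport φ ⊆ Ω →
      (∫ x in C, u x * ⟪B x, gradient φ x⟫ ∂μH[1])
        + ((∫ x, φ x ∂μp) - (∫ x, φ x ∂μn)) = 0) :
    ∀ (Q : SimpleOmegaClosedCurve Ω C) (g : ℝ → EuclideanSpace ℝ (Fin 2)),
      AgreesWith Q g B →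
      ∀ νp νn : Measure ℝ, νp Q.domᶜ = 0 → νn Q.domᶜ = 0 →
        Measure.map Q.γ νp = μp → Measure.map Q.γ νn = μn →
        (∃ w : ℝ → ℝ, (∀ᵐ t ∂(volume.restrict Q.dom), w t = u (Q.γ t)) ∧
          BoundedVariationOn w Q.dom) ∧
        ∃ vp vm : ℝ → ℝ,
          (∀ᵐ t ∂(volume.restrict Q.dom), vp t = u (Q.γ t)) ∧
          (∀ t ∈ Q.dom, ContinuousWithinAt vp (Set.Ici t) t) ∧
          (∀ᵐ t ∂(volume.restrict Q.dom), vm t = u (Q.γ t)) ∧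
          (∀ t ∈ Q.dom, ContinuousWithinAt vm (Set.Iic t) t) ∧
          ∀ β : ℝ → ℝ, ContDiff ℝ 1 β →
            ∀ φ : EuclideanSpace ℝ (Fin 2) → ℝ, ContDiff ℝ (⊤ : ℕ∞) φ → HasCompactSupport φ →
              tsupport φ ⊆ Ω →
              (∫ x in C, β (u x) * ⟪B x, gradient φ x⟫ ∂μH[1])
                + ((∫ t, φ (Q.γ t) * volpert β (vp t) (vm t) ∂νp)
                   - (∫ t, φ (Q.γ t) * volpert β (vp t) (vm t) ∂νn)) = 0 := by
  intro Q g hA νp νn hνp hνn hmp hmn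
  have hγm : Measurable Q.γ := Q.lip.continuous.measurable
  have hfin : ∀ (ν : Measure ℝ) (μ : Measure E2), IsFiniteMeasure μ → Measure.map Q.γ ν = μ →
      IsFiniteMeasure ν := by
    intro ν μ hμ h
    refine ⟨?_⟩
    have : ν univ = μ univ := by rw [← h, Measure.map_apply hγm MeasurableSet.univ, preimage_univ]
    rw [this]
    exact measure_lt_top μ univ
  have fp := hfin νp μp inferInstance hmp
  have fn := hfin νn μn inferInstance hmn
  have htan := P₀.tangent_ae Q hΩ hBnorm htang hA
  have hstar : ∀ φ : E2 → ℝ, ContDiff ℝ (⊤ : ℕ∞) φ → HasCompactSupport φ → tsupport φ ⊆ Ω →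
      (∫ t in Q.dom, u (Q.γ t) * deriv (fun s => φ (Q.γ s)) t) +
        ((∫ t, φ (Q.γ t) ∂νp) - ∫ t, φ (Q.γ t) ∂νn) = 0 := by
    intro φ h1 h2 h3
    have h := heq φ h1 h2 h3
    rw [Q.change_var hBmeas htan humeas h1, ← hmp, ← hmn,
      integral_map hγm.aemeasurable h1.continuous.aestronglyMeasurable,
      integral_map hγm.aemeasurable h1.continuous.aestronglyMeasurable] at h
    exact h
  obtain ⟨c, hc⟩ := Q.exists_repr hΩ hνp hνn (htan.mono fun t h => h.2.1)
    (humeas.comp hγm) (Q.speed_integrable hu humeas) hstar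
  have hc' : ∀ᵐ t ∂(volume.restrict Q.dom), cdfR νp νn c t = u (Q.γ t) := hc
  refine ⟨⟨cdfR νp νn c, hc', cdfR_bv νp νn c _⟩, cdfR νp νn c, cdfL νp νn c, hc',
    fun t _ => cdfR_tendsto_right νp νn c t, ?_, fun t _ => cdfL_tendsto_left νp νn c t, ?_⟩
  · filter_upwards [hc', ae_restrict_of_ae (cdfL_ae νp νn c)] with t h1 h2
    rw [h2, h1]
  · intro β hβ φ h1 h2 h3
    have hr := Q.renorm hΩ hνp hνn (fun hp hd => Q.mass_zero hΩ hp hd hstar) c hβ h1 h2 h3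
    rw [Q.change_var hBmeas htan (h := fun x => β (u x))
      (hβ.continuous.measurable.comp humeas) h1]
    refine Eq.trans (congrArg₂ (· + ·) (integral_congr_ae ?_) rfl) hr
    filter_upwards [hc'] with t ht
    simp only [ht]
end
end
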